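/- arXiv:2303.05997 — 3 statements merged into one kernel-verified Lean document; each statement's English description precedes it below -/
import Mathlib

section
/- Let q ≥ 2 be an integer, let f be a nonzero M_q-function, and let a_0(z)f(z) + a_1(z)f(z^q) + ⋯ + a_n(z)f(z^{q^n}) = 0 be its minimal q-Mahler equation (an equation of minimal order n among all nonzero σ_q-operators annihilating f). If α is an algebraic number with 0 < |α| < 1 which is not a pole of f and f(α) = 0, then α is a singularity of this equation: there exists an integer ℓ ≥ 0 such that a_0(α^{q^ℓ})a_n(α^{q^ℓ}) = 0. -/
noncomputable section

/-- The derivative `d/dz` of a formal power series over `ℂ`. -/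
def psD (f : PowerSeries ℂ) : PowerSeries ℂ :=
  PowerSeries.mk fun n => ((n : ℂ) + 1) * PowerSeries.coeff (n + 1) f

/-- The Mahler operator `σ_q : f(z) ↦ f(z^q)` on formal power series over `ℂ`. -/
def psSigma (q : ℕ) (f : PowerSeries ℂ) : PowerSeries ℂ :=
  PowerSeries.mk fun n => if q ∣ n then PowerSeries.coeff (n / q) f else 0

/-- The canonical embedding of polynomials into power series. -/
def polyPS : Polynomial ℂ →+* PowerSeries ℂ := Polynomial.coeToPowerSeries.ringHom

/-- The power series `∑ (a n / n!) zⁿ` attached to a sequence `a` of coefficients. -/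
def ePS (a : ℕ → ℂ) : PowerSeries ℂ := PowerSeries.mk fun n => a n / (n.factorial : ℂ)

/-- `IsE a` : the power series `∑ (a n / n!) zⁿ` is an E-function: its coefficients are
algebraic, it satisfies a nonzero linear differential equation over `ℚ̄[z]`, and the size of
the conjugates of the `a n` as well as their common denominators grow at most geometrically. -/
def IsE (a : ℕ → ℂ) : Prop :=
  (∀ n, IsAlgebraic ℚ (a n)) ∧
  (∃ (m : ℕ) (p : ℕ → Polynomial ℂ),
      (∀ i k, IsAlgebraic ℚ ((p i).coeff k)) ∧ (∃ i, i ≤ m ∧ p i ≠ 0) ∧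
      ∑ i ∈ Finset.range (m + 1), polyPS (p i) * psD^[i] (ePS a) = 0) ∧
  (∃ C : ℝ, 0 < C ∧ ∃ d : ℕ → ℕ, ∀ n : ℕ, 1 ≤ n →
      1 ≤ d n ∧ (d n : ℝ) ≤ C ^ n ∧
      (∀ σ : (integralClosure ℚ ℂ) →+* ℂ, ∀ h : a n ∈ integralClosure ℚ ℂ,
        ‖σ ⟨a n, h⟩‖ ≤ C ^ n) ∧
      (∀ i, 1 ≤ i → i ≤ n → IsIntegral ℤ ((d n : ℂ) * a i)))

/-- The value at `α` of the E-function with coefficient sequence `a`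
(E-functions are entire, so this series converges for all `α`). -/
def evalE (a : ℕ → ℂ) (α : ℂ) : ℂ := ∑' n : ℕ, a n / (n.factorial : ℂ) * α ^ n

/-- `IsM q f` : the formal power series `f` is an M_q-function, i.e. it has algebraic
coefficients and satisfies a linear `σ_q`-difference equation over `ℚ̄[z]` with
not-all-zero polynomial coefficients. -/
def IsM (q : ℕ) (f : PowerSeries ℂ) : Prop :=
  (∀ n, IsAlgebraic ℚ (PowerSeries.coeff n f)) ∧
  ∃ (m : ℕ) (p : ℕ → Polynomial ℂ),
    (∀ i k, IsAlgebraic ℚ ((p i).coeff k)) ∧ (∃ i, i ≤ m ∧ p i ≠ 0) ∧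
    ∑ i ∈ Finset.range (m + 1), polyPS (p i) * (psSigma q)^[i] f = 0

/-- `MahlerValue f α v` : the meromorphic extension of (the sum of) the power series `f`
to the open unit disk has no pole at `α` and takes the value `v` there. -/
def MahlerValue (f : PowerSeries ℂ) (α v : ℂ) : Prop :=
  ∃ F : ℂ → ℂ, MeromorphicOn F (Metric.ball (0 : ℂ) 1) ∧
    (∀ᶠ z in nhds (0 : ℂ), HasSum (fun n => PowerSeries.coeff n f * z ^ n) (F z)) ∧
    AnalyticAt ℂ F α ∧ F α = v

/-- The power series `f` converges (hence defines an analytic function) on the open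
disk `D(0,R)`. -/
def AnOnBall (f : PowerSeries ℂ) (R : ℝ) : Prop :=
  ∀ z : ℂ, ‖z‖ < R → Summable fun n => PowerSeries.coeff n f * z ^ n

/-- The value at `z` of (the sum of) the power series `f`. -/
def psEval (f : PowerSeries ℂ) (z : ℂ) : ℂ := ∑' n : ℕ, PowerSeries.coeff n f * z ^ n

/-- `Banal fv α P` : the homogeneous algebraic relation `P` among the values at `α` of the
power series `fv 1, …, fv r` is banal: it is the specialization at `z = α` of some
`Q ∈ ℚ̄[z, X₁, …, X_r]`, homogeneous in `X₁, …, X_r`, with `Q(z, fv 1, …, fv r) = 0`. -/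
def Banal {r : ℕ} (fv : Fin r → PowerSeries ℂ) (α : ℂ) (P : MvPolynomial (Fin r) ℂ) : Prop :=
  ∃ Q : MvPolynomial (Fin r) (Polynomial ℂ),
    (∀ v k, IsAlgebraic ℚ ((MvPolynomial.coeff v Q).coeff k)) ∧
    (∃ e, Q.IsHomogeneous e) ∧
    MvPolynomial.eval₂ polyPS fv Q = 0 ∧
    MvPolynomial.map (Polynomial.evalRingHom α) Q = P

/-- `Eset S` : the set of values at `z = 1` of all E-functions with coefficients in `S`. -/
def Eset (S : Set ℂ) : Set ℂ :=
  {x | ∃ a : ℕ → ℂ, IsE a ∧ (∀ n, a n ∈ S) ∧ x = evalE a 1}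

/-- `Mset q α S` : the set of values at `α` of all M_q-functions with coefficients in `S`
having no pole at `α`. -/
def Mset (q : ℕ) (α : ℂ) (S : Set ℂ) : Set ℂ :=
  {x | ∃ f : PowerSeries ℂ, IsM q f ∧ (∀ n, PowerSeries.coeff n f ∈ S) ∧ MahlerValue f α x}

section

open PowerSeries LaurentSeries Polynomial
open scoped RatFunc

theorem isIntegralElem_norm {R K L : Type*} [CommRing R] [Field K] [Field L] [Algebra K L]
    (i : R →+* K) {x : L} (hx : ((algebraMap K L).comp i).IsIntegralElem x) :
    i.IsIntegralElem (Algebra.norm K x) := by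
  let _ := i.toAlgebra
  let _ := ((algebraMap K L).comp i).toAlgebra
  have : IsScalarTower R K L := IsScalarTower.of_algebraMap_eq fun _ => rfl
  exact Algebra.isIntegral_norm (R := R) K hx

theorem isIntegralElem_pow_mul_coeff_zero_minpoly {R K L : Type*} [CommRing R] [Field K] [Field L]
    [Algebra K L] (i : R →+* K) (u : K) {x : L} (hK : IsIntegral K x)
    (hx : ((algebraMap K L).comp i).IsIntegralElem (algebraMap K L u * x)) :
    i.IsIntegralElem (u ^ (minpoly K x).natDegree * (minpoly K x).coeff 0) := by
  have hx' : ((algebraMap K (IntermediateField.adjoin K {x})).comp i).IsIntegralElem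
      (algebraMap K (IntermediateField.adjoin K {x}) u * IntermediateField.AdjoinSimple.gen K x) := by
    obtain ⟨p, hp, h⟩ := hx
    refine ⟨p, hp, (algebraMap (IntermediateField.adjoin K {x}) L).injective ?_⟩
    rw [Polynomial.hom_eval₂, map_zero, ← h]
    rfl
  have h1 := isIntegralElem_norm i hx'
  have h2 := Algebra.PowerBasis.norm_gen_eq_coeff_zero_minpoly
    (IntermediateField.adjoin.powerBasis hK)
  rw [IntermediateField.adjoin.powerBasis_gen, IntermediateField.adjoin.powerBasis_dim,
    IntermediateField.minpoly_gen] at h2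
  rw [map_mul, Algebra.norm_algebraMap, IntermediateField.adjoin.finrank hK, h2] at h1
  have h3 : i.IsIntegralElem ((-1) ^ (minpoly K x).natDegree) := by
    have : ((-1 : K) ^ (minpoly K x).natDegree) = i ((-1) ^ (minpoly K x).natDegree) := by simp
    rw [this]; exact i.isIntegralElem_map
  have := RingHom.IsIntegralElem.mul i h1 h3
  have h4 : (-1 : K) ^ (minpoly K x).natDegree * (-1) ^ (minpoly K x).natDegree = 1 := by
    rw [← mul_pow]; simp
  have h5 : u ^ (minpoly K x).natDegree * ((-1) ^ (minpoly K x).natDegree * (minpoly K x).coeff 0) *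
      (-1) ^ (minpoly K x).natDegree = u ^ (minpoly K x).natDegree * (minpoly K x).coeff 0 := by
    linear_combination (u ^ (minpoly K x).natDegree * (minpoly K x).coeff 0) * h4
  rwa [h5] at this

theorem valuation_le_one_of_isIntegralElem {R K Γ : Type*} [CommRing R] [Field K]
    [LinearOrderedCommGroupWithZero Γ] (v : Valuation K Γ) (i : R →+* K) (hi : ∀ r, v (i r) ≤ 1)
    {x : K} (hx : i.IsIntegralElem x) : v x ≤ 1 := by
  obtain ⟨p, hp, h⟩ := hx
  by_contra! hlt
  rw [Polynomial.eval₂_eq_sum_range, Finset.sum_range_succ, hp.coeff_natDegree, map_one, one_mul,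
    add_comm] at h
  have h0 : v (x ^ p.natDegree) = v (∑ j ∈ Finset.range p.natDegree, i (p.coeff j) * x ^ j) := by
    rw [eq_neg_of_add_eq_zero_left h, Valuation.map_neg]
  have hne : v (x ^ p.natDegree) ≠ 0 := by
    have : v x ≠ 0 := (lt_trans zero_lt_one hlt).ne'
    simp [this]
  refine absurd h0 (ne_of_gt (v.map_sum_lt hne fun j hj => ?_))
  rw [map_mul, map_pow, map_pow]
  calc v (i (p.coeff j)) * v x ^ j ≤ 1 * v x ^ j := by gcongr; exact hi _
    _ < v x ^ p.natDegree := by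
      rw [one_mul]; exact pow_lt_pow_right₀ hlt (Finset.mem_range.1 hj)

/-- The embedding of polynomials in `1 / z` into rational functions. -/
def invPoly : ℂ[X] →+* RatFunc ℂ := (Polynomial.aeval (RatFunc.X : RatFunc ℂ)⁻¹).toRingHom

theorem algebraMap_polynomial_laurent (p : ℂ[X]) :
    algebraMap ℂ[X] ℂ⸨X⸩ p = algebraMap ℂ⟦X⟧ ℂ⸨X⸩ (p : ℂ⟦X⟧) := by
  rw [LaurentSeries.coe_algebraMap, RatFunc.coe_coe]
  exact IsScalarTower.algebraMap_apply ℂ[X] (RatFunc ℂ) ℂ⸨X⸩ p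

open Classical in
theorem natDegree_le_of_isIntegralElem_invPoly {c : ℂ[X]} {D : ℕ}
    (h : invPoly.IsIntegralElem ((RatFunc.X⁻¹ : RatFunc ℂ) ^ D * algebraMap ℂ[X] (RatFunc ℂ) c)) :
    c.natDegree ≤ D := by
  by_cases hc : c = 0
  · simp [hc]
  have hX : RatFunc.inftyValuation ℂ (RatFunc.X)⁻¹ ≤ 1 := by
    rw [map_inv₀, RatFunc.inftyValuation.X]
    rw [← WithZero.exp_neg, ← WithZero.exp_zero, WithZero.exp_le_exp]; norm_num
  have := valuation_le_one_of_isIntegralElem (RatFunc.inftyValuation ℂ) invPoly (fun r => by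
    have : invPoly r = ∑ j ∈ Finset.range (r.natDegree + 1),
        algebraMap ℂ (RatFunc ℂ) (r.coeff j) * (RatFunc.X⁻¹ : RatFunc ℂ) ^ j := by
      simp [invPoly, Polynomial.aeval_eq_sum_range, Algebra.smul_def]
    rw [this]
    refine Valuation.map_sum_le _ fun j _ => ?_
    rw [map_mul, map_pow]
    refine mul_le_one' ?_ (pow_le_one' hX _)
    rw [RatFunc.algebraMap_eq_C]
    by_cases h0 : r.coeff j = 0
    · simp [h0]
    · rw [RatFunc.inftyValuation.C ℂ h0]) h
  rw [map_mul, map_pow, map_inv₀, RatFunc.inftyValuation.X, RatFunc.inftyValuation_apply,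
    RatFunc.inftyValuation.polynomial ℂ hc, ← WithZero.exp_neg, ← WithZero.exp_nsmul,
    ← WithZero.exp_add, ← WithZero.exp_zero, WithZero.exp_le_exp] at this
  simp at this
  omega

/-- A nonzero power series which is integral over `ℂ[z]`, of degree at most `N`, and with a pole
of order at most `d` at infinity, has order at most `N * d` at the origin. -/
theorem exists_coeff_ne_zero_of_isIntegral {S : ℂ⟦X⟧} (hS : S ≠ 0) {N d : ℕ}
    (hint : IsIntegral ℂ[X] (algebraMap ℂ⟦X⟧ ℂ⸨X⸩ S))
    (hinf : ((algebraMap (RatFunc ℂ) ℂ⸨X⸩).comp invPoly).IsIntegralElem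
      (algebraMap (RatFunc ℂ) ℂ⸨X⸩ (RatFunc.X⁻¹ ^ d) * algebraMap ℂ⟦X⟧ ℂ⸨X⸩ S))
    (hdeg : (minpoly (RatFunc ℂ) (algebraMap ℂ⟦X⟧ ℂ⸨X⸩ S)).natDegree ≤ N) :
    ∃ j ≤ N * d, PowerSeries.coeff j S ≠ 0 := by
  set x := algebraMap ℂ⟦X⟧ ℂ⸨X⸩ S with hx
  have hinj : Function.Injective (algebraMap ℂ⟦X⟧ ℂ⸨X⸩) := IsFractionRing.injective _ _
  have hx0 : x ≠ 0 := by rw [hx, Ne, map_eq_zero_iff _ hinj]; exact hS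
  have hK : IsIntegral (RatFunc ℂ) x := hint.tower_top
  have h1 := isIntegralElem_pow_mul_coeff_zero_minpoly invPoly (RatFunc.X⁻¹ ^ d) hK hinf
  have hmin : minpoly (RatFunc ℂ) x = (minpoly ℂ[X] x).map (algebraMap ℂ[X] (RatFunc ℂ)) :=
    minpoly.isIntegrallyClosed_eq_field_fractions (RatFunc ℂ) ℂ⸨X⸩ hint
  have hc0 := minpoly.coeff_zero_ne_zero hK hx0
  set P := minpoly ℂ[X] x with hP
  rw [hmin, Polynomial.coeff_map] at h1 hc0
  rw [← pow_mul] at h1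
  have h2 := natDegree_le_of_isIntegralElem_invPoly h1
  have hc : P.coeff 0 ≠ 0 := fun h => hc0 (by rw [h, map_zero])
  have hle : (P.coeff 0).natDegree ≤ N * d := by
    rw [hmin] at hdeg
    refine h2.trans ?_
    rw [mul_comm]; gcongr
  have hdvd : S ∣ (P.coeff 0 : ℂ⟦X⟧) := by
    have h3 : Polynomial.aeval x P = 0 := minpoly.aeval _ _
    refine ⟨-Polynomial.eval₂ (Polynomial.coeToPowerSeries.ringHom) S P.divX, hinj ?_⟩
    rw [← Polynomial.divX_mul_X_add P, map_add, map_mul, Polynomial.aeval_X,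
      Polynomial.aeval_C, algebraMap_polynomial_laurent] at h3
    rw [map_mul, map_neg, Polynomial.hom_eval₂, ← hx]
    have h4 : Polynomial.eval₂ ((algebraMap ℂ⟦X⟧ ℂ⸨X⸩).comp Polynomial.coeToPowerSeries.ringHom) x
        P.divX = Polynomial.aeval x P.divX := by
      rw [Polynomial.aeval_def]
      congr 1
    rw [h4]
    linear_combination h3
  by_contra! hall
  have h5 : (PowerSeries.X : ℂ⟦X⟧) ^ (N * d + 1) ∣ (P.coeff 0 : ℂ⟦X⟧) :=
    (PowerSeries.X_pow_dvd_iff.2 fun m hm => hall m (by omega)).trans hdvd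
  rw [PowerSeries.X_pow_dvd_iff] at h5
  have h6 := h5 (P.coeff 0).natDegree (by omega)
  rw [Polynomial.coeff_coe] at h6
  exact hc (Polynomial.leadingCoeff_eq_zero.1 h6)

end

section

open PowerSeries LaurentSeries Polynomial
open scoped RatFunc

theorem RingHom.IsIntegralElem.map_of_comp_eq {R S : Type*} [CommRing R] [CommRing S]
    {i : R →+* S} {ρ : S →+* S} {s : R →+* R} (h : ρ.comp i = i.comp s) {x : S}
    (hx : i.IsIntegralElem x) : i.IsIntegralElem (ρ x) := by
  obtain ⟨p, hp, hpx⟩ := hx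
  refine ⟨p.map s, hp.map s, ?_⟩
  rw [Polynomial.eval₂_map, ← h, ← Polynomial.hom_eval₂, hpx, map_zero]

/-- The substitution `z ↦ ω z` on Laurent series. -/
def laurentRescale (ω : ℂˣ) : ℂ⸨X⸩ →+* ℂ⸨X⸩ :=
  IsFractionRing.lift (A := ℂ⟦X⟧) (g := (algebraMap ℂ⟦X⟧ ℂ⸨X⸩).comp (PowerSeries.rescale (ω : ℂ)))
    ((IsFractionRing.injective ℂ⟦X⟧ ℂ⸨X⸩).comp (PowerSeries.rescale_injective ω.ne_zero))

theorem laurentRescale_algebraMap (ω : ℂˣ) (f : ℂ⟦X⟧) :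
    laurentRescale ω (algebraMap ℂ⟦X⟧ ℂ⸨X⸩ f) =
      algebraMap ℂ⟦X⟧ ℂ⸨X⸩ (PowerSeries.rescale (ω : ℂ) f) :=
  IsFractionRing.lift_algebraMap _ f

theorem rescale_coe_polynomial (ω : ℂ) (p : ℂ[X]) :
    PowerSeries.rescale ω (p : ℂ⟦X⟧) = ((p.comp (Polynomial.C ω * Polynomial.X) : ℂ[X]) : ℂ⟦X⟧) := by
  ext m
  rw [PowerSeries.coeff_rescale, Polynomial.coeff_coe, Polynomial.coeff_coe,
    Polynomial.comp_C_mul_X_coeff, mul_comm]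

theorem laurentRescale_comp_algebraMap (ω : ℂˣ) :
    (laurentRescale ω).comp (algebraMap ℂ[X] ℂ⸨X⸩) =
      (algebraMap ℂ[X] ℂ⸨X⸩).comp (Polynomial.compRingHom (Polynomial.C (ω : ℂ) * Polynomial.X)) := by
  refine RingHom.ext fun p => ?_
  rw [RingHom.comp_apply, RingHom.comp_apply, algebraMap_polynomial_laurent,
    laurentRescale_algebraMap, rescale_coe_polynomial, algebraMap_polynomial_laurent,
    Polynomial.coe_compRingHom_apply]

theorem laurentRescale_mul (ω ω' : ℂˣ) (x : ℂ⸨X⸩) :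
    laurentRescale ω (laurentRescale ω' x) = laurentRescale (ω * ω') x := by
  have : (laurentRescale ω).comp (laurentRescale ω') = laurentRescale (ω * ω') := by
    refine IsLocalization.ringHom_ext (nonZeroDivisors ℂ⟦X⟧) (RingHom.ext fun f => ?_)
    simp only [RingHom.comp_apply, laurentRescale_algebraMap, Units.val_mul]
    rw [PowerSeries.rescale_mul, RingHom.comp_apply]
    congr 1
    ext m
    simp only [PowerSeries.coeff_rescale]; ring
  exact congrArg (fun g : ℂ⸨X⸩ →+* ℂ⸨X⸩ => g x) this

theorem laurentRescale_one (x : ℂ⸨X⸩) : laurentRescale 1 x = x := by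
  have : laurentRescale 1 = RingHom.id _ := by
    refine IsLocalization.ringHom_ext (nonZeroDivisors ℂ⟦X⟧) (RingHom.ext fun f => ?_)
    rw [RingHom.comp_apply, laurentRescale_algebraMap, Units.val_one, PowerSeries.rescale_one]
    rfl
  rw [this]; rfl

theorem laurentRescale_algebraMap_ratFunc (ω : ℂˣ) (r : RatFunc ℂ) :
    laurentRescale ω (algebraMap (RatFunc ℂ) ℂ⸨X⸩ r) ∈ (algebraMap (RatFunc ℂ) ℂ⸨X⸩).range := by
  induction r using RatFunc.induction_on with
  | f p p' h =>
    have hp (p : ℂ[X]) : laurentRescale ω (algebraMap (RatFunc ℂ) ℂ⸨X⸩ (algebraMap _ _ p)) ∈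
        (algebraMap (RatFunc ℂ) ℂ⸨X⸩).range := by
      rw [← IsScalarTower.algebraMap_apply]
      rw [← RingHom.comp_apply, laurentRescale_comp_algebraMap, RingHom.comp_apply,
        IsScalarTower.algebraMap_apply ℂ[X] (RatFunc ℂ) ℂ⸨X⸩]
      exact ⟨_, rfl⟩
    obtain ⟨x, hx⟩ := hp p
    obtain ⟨y, hy⟩ := hp p'
    exact ⟨x / y, by rw [map_div₀, map_div₀, map_div₀, hx, hy]⟩

theorem laurentRescale_X_inv (ω : ℂˣ) :
    laurentRescale ω (algebraMap (RatFunc ℂ) ℂ⸨X⸩ RatFunc.X⁻¹) =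
      algebraMap (RatFunc ℂ) ℂ⸨X⸩ (RatFunc.C ((ω : ℂ)⁻¹) * RatFunc.X⁻¹) := by
  have h := congrArg (fun g : ℂ[X] →+* ℂ⸨X⸩ => g Polynomial.X) (laurentRescale_comp_algebraMap ω)
  simp only [RingHom.comp_apply, Polynomial.coe_compRingHom_apply, Polynomial.X_comp,
    IsScalarTower.algebraMap_apply ℂ[X] (RatFunc ℂ) ℂ⸨X⸩, RatFunc.algebraMap_X, map_mul,
    RatFunc.algebraMap_C] at h
  simp only [map_inv₀, h, map_mul, mul_inv]

theorem laurentRescale_comp_invPoly (ω : ℂˣ) :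
    (laurentRescale ω).comp ((algebraMap (RatFunc ℂ) ℂ⸨X⸩).comp invPoly) =
      ((algebraMap (RatFunc ℂ) ℂ⸨X⸩).comp invPoly).comp
        (Polynomial.compRingHom (Polynomial.C ((ω : ℂ)⁻¹) * Polynomial.X)) := by
  refine Polynomial.ringHom_ext (fun c => ?_) ?_
  · have h := congrArg (fun g : ℂ[X] →+* ℂ⸨X⸩ => g (Polynomial.C c))
      (laurentRescale_comp_algebraMap ω)
    simp only [RingHom.comp_apply, Polynomial.coe_compRingHom_apply, Polynomial.C_comp,
      IsScalarTower.algebraMap_apply ℂ[X] (RatFunc ℂ) ℂ⸨X⸩, RatFunc.algebraMap_C] at h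
    simp [invPoly, h, RatFunc.algebraMap_eq_C]
  · simp [invPoly, laurentRescale_X_inv, RatFunc.algebraMap_eq_C, -map_inv₀]

theorem X_inv_pow_mul_mem_range_invPoly {c : ℂ[X]} {D : ℕ} (h : c.natDegree ≤ D) :
    (RatFunc.X⁻¹ : RatFunc ℂ) ^ D * algebraMap ℂ[X] (RatFunc ℂ) c ∈ invPoly.range := by
  rw [Polynomial.as_sum_range_C_mul_X_pow c, map_sum, Finset.mul_sum]
  refine Subring.sum_mem _ fun j hj => ⟨Polynomial.C (c.coeff j) * Polynomial.X ^ (D - j), ?_⟩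
  have hj' : j ≤ D := by have := Finset.mem_range.1 hj; omega
  have hX : (RatFunc.X : RatFunc ℂ) ≠ 0 := RatFunc.X_ne_zero
  obtain ⟨e, rfl⟩ := Nat.exists_eq_add_of_le hj'
  simp only [invPoly, AlgHom.toRingHom_eq_coe, RingHom.coe_coe, map_mul, Polynomial.aeval_C,
    map_pow, Polynomial.aeval_X, RatFunc.algebraMap_C, RatFunc.algebraMap_X,
    RatFunc.algebraMap_eq_C, Nat.add_sub_cancel_left]
  rw [pow_add, inv_pow, inv_pow]
  field_simp

theorem exists_isIntegralElem_invPoly {h : ℂ⸨X⸩} (hh : IsIntegral ℂ[X] h) :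
    ∃ d : ℕ, ((algebraMap (RatFunc ℂ) ℂ⸨X⸩).comp invPoly).IsIntegralElem
      (algebraMap (RatFunc ℂ) ℂ⸨X⸩ (RatFunc.X⁻¹ ^ d) * h) := by
  obtain ⟨p, hp, hph⟩ := hh
  set d := ∑ j ∈ Finset.range (p.natDegree + 1), (p.coeff j).natDegree with hd
  refine ⟨d, ?_⟩
  set P := (p.map (algebraMap ℂ[X] (RatFunc ℂ))).scaleRoots ((RatFunc.X⁻¹ : RatFunc ℂ) ^ d)
    with hPdef
  have hPm : P.Monic := (Polynomial.monic_scaleRoots_iff _).2 (hp.map _)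
  have hlift : P ∈ Polynomial.lifts invPoly := by
    rw [Polynomial.lifts_iff_coeff_lifts]
    intro j
    rw [hPdef, Polynomial.coeff_scaleRoots, Polynomial.coeff_map, hp.natDegree_map, ← pow_mul,
      mul_comm]
    rcases lt_or_ge j p.natDegree with hj | hj
    · refine RingHom.mem_range.1 (X_inv_pow_mul_mem_range_invPoly ?_)
      calc (p.coeff j).natDegree ≤ d :=
            Finset.single_le_sum (f := fun j => (p.coeff j).natDegree) (fun _ _ => Nat.zero_le _)
              (Finset.mem_range.2 (by omega))
        _ = d * 1 := (mul_one _).symm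
        _ ≤ d * (p.natDegree - j) := by gcongr; omega
    · rcases hj.eq_or_lt with rfl | hj
      · exact ⟨1, by simp [hp.coeff_natDegree]⟩
      · exact ⟨0, by simp [Polynomial.coeff_eq_zero_of_natDegree_lt hj]⟩
  obtain ⟨Q, hQ, -, hQm⟩ := Polynomial.lifts_and_natDegree_eq_and_monic hlift hPm
  refine ⟨Q, hQm, ?_⟩
  rw [← Polynomial.eval₂_map, hQ, hPdef]
  refine Polynomial.scaleRoots_eval₂_eq_zero _ ?_
  rw [Polynomial.eval₂_map, ← IsScalarTower.algebraMap_eq]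
  exact hph

end

section

open PowerSeries LaurentSeries Polynomial
open scoped RatFunc

theorem exists_powerSeries_of_isIntegral {h : ℂ⸨X⸩} (hh : IsIntegral ℂ[X] h) :
    ∃ s : ℂ⟦X⟧, algebraMap ℂ⟦X⟧ ℂ⸨X⸩ s = h := by
  refine IsIntegrallyClosed.isIntegral_iff.1 ?_
  obtain ⟨p, hp, hph⟩ := hh
  refine ⟨p.map Polynomial.coeToPowerSeries.ringHom, hp.map _, ?_⟩
  rw [Polynomial.eval₂_map, ← hph]
  congr 1

/-- The average of `ω ^ (-m) h(ω z)` over the powers `ω` of `ξ`. -/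
def rootAverage (ξ : ℂ) (M m : ℕ) (h : ℂ⟦X⟧) : ℂ⟦X⟧ :=
  ∑ t ∈ Finset.range M, PowerSeries.C ((ξ ^ t)⁻¹ ^ m) * PowerSeries.rescale (ξ ^ t) h

theorem coeff_rootAverage (ξ : ℂ) (M m j : ℕ) (h : ℂ⟦X⟧) :
    PowerSeries.coeff j (rootAverage ξ M m h) =
      PowerSeries.coeff j h * ∑ t ∈ Finset.range M, (ξ ^ j * (ξ ^ m)⁻¹) ^ t := by
  rw [rootAverage, map_sum, Finset.mul_sum]
  refine Finset.sum_congr rfl fun t _ => ?_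
  rw [PowerSeries.coeff_C_mul, PowerSeries.coeff_rescale, mul_pow, inv_pow, inv_pow, ← pow_mul,
    ← pow_mul, ← pow_mul, ← pow_mul, mul_comm t m, mul_comm t j]
  ring

theorem coeff_rootAverage_self {ξ : ℂ} (hξ : ξ ≠ 0) (M m : ℕ) (h : ℂ⟦X⟧) :
    PowerSeries.coeff m (rootAverage ξ M m h) = PowerSeries.coeff m h * M := by
  rw [coeff_rootAverage, mul_inv_cancel₀ (pow_ne_zero m hξ)]
  simp

theorem coeff_rootAverage_of_lt {ξ : ℂ} {M : ℕ} (hξ : IsPrimitiveRoot ξ M) {j m : ℕ} (hj : j < m)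
    (hm : m < M) (h : ℂ⟦X⟧) : PowerSeries.coeff j (rootAverage ξ M m h) = 0 := by
  have hξ0 : ξ ≠ 0 := hξ.ne_zero (by omega)
  rw [coeff_rootAverage]
  have hr : ξ ^ j * (ξ ^ m)⁻¹ ≠ 1 := by
    intro h1
    rw [mul_inv_eq_one₀ (pow_ne_zero m hξ0)] at h1
    exact hj.ne (hξ.pow_inj (hj.trans hm) hm h1)
  have hM : (ξ ^ j * (ξ ^ m)⁻¹) ^ M = 1 := by
    rw [mul_pow, inv_pow, ← pow_mul, ← pow_mul, mul_comm j, mul_comm m, pow_mul, pow_mul,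
      hξ.pow_eq_one]
    simp
  have h2 := geom_sum_mul (ξ ^ j * (ξ ^ m)⁻¹) M
  rw [hM, sub_self] at h2
  rw [(mul_eq_zero.1 h2).resolve_right (sub_ne_zero.2 hr), mul_zero]

theorem RingHom.IsIntegralElem.sum {R S ι : Type*} [CommRing R] [CommRing S] {i : R →+* S}
    {f : ι → S} (s : Finset ι) (h : ∀ t ∈ s, i.IsIntegralElem (f t)) :
    i.IsIntegralElem (∑ t ∈ s, f t) := by
  let _ := i.toAlgebra
  exact _root_.IsIntegral.sum (R := R) f h

theorem algebraMap_C_eq_invPoly (c : ℂ) : algebraMap ℂ⟦X⟧ ℂ⸨X⸩ (PowerSeries.C c) =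
    algebraMap (RatFunc ℂ) ℂ⸨X⸩ (invPoly (Polynomial.C c)) := by
  have := algebraMap_polynomial_laurent (Polynomial.C c)
  rw [Polynomial.coe_C] at this
  rw [← this, IsScalarTower.algebraMap_apply ℂ[X] (RatFunc ℂ) ℂ⸨X⸩]
  simp [invPoly, RatFunc.algebraMap_eq_C]

theorem isIntegralElem_invPoly_rescale (ω : ℂˣ) {d : ℕ} {h : ℂ⟦X⟧}
    (hd : ((algebraMap (RatFunc ℂ) ℂ⸨X⸩).comp invPoly).IsIntegralElem
      (algebraMap (RatFunc ℂ) ℂ⸨X⸩ (RatFunc.X⁻¹ ^ d) * algebraMap ℂ⟦X⟧ ℂ⸨X⸩ h)) :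
    ((algebraMap (RatFunc ℂ) ℂ⸨X⸩).comp invPoly).IsIntegralElem
      (algebraMap (RatFunc ℂ) ℂ⸨X⸩ (RatFunc.X⁻¹ ^ d) *
        algebraMap ℂ⟦X⟧ ℂ⸨X⸩ (PowerSeries.rescale (ω : ℂ) h)) := by
  have h1 := RingHom.IsIntegralElem.map_of_comp_eq (laurentRescale_comp_invPoly ω) hd
  have h2 : ((algebraMap (RatFunc ℂ) ℂ⸨X⸩).comp invPoly).IsIntegralElem
      (algebraMap (RatFunc ℂ) ℂ⸨X⸩ (RatFunc.C ((ω : ℂ) ^ d))) := by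
    have : RatFunc.C ((ω : ℂ) ^ d) = invPoly (Polynomial.C ((ω : ℂ) ^ d)) := by
      simp [invPoly, RatFunc.algebraMap_eq_C]
    rw [this]
    exact ((algebraMap (RatFunc ℂ) ℂ⸨X⸩).comp invPoly).isIntegralElem_map
  have h3 := RingHom.IsIntegralElem.mul _ h2 h1
  have h4 : RatFunc.C ((ω : ℂ) ^ d) * (RatFunc.C ((ω : ℂ)⁻¹) * (RatFunc.X : RatFunc ℂ)⁻¹) ^ d =
      RatFunc.X⁻¹ ^ d := by
    rw [mul_pow, ← mul_assoc, ← map_pow, ← map_mul, ← mul_pow, mul_inv_cancel₀ ω.ne_zero]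
    simp
  have h5 : laurentRescale ω (algebraMap (RatFunc ℂ) ℂ⸨X⸩ (RatFunc.X⁻¹ ^ d)) =
      algebraMap (RatFunc ℂ) ℂ⸨X⸩ ((RatFunc.C ((ω : ℂ)⁻¹) * RatFunc.X⁻¹) ^ d) := by
    rw [map_pow, map_pow, laurentRescale_X_inv, map_pow]
  rwa [map_mul (laurentRescale ω), h5, laurentRescale_algebraMap,
    ← mul_assoc, ← map_mul, h4] at h3

theorem mem_range_of_laurentRescale_mem (L₁ : IntermediateField (RatFunc ℂ) ℂ⸨X⸩)
    [FiniteDimensional (RatFunc ℂ) L₁] {q : ℕ} (hq : 2 ≤ q) {g : ℂ⸨X⸩}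
    (hg : ∀ (ω : ℂˣ) (k : ℕ), ω ^ q ^ k = 1 → laurentRescale ω g ∈ L₁) :
    g ∈ (algebraMap (RatFunc ℂ) ℂ⸨X⸩).range := by
  have hinj : Function.Injective (algebraMap ℂ⟦X⟧ ℂ⸨X⸩) := IsFractionRing.injective _ _
  have hgL : g ∈ L₁ := by simpa [laurentRescale_one] using hg 1 0 (by simp)
  have hgalg : IsAlgebraic ℂ[X] g := by
    have h1 : IsAlgebraic (RatFunc ℂ) g :=
      (IntermediateField.isAlgebraic_iff (x := (⟨g, hgL⟩ : L₁))).1 (Algebra.IsAlgebraic.isAlgebraic _)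
    exact (IsFractionRing.isAlgebraic_iff ℂ[X] (RatFunc ℂ) ℂ⸨X⸩).2 h1
  obtain ⟨p, hp0, hint⟩ := hgalg.exists_integral_multiple
  obtain ⟨h, hh⟩ := exists_powerSeries_of_isIntegral hint
  obtain ⟨d, hd⟩ := exists_isIntegralElem_invPoly hint
  rw [← hh] at hint hd
  have hhL (ω : ℂˣ) (k : ℕ) (hω : ω ^ q ^ k = 1) :
      algebraMap ℂ⟦X⟧ ℂ⸨X⸩ (PowerSeries.rescale (ω : ℂ) h) ∈ L₁ := by
    rw [← laurentRescale_algebraMap, hh, Algebra.smul_def, map_mul,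
      IsScalarTower.algebraMap_apply ℂ[X] (RatFunc ℂ) ℂ⸨X⸩]
    refine mul_mem ?_ (hg ω k hω)
    obtain ⟨y, hy⟩ := laurentRescale_algebraMap_ratFunc ω (algebraMap _ _ p)
    rw [← hy]
    exact L₁.algebraMap_mem y
  have hzero : ∀ m > Module.finrank (RatFunc ℂ) L₁ * d, PowerSeries.coeff m h = 0 := by
    intro m hm
    by_contra hne
    have hmM : m < q ^ m := Nat.lt_pow_self (by omega)
    set M := q ^ m with hM
    have hM0 : M ≠ 0 := by omega
    have hξ := Complex.isPrimitiveRoot_exp M hM0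
    set ξ := Complex.exp (2 * Real.pi * Complex.I / M)
    have hξ0 : ξ ≠ 0 := hξ.ne_zero hM0
    set u : ℂˣ := Units.mk0 ξ hξ0
    have hu (t : ℕ) : (u ^ t) ^ q ^ m = 1 := by
      rw [← pow_mul, mul_comm, pow_mul]
      have : u ^ q ^ m = 1 := Units.ext (by simpa [u] using hξ.pow_eq_one)
      rw [this, one_pow]
    have hut (t : ℕ) : ((u ^ t : ℂˣ) : ℂ) = ξ ^ t := by simp [u]
    have hsum : algebraMap ℂ⟦X⟧ ℂ⸨X⸩ (rootAverage ξ M m h) = ∑ t ∈ Finset.range M,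
        algebraMap ℂ⟦X⟧ ℂ⸨X⸩ (PowerSeries.C ((ξ ^ t)⁻¹ ^ m)) *
          algebraMap ℂ⟦X⟧ ℂ⸨X⸩ (PowerSeries.rescale ((u ^ t : ℂˣ) : ℂ) h) := by
      rw [rootAverage, map_sum]
      exact Finset.sum_congr rfl fun t _ => by rw [map_mul, hut]
    have hS0 : rootAverage ξ M m h ≠ 0 := by
      intro h0
      have := coeff_rootAverage_self hξ0 M m h
      rw [h0, map_zero] at this
      exact mul_ne_zero hne (Nat.cast_ne_zero.2 hM0) this.symm
    have hSL : algebraMap ℂ⟦X⟧ ℂ⸨X⸩ (rootAverage ξ M m h) ∈ L₁ := by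
      rw [hsum]
      refine sum_mem fun t _ => mul_mem ?_ (hhL (u ^ t) m (hu t))
      rw [algebraMap_C_eq_invPoly]; exact L₁.algebraMap_mem _
    obtain ⟨j, hj, hjne⟩ := exists_coeff_ne_zero_of_isIntegral
        (N := Module.finrank (RatFunc ℂ) L₁) (d := d) hS0 (by
          rw [hsum]
          refine IsIntegral.sum _ fun t _ => IsIntegral.mul ?_ ?_
          · have := algebraMap_polynomial_laurent (Polynomial.C ((ξ ^ t)⁻¹ ^ m))
            rw [Polynomial.coe_C] at this
            rw [← this]
            exact isIntegral_algebraMap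
          · rw [← laurentRescale_algebraMap]
            exact RingHom.IsIntegralElem.map_of_comp_eq (laurentRescale_comp_algebraMap _) hint) (by
          rw [hsum, Finset.mul_sum]
          refine RingHom.IsIntegralElem.sum _ fun t _ => ?_
          rw [mul_left_comm]
          refine RingHom.IsIntegralElem.mul _ ?_ (isIntegralElem_invPoly_rescale (u ^ t) hd)
          rw [algebraMap_C_eq_invPoly]
          exact ((algebraMap (RatFunc ℂ) ℂ⸨X⸩).comp invPoly).isIntegralElem_map) (by
          have := minpoly.natDegree_le (A := RatFunc ℂ) (⟨_, hSL⟩ : L₁)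
          rwa [IntermediateField.minpoly_eq] at this)
    exact hjne (coeff_rootAverage_of_lt hξ (by omega) hmM h)
  have hpoly : h = (PowerSeries.trunc (Module.finrank (RatFunc ℂ) L₁ * d + 1) h : ℂ⟦X⟧) := by
    ext m
    rw [Polynomial.coeff_coe, PowerSeries.coeff_trunc]
    split_ifs with hm
    · rfl
    · exact hzero m (by omega)
  rw [hpoly, ← algebraMap_polynomial_laurent, Algebra.smul_def,
    IsScalarTower.algebraMap_apply ℂ[X] (RatFunc ℂ) ℂ⸨X⸩,
    IsScalarTower.algebraMap_apply ℂ[X] (RatFunc ℂ) ℂ⸨X⸩] at hh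
  have hp1 : algebraMap (RatFunc ℂ) ℂ⸨X⸩ (algebraMap ℂ[X] (RatFunc ℂ) p) ≠ 0 := by
    simpa using hp0
  exact ⟨_, by rw [map_div₀]; exact (eq_div_of_mul_eq hp1 ((mul_comm _ _).trans hh.symm)).symm⟩

end

section

theorem linearIndependent_algebraicClosure_of_descent {F E ι : Type*} [Field F] [Field E]
    [Algebra F E] [Finite ι] {v : ι → E} (hv : LinearIndependent F v) (G : Set (E ≃+* E))
    (halg : ∀ ρ ∈ G, ∀ x, IsAlgebraic F (ρ x) ↔ IsAlgebraic F x)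
    (hspan : ∀ ρ ∈ G, ∀ i, ρ (v i) ∈ Submodule.span F (Set.range v))
    (hdesc : ∀ L₁ : IntermediateField F E, FiniteDimensional F L₁ → ∀ g : E,
      (∀ ρ ∈ G, ρ g ∈ L₁) → g ∈ (algebraMap F E).range) :
    LinearIndependent (algebraicClosure F E) v := by
  classical
  let _ := Fintype.ofFinite ι
  set L := algebraicClosure F E with hL
  obtain ⟨s, hs, hmax⟩ := exists_maximal_linearIndepOn L v
  have hmem (i : ι) : ∃ c : s → L, ∑ j, c j • v j = v i := by
    rw [← Submodule.mem_span_range_iff_exists_fun L (v := fun j : s => v j),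
      ← Set.image_eq_range]
    by_cases hi : i ∈ s
    · exact Submodule.subset_span ⟨i, hi, rfl⟩
    · obtain ⟨a, ha, h⟩ := hmax i hi
      simpa [smul_smul, inv_mul_cancel₀ ha] using Submodule.smul_mem _ a⁻¹ h
  choose c hc using hmem
  set T : Set E := Set.range fun p : ι × s => (c p.1 p.2 : E) with hT
  set L₁ := IntermediateField.adjoin F T with hL₁
  have hfin : FiniteDimensional F L₁ := by
    refine IntermediateField.finiteDimensional_adjoin ?_
    rintro _ ⟨p, rfl⟩
    exact (mem_algebraicClosure_iff.1 (c p.1 p.2).2).isIntegral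
  have hcL (i : ι) (j : s) : (c i j : E) ∈ L₁ :=
    IntermediateField.subset_adjoin F T ⟨(i, j), rfl⟩
  have hs' (d : s → E) (hd : ∀ j, IsAlgebraic F (d j)) (h0 : ∑ j, d j * v j = 0) (j : s) :
      d j = 0 := by
    have := Fintype.linearIndependent_iff.1 hs (fun j => ⟨d j, mem_algebraicClosure_iff.2 (hd j)⟩)
      h0 j
    simpa using congrArg Subtype.val this
  have halg₁ (x : L₁) : IsAlgebraic F (x : E) :=
    (IntermediateField.isAlgebraic_iff (S := L₁)).1 (Algebra.IsAlgebraic.isAlgebraic x)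
  have hρs (ρ) (hρ : ρ ∈ G) (d : s → E) (hd : ∀ j, IsAlgebraic F (d j))
      (h0 : ∑ j, d j * ρ (v j) = 0) (j : s) : d j = 0 := by
    have h1 : ∑ j, ρ.symm (d j) * v j = 0 := by
      apply ρ.injective
      simpa using h0
    simpa using hs' (fun j => ρ.symm (d j)) 
      (fun j => (halg ρ hρ _).1 (by simpa using hd j)) h1 j
  have hv₁ (i : ι) : v i ∈ Submodule.span L₁ (Set.range fun j : s => v j) := by
    rw [Submodule.mem_span_range_iff_exists_fun]
    exact ⟨fun j => ⟨c i j, hcL i j⟩, hc i⟩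
  have hli₁ : LinearIndependent L₁ fun j : s => v j :=
    Fintype.linearIndependent_iff.2 fun d h0 j =>
      Subtype.ext (hs' (fun j => d j) (fun j => halg₁ _) h0 j)
  have hρc (ρ) (hρ : ρ ∈ G) (i : ι) (j : s) : ρ (c i j) ∈ L₁ := by
    have hli : LinearIndependent L₁ fun j : s => ρ (v j) :=
      Fintype.linearIndependent_iff.2 fun d h0 j =>
        Subtype.ext (hρs ρ hρ (fun j => d j) (fun j => halg₁ _) h0 j)
    have hle (i : ι) : ρ (v i) ∈ Submodule.span L₁ (Set.range fun j : s => v j) := by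
      have h1 : Submodule.span F (Set.range v) ≤
          (Submodule.span L₁ (Set.range fun j : s => v j)).restrictScalars F := by
        rw [Submodule.span_le]
        rintro _ ⟨i, rfl⟩
        exact hv₁ i
      exact h1 (hspan ρ hρ i)
    have heq : Submodule.span L₁ (Set.range fun j : s => ρ (v j)) =
        Submodule.span L₁ (Set.range fun j : s => v j) := by
      have : FiniteDimensional L₁ (Submodule.span L₁ (Set.range fun j : s => v j)) :=
        FiniteDimensional.span_of_finite _ (Set.finite_range _)
      refine Submodule.eq_of_le_of_finrank_le ?_ ?_
      · rw [Submodule.span_le]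
        rintro _ ⟨j, rfl⟩
        exact hle j
      · rw [finrank_span_eq_card hli, finrank_span_eq_card hli₁]
    have h2 := hle i
    rw [← heq, Submodule.mem_span_range_iff_exists_fun] at h2
    obtain ⟨d, hd⟩ := h2
    have h3 : ∑ j, ((d j : E) - ρ (c i j)) * ρ (v j) = 0 := by
      have h4 := congrArg ρ (hc i)
      rw [map_sum] at h4
      simp only [sub_mul, Finset.sum_sub_distrib]
      rw [sub_eq_zero]
      refine Eq.trans hd (h4.symm.trans (Finset.sum_congr rfl fun j _ => ?_))
      rw [← map_mul]
      rfl
    have h5 := hρs ρ hρ _ (fun j => (halg₁ (d j)).sub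
      ((halg ρ hρ _).2 (mem_algebraicClosure_iff.1 (c i j).2))) h3 j
    rw [← sub_eq_zero.1 h5]
    exact (d j).2
  have hall (i : ι) : i ∈ s := by
    by_contra hi
    refine hv.notMem_span_image hi ?_
    rw [Set.image_eq_range, Submodule.mem_span_range_iff_exists_fun]
    choose r hr using fun j => hdesc L₁ hfin (c i j) fun ρ hρ => hρc ρ hρ i j
    refine ⟨r, Eq.trans (Finset.sum_congr rfl fun j _ => ?_) (hc i)⟩
    rw [Algebra.smul_def, hr]
    rfl
  have huniv : s = Set.univ := Set.eq_univ_of_forall hall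
  rwa [huniv, linearIndepOn_univ_iff] at hs

end

section

open PowerSeries LaurentSeries Polynomial
open scoped RatFunc

theorem psSigma_eq_expand {q : ℕ} (hq : q ≠ 0) (f : ℂ⟦X⟧) :
    psSigma q f = PowerSeries.expand q hq f := by
  ext m
  rw [psSigma, PowerSeries.coeff_mk, PowerSeries.coeff_expand]

theorem iterate_psSigma {q : ℕ} (hq : q ≠ 0) (k : ℕ) (f : ℂ⟦X⟧) :
    (psSigma q)^[k] f = PowerSeries.expand (q ^ k) (pow_ne_zero k hq) f := by
  induction k with
  | zero => simp
  | succ k ih =>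
    rw [Function.iterate_succ_apply', ih, psSigma_eq_expand hq]
    rw [← PowerSeries.expand_mul]
    congr 1
    ring_nf

theorem polyPS_apply (p : ℂ[X]) : polyPS p = (p : ℂ⟦X⟧) := rfl

theorem expand_polyPS {q : ℕ} (hq : q ≠ 0) (p : ℂ[X]) :
    PowerSeries.expand q hq (polyPS p) = polyPS (Polynomial.expand ℂ q p) := by
  ext m
  rw [PowerSeries.coeff_expand, polyPS_apply, polyPS_apply, Polynomial.coeff_coe,
    Polynomial.coeff_coe, Polynomial.coeff_expand (Nat.pos_of_ne_zero hq)]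

/-- The substitution `z ↦ ω z` as an automorphism of the field of Laurent series. -/
def laurentRescaleEquiv (ω : ℂˣ) : ℂ⸨X⸩ ≃+* ℂ⸨X⸩ :=
  RingEquiv.ofRingHom (laurentRescale ω) (laurentRescale ω⁻¹)
    (RingHom.ext fun x => by simp [laurentRescale_mul, laurentRescale_one])
    (RingHom.ext fun x => by simp [laurentRescale_mul, laurentRescale_one])

theorem laurentRescaleEquiv_apply (ω : ℂˣ) (x : ℂ⸨X⸩) :
    laurentRescaleEquiv ω x = laurentRescale ω x := rfl

theorem IsAlgebraic.laurentRescale {x : ℂ⸨X⸩} (hx : IsAlgebraic (RatFunc ℂ) x) (ω : ℂˣ) :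
    IsAlgebraic (RatFunc ℂ) (laurentRescale ω x) := by
  rw [← IsFractionRing.isAlgebraic_iff ℂ[X] (RatFunc ℂ) ℂ⸨X⸩] at hx ⊢
  refine hx.ringHom_of_comp_eq (Polynomial.compRingHom (Polynomial.C (ω : ℂ) * Polynomial.X))
    (_root_.laurentRescale ω) ?_ (laurentRescale_comp_algebraMap ω).symm
  rw [injective_iff_map_eq_zero]
  intro p hp
  rw [Polynomial.coe_compRingHom_apply] at hp
  ext m
  have := congrArg (fun p => Polynomial.coeff p m) hp
  simpa [Polynomial.comp_C_mul_X_coeff] using this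

/-- The Laurent series `f(z ^ q ^ j)`. -/
def mahlerFamily (q : ℕ) (f : ℂ⟦X⟧) (j : ℕ) : ℂ⸨X⸩ := algebraMap ℂ⟦X⟧ ℂ⸨X⸩ ((psSigma q)^[j] f)

theorem laurentRescale_mahlerFamily {q : ℕ} (hq : q ≠ 0) (f : ℂ⟦X⟧) {ω : ℂˣ} {k j : ℕ}
    (hω : ω ^ q ^ k = 1) (hj : k ≤ j) :
    laurentRescale ω (mahlerFamily q f j) = mahlerFamily q f j := by
  rw [mahlerFamily, laurentRescale_algebraMap]
  congr 1
  ext m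
  rw [PowerSeries.coeff_rescale, iterate_psSigma hq, PowerSeries.coeff_expand]
  split_ifs with h
  · have h1 : (ω : ℂ) ^ q ^ k = 1 := by simpa using congrArg Units.val hω
    obtain ⟨e, rfl⟩ := (pow_dvd_pow q hj).trans h
    rw [pow_mul, h1, one_pow, one_mul]
  · rw [mul_zero]

theorem sum_mahlerFamily_eq_zero {q : ℕ} (hq : q ≠ 0) {f : ℂ⟦X⟧} {n : ℕ} {a : ℕ → ℂ[X]}
    (heq : ∑ i ∈ Finset.range (n + 1), polyPS (a i) * (psSigma q)^[i] f = 0) (k : ℕ) :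
    ∑ i ∈ Finset.range (n + 1), algebraMap ℂ[X] ℂ⸨X⸩ (Polynomial.expand ℂ (q ^ k) (a i)) *
      mahlerFamily q f (i + k) = 0 := by
  have h := congrArg (fun g => algebraMap ℂ⟦X⟧ ℂ⸨X⸩ ((psSigma q)^[k] g)) heq
  simp only [iterate_psSigma hq k, map_sum, map_mul, map_zero, expand_polyPS] at h
  rw [← h]
  refine Finset.sum_congr rfl fun i _ => ?_
  rw [algebraMap_polynomial_laurent, polyPS_apply, mahlerFamily, add_comm i k,
    Function.iterate_add_apply, iterate_psSigma hq k]

theorem expand_ne_zero_of_ne_zero {q : ℕ} (hq : q ≠ 0) {p : ℂ[X]} (hp : p ≠ 0) :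
    Polynomial.expand ℂ q p ≠ 0 := fun h =>
  hp ((Polynomial.expand_eq_zero (Nat.pos_of_ne_zero hq)).1 h)

theorem mem_of_sum_mul_eq_zero {R F E ι : Type*} [CommRing R] [Field F] [Field E] [Algebra R F]
    [Algebra R E] [Algebra F E] [FaithfulSMul R F] [IsScalarTower R F E]
    {s : Finset ι} {c : ι → R} {v : ι → E}
    (h : ∑ i ∈ s, algebraMap R E (c i) * v i = 0) {N : Submodule F E} {i₀ : ι} (hi₀ : i₀ ∈ s)
    (hc : c i₀ ≠ 0) (hN : ∀ i ∈ s, i ≠ i₀ → v i ∈ N) : v i₀ ∈ N := by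
  classical
  simp only [IsScalarTower.algebraMap_apply R F E, ← Algebra.smul_def] at h
  rw [← Finset.add_sum_erase s _ hi₀] at h
  have h1 : algebraMap R F (c i₀) • v i₀ ∈ N := by
    rw [eq_neg_of_add_eq_zero_left h]
    exact N.neg_mem (N.sum_mem fun i hi =>
      N.smul_mem _ (hN i (Finset.mem_of_mem_erase hi) (Finset.ne_of_mem_erase hi)))
  have h2 : algebraMap R F (c i₀) ≠ 0 := by
    rwa [Ne, FaithfulSMul.algebraMap_eq_zero_iff]
  have := N.smul_mem (algebraMap R F (c i₀))⁻¹ h1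
  rwa [smul_smul, inv_mul_cancel₀ h2, one_smul] at this

theorem mahlerFamily_mem_span_of_le {q : ℕ} (hq : q ≠ 0) {f : ℂ⟦X⟧} {n : ℕ} {a : ℕ → ℂ[X]}
    (ha0 : a 0 ≠ 0)
    (heq : ∑ i ∈ Finset.range (n + 1), polyPS (a i) * (psSigma q)^[i] f = 0) (k j : ℕ) :
    mahlerFamily q f j ∈ Submodule.span (RatFunc ℂ) (mahlerFamily q f '' {i | k ≤ i}) := by
  induction k with
  | zero => exact Submodule.subset_span ⟨j, Nat.zero_le _, rfl⟩
  | succ k ih =>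
    refine (Submodule.span_le (p := Submodule.span (RatFunc ℂ)
      (mahlerFamily q f '' {i | k + 1 ≤ i}))).2 ?_ ih
    rintro _ ⟨i, hi, rfl⟩
    rcases (show k ≤ i from hi).eq_or_lt with rfl | hlt
    · have := mem_of_sum_mul_eq_zero (F := RatFunc ℂ)
        (N := Submodule.span (RatFunc ℂ) (mahlerFamily q f '' {i | k + 1 ≤ i}))
        (c := fun i => Polynomial.expand ℂ (q ^ k) (a i)) (v := fun i => mahlerFamily q f (i + k))
        (sum_mahlerFamily_eq_zero hq heq k) (i₀ := 0) (by simp)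
        (expand_ne_zero_of_ne_zero (pow_ne_zero k hq) ha0) fun i _ hi =>
          Submodule.subset_span ⟨i + k, show k + 1 ≤ i + k by omega, rfl⟩
      rw [SetLike.mem_coe]
      simpa only [zero_add] using this
    · exact Submodule.subset_span ⟨i, hlt, rfl⟩

theorem mahlerFamily_mem_span {q : ℕ} (hq : q ≠ 0) {f : ℂ⟦X⟧} {n : ℕ} {a : ℕ → ℂ[X]}
    (han : a n ≠ 0)
    (heq : ∑ i ∈ Finset.range (n + 1), polyPS (a i) * (psSigma q)^[i] f = 0) (j : ℕ) :
    mahlerFamily q f j ∈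
      Submodule.span (RatFunc ℂ) (Set.range fun i : Fin n => mahlerFamily q f i) := by
  induction j using Nat.strong_induction_on with
  | _ j ih =>
    rcases lt_or_ge j n with hj | hj
    · exact Submodule.subset_span ⟨⟨j, hj⟩, rfl⟩
    · obtain ⟨k, rfl⟩ := Nat.exists_eq_add_of_le hj
      refine mem_of_sum_mul_eq_zero (F := RatFunc ℂ)
        (c := fun i => Polynomial.expand ℂ (q ^ k) (a i)) (v := fun i => mahlerFamily q f (i + k))
        (sum_mahlerFamily_eq_zero hq heq k) (i₀ := n)
        (by simp) (expand_ne_zero_of_ne_zero (pow_ne_zero k hq) han) fun i hi hin => ih _ ?_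
      have := Finset.mem_range.1 hi
      omega

theorem laurentRescale_mem_span {q : ℕ} (hq : q ≠ 0) {f : ℂ⟦X⟧} {n : ℕ} {a : ℕ → ℂ[X]}
    (ha0 : a 0 ≠ 0) (han : a n ≠ 0)
    (heq : ∑ i ∈ Finset.range (n + 1), polyPS (a i) * (psSigma q)^[i] f = 0) {ω : ℂˣ} {k : ℕ}
    (hω : ω ^ q ^ k = 1) (j : ℕ) :
    laurentRescale ω (mahlerFamily q f j) ∈
      Submodule.span (RatFunc ℂ) (Set.range fun i : Fin n => mahlerFamily q f i) := by
  have h := mahlerFamily_mem_span_of_le hq ha0 heq k j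
  generalize mahlerFamily q f j = x at h
  induction h using Submodule.span_induction with
  | mem x hx =>
    obtain ⟨i, hi, rfl⟩ := hx
    rw [laurentRescale_mahlerFamily hq f hω hi]
    exact mahlerFamily_mem_span hq han heq i
  | zero => rw [map_zero]; exact Submodule.zero_mem _
  | add x y _ _ hx hy => rw [map_add]; exact Submodule.add_mem _ hx hy
  | smul r x _ hx =>
    rw [Algebra.smul_def, map_mul]
    obtain ⟨y, hy⟩ := laurentRescale_algebraMap_ratFunc ω r
    rw [← hy, ← Algebra.smul_def]
    exact Submodule.smul_mem _ _ hx

/-- A linear relation with algebraic coefficients between `f(z), f(z ^ q), …, f(z ^ q ^ (n - 1))`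
produces one with polynomial coefficients. -/
theorem exists_polynomial_relation_of_algebraic_relation {q : ℕ} (hq : 2 ≤ q) {f : ℂ⟦X⟧} {n : ℕ}
    {a : ℕ → ℂ[X]} (ha0 : a 0 ≠ 0) (han : a n ≠ 0)
    (heq : ∑ i ∈ Finset.range (n + 1), polyPS (a i) * (psSigma q)^[i] f = 0)
    {g : Fin n → ℂ⸨X⸩} (hg : ∀ i, IsAlgebraic ℂ[X] (g i)) (hg0 : g ≠ 0)
    (hsum : ∑ i, g i * mahlerFamily q f i = 0) :
    ∃ b : Fin n → ℂ[X], b ≠ 0 ∧ ∑ i, polyPS (b i) * (psSigma q)^[i] f = 0 := by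
  have hq0 : q ≠ 0 := by omega
  by_contra! hb
  have hli : LinearIndependent (RatFunc ℂ) fun i : Fin n => mahlerFamily q f i := by
    rw [← LinearIndependent.iff_fractionRing ℂ[X] (RatFunc ℂ), Fintype.linearIndependent_iff]
    intro b hb0
    by_contra! hne
    obtain ⟨i, hi⟩ := hne
    refine hb b (fun h => hi (congrFun h i)) (IsFractionRing.injective ℂ⟦X⟧ ℂ⸨X⸩ ?_)
    rw [map_sum, map_zero, ← hb0]
    refine Finset.sum_congr rfl fun i _ => ?_
    rw [map_mul, Algebra.smul_def, algebraMap_polynomial_laurent]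
    rfl
  have hli' : LinearIndependent (algebraicClosure (RatFunc ℂ) ℂ⸨X⸩)
      fun i : Fin n => mahlerFamily q f i := by
    refine linearIndependent_algebraicClosure_of_descent hli
      {ρ | ∃ (ω : ℂˣ) (k : ℕ), ω ^ q ^ k = 1 ∧ ρ = laurentRescaleEquiv ω} ?_ ?_ ?_
    · rintro _ ⟨ω, k, hω, rfl⟩ x
      refine ⟨fun h => ?_, fun h => h.laurentRescale ω⟩
      have := h.laurentRescale ω⁻¹
      rwa [laurentRescaleEquiv_apply, laurentRescale_mul, inv_mul_cancel, laurentRescale_one] at this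
    · rintro _ ⟨ω, k, hω, rfl⟩ i
      exact laurentRescale_mem_span hq0 ha0 han heq hω i
    · intro L₁ hL₁ g hg
      exact mem_range_of_laurentRescale_mem L₁ hq fun ω k hω => hg _ ⟨ω, k, hω, rfl⟩
  refine hg0 (funext fun i => ?_)
  have halg (i) : g i ∈ algebraicClosure (RatFunc ℂ) ℂ⸨X⸩ :=
    mem_algebraicClosure_iff.2
      ((IsFractionRing.isAlgebraic_iff ℂ[X] (RatFunc ℂ) ℂ⸨X⸩).1 (hg i))
  exact congrArg Subtype.val
    (Fintype.linearIndependent_iff.1 hli' (fun i => ⟨g i, halg i⟩) hsum i)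

end

section

open PowerSeries Polynomial Filter Topology

/-- The power series `f` converges at `z`, with sum `s`. -/
def HasValue (f : ℂ⟦X⟧) (z s : ℂ) : Prop := HasSum (fun m => PowerSeries.coeff m f * z ^ m) s

namespace HasValue

variable {f g : ℂ⟦X⟧} {z s t : ℂ}

theorem add (hf : HasValue f z s) (hg : HasValue g z t) : HasValue (f + g) z (s + t) := by
  have := HasSum.add hf hg
  simpa only [HasValue, map_add, add_mul] using this

theorem mul (hf : HasValue f z s) (hg : HasValue g z t) : HasValue (f * g) z (s * t) := by
  have hf' := hf.summable.norm
  have hg' := hg.summable.norm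
  have h1 := (summable_norm_sum_mul_antidiagonal_of_summable_norm hf' hg').of_norm.hasSum
  rw [← tsum_mul_tsum_eq_tsum_sum_antidiagonal_of_summable_norm hf' hg', HasSum.tsum_eq hf,
    HasSum.tsum_eq hg] at h1
  refine h1.congr_fun fun m => ?_
  rw [PowerSeries.coeff_mul, Finset.sum_mul]
  refine Finset.sum_congr rfl fun p hp => ?_
  rw [← Finset.HasAntidiagonal.mem_antidiagonal.1 hp, pow_add]
  ring

theorem zero (z : ℂ) : HasValue 0 z 0 := by simp [HasValue]

theorem sum {ι : Type*} (I : Finset ι) {F : ι → ℂ⟦X⟧} {S : ι → ℂ}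
    (h : ∀ i ∈ I, HasValue (F i) z (S i)) : HasValue (∑ i ∈ I, F i) z (∑ i ∈ I, S i) := by
  have := hasSum_sum h
  simpa only [HasValue, map_sum, Finset.sum_mul] using this

theorem polynomial (p : ℂ[X]) (z : ℂ) : HasValue (p : ℂ⟦X⟧) z (p.eval z) := by
  rw [Polynomial.eval_eq_sum_range]
  simp only [HasValue, Polynomial.coeff_coe]
  refine hasSum_sum_of_ne_finset_zero fun m hm => ?_
  rw [Polynomial.coeff_eq_zero_of_natDegree_lt (by simpa using hm), zero_mul]

theorem expand {q : ℕ} (hq : q ≠ 0) (h : HasValue f (z ^ q) s) :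
    HasValue (PowerSeries.expand q hq f) z s := by
  have hinj : Function.Injective fun m : ℕ => q * m := fun _ _ h => Nat.eq_of_mul_eq_mul_left (Nat.pos_of_ne_zero hq) h
  refine (hinj.hasSum_iff fun m hm => ?_).1 (h.congr_fun fun m => ?_)
  · rw [PowerSeries.coeff_expand_of_not_dvd, zero_mul]
    rintro ⟨e, rfl⟩
    exact hm ⟨e, rfl⟩
  · simp only [Function.comp_apply, PowerSeries.coeff_expand_mul, pow_mul]

theorem unique (hf : HasValue f z s) (hf' : HasValue f z t) : s = t := HasSum.unique hf hf'

end HasValue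

theorem analyticAt_zero_of_hasValue {f : ℂ⟦X⟧} {F : ℂ → ℂ} (h : ∀ᶠ z in 𝓝 0, HasValue f z (F z)) :
    AnalyticAt ℂ F 0 := by
  refine ⟨FormalMultilinearSeries.ofScalars ℂ fun m => PowerSeries.coeff m f, ?_⟩
  rw [hasFPowerSeriesAt_iff]
  filter_upwards [h] with z hz
  simpa [FormalMultilinearSeries.coeff_ofScalars, HasValue, mul_comm] using hz

theorem tendsto_pow_nhdsNE {β : ℂ} (hβ : β ≠ 0) {e : ℕ} (he : e ≠ 0) :
    Tendsto (fun z => z ^ e) (𝓝[≠] β) (𝓝[≠] (β ^ e)) :=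
  (hasDerivAt_pow e β).tendsto_nhdsNE (mul_ne_zero (Nat.cast_ne_zero.2 he) (pow_ne_zero _ hβ))

theorem tendsto_pow_pow_atTop {α : ℂ} (hα : ‖α‖ < 1) {q : ℕ} (hq : 2 ≤ q) :
    Tendsto (fun j => α ^ q ^ j) atTop (𝓝 0) :=
  (tendsto_pow_atTop_nhds_zero_of_norm_lt_one hα).comp (tendsto_pow_atTop_atTop_of_one_lt (by omega))

/-- The Mahler equation satisfied by `f` holds for its meromorphic continuation. -/
theorem eventually_sum_eval_mul_eq_zero {q : ℕ} (hq : q ≠ 0) {f : ℂ⟦X⟧} {n : ℕ} {a : ℕ → ℂ[X]}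
    (heq : ∑ i ∈ Finset.range (n + 1), polyPS (a i) * (psSigma q)^[i] f = 0) {F : ℂ → ℂ}
    (hF : MeromorphicOn F (Metric.ball 0 1)) (hval : ∀ᶠ z in 𝓝 0, HasValue f z (F z)) {β : ℂ}
    (hβ : ‖β‖ < 1) :
    ∀ᶠ z in 𝓝[≠] β, ∑ i ∈ Finset.range (n + 1), (a i).eval z * F (z ^ q ^ i) = 0 := by
  have hmer : MeromorphicOn (fun z => ∑ i ∈ Finset.range (n + 1), (a i).eval z * F (z ^ q ^ i))
      (Metric.ball 0 1) := by
    intro z hz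
    refine MeromorphicAt.fun_sum fun i _ => MeromorphicAt.mul ?_ ?_
    · exact (AnalyticOnNhd.eval_polynomial (a i) z (Set.mem_univ z)).meromorphicAt
    · refine MeromorphicAt.comp_analyticAt (g := fun z => z ^ q ^ i) (hF _ ?_) (by fun_prop)
      rw [mem_ball_zero_iff] at hz ⊢
      rw [norm_pow]
      exact pow_lt_one₀ (norm_nonneg _) hz (pow_ne_zero _ hq)
  have hzero : ∀ᶠ z in 𝓝 (0 : ℂ),
      ∑ i ∈ Finset.range (n + 1), (a i).eval z * F (z ^ q ^ i) = 0 := by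
    have h1 : ∀ᶠ z in 𝓝 (0 : ℂ), ∀ i ∈ Finset.range (n + 1),
        HasValue f (z ^ q ^ i) (F (z ^ q ^ i)) := by
      rw [Filter.eventually_all_finset]
      intro i _
      have : Tendsto (fun z : ℂ => z ^ q ^ i) (𝓝 0) (𝓝 0) := by
        have h : Continuous fun z : ℂ => z ^ q ^ i := by fun_prop
        simpa [zero_pow (pow_ne_zero i hq)] using h.tendsto 0
      exact this.eventually hval
    filter_upwards [h1] with z hz
    have h2 := HasValue.sum (Finset.range (n + 1)) fun i hi =>
      (HasValue.polynomial (a i) z).mul ((hz i hi).expand (pow_ne_zero i hq))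
    simp only [← iterate_psSigma hq, ← polyPS_apply, heq] at h2
    exact h2.unique (HasValue.zero z)
  rw [← meromorphicOrderAt_eq_top_iff]
  by_contra h
  refine hmer.meromorphicOrderAt_ne_top_of_isPreconnected (y := 0) (convex_ball _ _).isPreconnected
    (by simpa using hβ) (by simp) h ?_
  rw [meromorphicOrderAt_eq_top_iff]
  exact hzero.filter_mono nhdsWithin_le_nhds

theorem exists_mahler_values {q : ℕ} (hq : 2 ≤ q) {f : ℂ⟦X⟧} {n : ℕ} {a : ℕ → ℂ[X]}
    (heq : ∑ i ∈ Finset.range (n + 1), polyPS (a i) * (psSigma q)^[i] f = 0)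
    {α : ℂ} (hα0 : α ≠ 0) (hα1 : ‖α‖ < 1) (ha0 : ∀ j, (a 0).eval (α ^ q ^ j) ≠ 0)
    {v₀ : ℂ} (hv₀ : MahlerValue f α v₀) :
    ∃ v : ℕ → ℂ, v 0 = v₀ ∧
      (∀ j, ∑ i ∈ Finset.range (n + 1), (a i).eval (α ^ q ^ j) * v (j + i) = 0) ∧
      ∀ᶠ j in atTop, HasValue f (α ^ q ^ j) (v j) := by
  have hq0 : q ≠ 0 := by omega
  obtain ⟨F, hF, hval, hFα, rfl⟩ := hv₀
  have hlt (j : ℕ) : ‖α ^ q ^ j‖ < 1 := by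
    rw [norm_pow]; exact pow_lt_one₀ (norm_nonneg _) hα1 (pow_ne_zero _ hq0)
  have hne (j : ℕ) : α ^ q ^ j ≠ 0 := pow_ne_zero _ hα0
  have htend (i j : ℕ) : Tendsto (fun z => z ^ q ^ i) (𝓝[≠] (α ^ q ^ j)) (𝓝[≠] (α ^ q ^ (j + i))) := by
    have := tendsto_pow_nhdsNE (hne j) (pow_ne_zero i hq0)
    rwa [← pow_mul, ← pow_add] at this
  have hpoly (p : ℂ[X]) (j : ℕ) : Tendsto (fun z => p.eval z) (𝓝[≠] (α ^ q ^ j))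
      (𝓝 (p.eval (α ^ q ^ j))) := (p.continuous.tendsto _).mono_left nhdsWithin_le_nhds
  have hlarge : ∀ᶠ j in atTop, Tendsto F (𝓝[≠] (α ^ q ^ j)) (𝓝 (F (α ^ q ^ j))) := by
    filter_upwards [(tendsto_pow_pow_atTop hα1 hq).eventually
      (analyticAt_zero_of_hasValue hval).eventually_analyticAt] with j hj
    exact hj.continuousAt.tendsto.mono_left nhdsWithin_le_nhds
  have hlim : ∀ j, ∃ l, Tendsto F (𝓝[≠] (α ^ q ^ j)) (𝓝 l) := by
    obtain ⟨J, hJ⟩ := eventually_atTop.1 hlarge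
    suffices ∀ d j, J ≤ j + d → ∃ l, Tendsto F (𝓝[≠] (α ^ q ^ j)) (𝓝 l) from
      fun j => this J j (by omega)
    intro d
    induction d with
    | zero => exact fun j hj => ⟨_, hJ j hj⟩
    | succ d ih =>
      intro j hj
      choose l hl using fun i : ℕ => ih (j + (i + 1)) (by omega)
      have h1 := eventually_sum_eval_mul_eq_zero hq0 heq hF hval (hlt j)
      have h2 : Tendsto (fun z => -∑ i ∈ Finset.range n, (a (i + 1)).eval z * F (z ^ q ^ (i + 1)))
          (𝓝[≠] (α ^ q ^ j)) (𝓝 (-∑ i ∈ Finset.range n, (a (i + 1)).eval (α ^ q ^ j) * l i)) :=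
        (tendsto_finsetSum _ fun i _ =>
          (hpoly (a (i + 1)) j).mul ((hl i).comp (htend (i + 1) j))).neg
      refine ⟨_, (h2.div (hpoly (a 0) j) (ha0 j)).congr' ?_⟩
      filter_upwards [h1, (hpoly (a 0) j).eventually_ne (ha0 j)] with z hz hz0
      rw [Finset.sum_range_succ', pow_zero, pow_one] at hz
      simp only [Pi.div_apply]
      rw [div_eq_iff hz0]
      linear_combination -hz
  choose v hv using hlim
  refine ⟨v, ?_, fun j => ?_, ?_⟩
  · have h := hv 0
    rw [pow_zero, pow_one] at h
    exact tendsto_nhds_unique h (hFα.continuousAt.tendsto.mono_left nhdsWithin_le_nhds)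
  · have h1 := eventually_sum_eval_mul_eq_zero hq0 heq hF hval (hlt j)
    have h2 : Tendsto (fun z => ∑ i ∈ Finset.range (n + 1), (a i).eval z * F (z ^ q ^ i))
        (𝓝[≠] (α ^ q ^ j)) (𝓝 (∑ i ∈ Finset.range (n + 1), (a i).eval (α ^ q ^ j) * v (j + i))) :=
      tendsto_finsetSum _ fun i _ => (hpoly (a i) j).mul ((hv (j + i)).comp (htend i j))
    exact tendsto_nhds_unique h2 (tendsto_const_nhds.congr' (h1.mono fun z hz => hz.symm))
  · filter_upwards [hlarge, (tendsto_pow_pow_atTop hα1 hq).eventually hval] with j hj hj'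
    rwa [tendsto_nhds_unique (hv j) hj]

end

section Convergent

open PowerSeries Polynomial Filter Topology

variable {K : Type*} [Field K] (ι : K →+* ℂ)

/-- The algebra of convergent power series with coefficients in a subfield of `ℂ`. -/
def convergentSeries : Subalgebra K K⟦X⟧ where
  carrier := {g | ∀ᶠ z in 𝓝 (0 : ℂ), ∃ s, HasValue (PowerSeries.map ι g) z s}
  mul_mem' {g h} hg hh := by
    filter_upwards [hg, hh] with z ⟨s, hs⟩ ⟨t, ht⟩
    exact ⟨s * t, by rw [map_mul]; exact hs.mul ht⟩
  add_mem' {g h} hg hh := by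
    filter_upwards [hg, hh] with z ⟨s, hs⟩ ⟨t, ht⟩
    exact ⟨s + t, by rw [map_add]; exact hs.add ht⟩
  algebraMap_mem' c := .of_forall fun z => ⟨_, by
    have : PowerSeries.map ι (algebraMap K K⟦X⟧ c) = ((Polynomial.C (ι c) : ℂ[X]) : ℂ⟦X⟧) := by
      rw [PowerSeries.algebraMap_apply]
      simp
    rw [this]
    exact HasValue.polynomial _ z⟩

/-- The sum of a power series with coefficients in a subfield of `ℂ`. -/
def seriesSum (g : K⟦X⟧) (z : ℂ) : ℂ := ∑' m, PowerSeries.coeff m (PowerSeries.map ι g) * z ^ m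

variable {ι}

theorem HasValue.seriesSum_eq {g : K⟦X⟧} {z s : ℂ} (h : HasValue (PowerSeries.map ι g) z s) :
    seriesSum ι g z = s := HasSum.tsum_eq h

theorem eventually_hasValue_seriesSum {g : K⟦X⟧} (hg : g ∈ convergentSeries ι) :
    ∀ᶠ z in 𝓝 (0 : ℂ), HasValue (PowerSeries.map ι g) z (seriesSum ι g z) := by
  filter_upwards [hg] with z ⟨s, hs⟩
  rwa [hs.seriesSum_eq]

theorem coe_mem_convergentSeries (p : K[X]) : (p : K⟦X⟧) ∈ convergentSeries ι :=
  .of_forall fun z => ⟨_, by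
    rw [← Polynomial.polynomial_map_coe]
    exact HasValue.polynomial (p.map ι) z⟩

theorem seriesSum_coe (p : K[X]) (z : ℂ) : seriesSum ι (p : K⟦X⟧) z = p.eval₂ ι z := by
  refine HasValue.seriesSum_eq ?_
  rw [← Polynomial.polynomial_map_coe, ← Polynomial.eval_map]
  exact HasValue.polynomial (p.map ι) z

theorem mem_convergentSeries_of_X_pow_mul_mem {T : ℕ} {g : K⟦X⟧}
    (h : PowerSeries.X ^ T * g ∈ convergentSeries ι) : g ∈ convergentSeries ι := by
  filter_upwards [h] with z ⟨s, hs⟩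
  by_cases hz : z = 0
  · refine ⟨ι (PowerSeries.coeff 0 g), ?_⟩
    rw [hz]
    have := hasSum_single (f := fun m => PowerSeries.coeff m (PowerSeries.map ι g) * 0 ^ m) 0
      fun m hm => by simp [hm]
    simpa [HasValue] using this
  · have h1 := (summable_nat_add_iff T).2 hs.summable
    have h2 := (h1.mul_right (z ^ T)⁻¹).hasSum
    refine ⟨_, h2.congr_fun fun m => ?_⟩
    rw [map_mul, map_pow, PowerSeries.map_X, mul_comm (_ ^ T), PowerSeries.coeff_mul_X_pow, pow_add]
    field_simp

/-- The variable, as a convergent power series. -/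
def convX : convergentSeries ι :=
  ⟨PowerSeries.X, by simpa using coe_mem_convergentSeries (ι := ι) (Polynomial.X : K[X])⟩

theorem convX_pow_dvd_iff {T : ℕ} {g : convergentSeries ι} :
    convX ^ T ∣ g ↔ ∀ m < T, PowerSeries.coeff m (g : K⟦X⟧) = 0 := by
  rw [← PowerSeries.X_pow_dvd_iff]
  constructor
  · rintro ⟨h, rfl⟩
    exact ⟨h, by simp [convX]⟩
  · rintro ⟨h, hh⟩
    refine ⟨⟨h, mem_convergentSeries_of_X_pow_mul_mem (T := T) ?_⟩, Subtype.ext ?_⟩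
    · rw [← hh]; exact g.2
    · simpa [convX] using hh

theorem prime_convX : Prime (convX : convergentSeries ι) := by
  have hdvd (g : convergentSeries ι) : convX ∣ g ↔ (PowerSeries.X : K⟦X⟧) ∣ (g : K⟦X⟧) := by
    rw [← pow_one convX, convX_pow_dvd_iff, ← PowerSeries.X_pow_dvd_iff, pow_one]
  have hX := PowerSeries.X_prime (R := K)
  refine ⟨fun h => hX.ne_zero (congrArg Subtype.val h), fun h => ?_, fun g h hgh => ?_⟩
  · rw [isUnit_iff_dvd_one, hdvd] at h
    exact hX.not_isUnit (isUnit_of_dvd_one h)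
  · rw [hdvd] at hgh ⊢
    rw [hdvd]
    exact hX.dvd_or_dvd hgh

end Convergent

section Size

open Polynomial

variable {K : Type*} [Field K]

/-- `SizeLE N x` : all the complex conjugates of `x` are bounded by `N`, and `N` is a
denominator of `x`. -/
def SizeLE (N : ℕ) (x : K) : Prop := (∀ τ : K →+* ℂ, ‖τ x‖ ≤ N) ∧ IsIntegral ℤ ((N : K) * x)

namespace SizeLE

variable {N M : ℕ} {x y : K}

theorem of_dvd (h : SizeLE N x) (hNM : N ∣ M) (hM : M ≠ 0) : SizeLE M x := by
  refine ⟨fun τ => (h.1 τ).trans (by exact_mod_cast Nat.le_of_dvd (Nat.pos_of_ne_zero hM) hNM), ?_⟩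
  obtain ⟨c, rfl⟩ := hNM
  rw [Nat.cast_mul, mul_comm (N : K), mul_assoc]
  exact (isIntegral_natCast c).mul h.2

theorem mul (hx : SizeLE N x) (hy : SizeLE M y) : SizeLE (N * M) (x * y) := by
  refine ⟨fun τ => ?_, ?_⟩
  · rw [map_mul, norm_mul, Nat.cast_mul]
    exact mul_le_mul (hx.1 τ) (hy.1 τ) (norm_nonneg _) (Nat.cast_nonneg _)
  · rw [Nat.cast_mul, mul_mul_mul_comm]
    exact hx.2.mul hy.2

theorem add (hx : SizeLE N x) (hy : SizeLE N y) : SizeLE (2 * N) (x + y) := by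
  refine ⟨fun τ => ?_, ?_⟩
  · rw [map_add, Nat.cast_mul, Nat.cast_two, two_mul]
    exact (norm_add_le _ _).trans (add_le_add (hx.1 τ) (hy.1 τ))
  · have := hx.2.add hy.2
    rw [Nat.cast_mul, Nat.cast_two, mul_assoc, two_mul, mul_add]
    exact this.add this

theorem neg (hx : SizeLE N x) : SizeLE N (-x) :=
  ⟨fun τ => by rw [map_neg, norm_neg]; exact hx.1 τ, by rw [mul_neg]; exact hx.2.neg⟩

theorem zero (N : ℕ) : SizeLE N (0 : K) := ⟨fun τ => by simp, by simp [isIntegral_zero]⟩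

theorem one : SizeLE 1 (1 : K) := ⟨fun τ => by simp, by simp [isIntegral_one]⟩

theorem pow (hx : SizeLE N x) (e : ℕ) : SizeLE (N ^ e) (x ^ e) := by
  induction e with
  | zero => simpa using one
  | succ e ih => rw [pow_succ, pow_succ]; exact ih.mul hx

theorem exists_of_numberField [NumberField K] (x : K) : ∃ N : ℕ, N ≠ 0 ∧ SizeLE N x := by
  obtain ⟨d, hd0, hd⟩ := IsAlgebraic.exists_integral_multiple (R := ℤ) (z := x)
    ((IsFractionRing.isAlgebraic_iff ℤ ℚ K).2 (Algebra.IsAlgebraic.isAlgebraic x))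
  have hfin : Finite (K →+* ℂ) := inferInstance
  obtain ⟨M, hM⟩ : ∃ M : ℕ, ∀ τ : K →+* ℂ, ‖τ x‖ ≤ M := by
    obtain ⟨M, hM⟩ := (Set.finite_range fun τ : K →+* ℂ => ‖τ x‖).bddAbove
    obtain ⟨M', hM'⟩ := exists_nat_ge M
    exact ⟨M', fun τ => (hM ⟨τ, rfl⟩).trans hM'⟩
  refine ⟨d.natAbs * (M + 1), by simpa using hd0, fun τ => (hM τ).trans ?_, ?_⟩
  · have : 1 ≤ d.natAbs := by omega
    exact_mod_cast (by nlinarith : M ≤ d.natAbs * (M + 1))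
  · have h1 : IsIntegral ℤ ((d.natAbs : K) * x) := by
      rcases Int.natAbs_eq d with h | h
      · rw [h, zsmul_eq_mul, Int.cast_natCast] at hd
        exact hd
      · rw [h, zsmul_eq_mul, Int.cast_neg, Int.cast_natCast, neg_mul] at hd
        simpa using hd.neg
    rw [Nat.cast_mul, mul_comm (d.natAbs : K), mul_assoc]
    exact (isIntegral_natCast (M + 1)).mul h1

/-- Liouville's inequality. -/
theorem one_le_norm_mul [NumberField K] (h : SizeLE N x) (hx : x ≠ 0) (hN : N ≠ 0) (ι : K →+* ℂ) :
    1 ≤ ‖ι x‖ * (N : ℝ) ^ (2 * Module.finrank ℚ K) := by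
  classical
  have hNK : (N : K) ≠ 0 := Nat.cast_ne_zero.2 hN
  have hN1 : (1 : ℝ) ≤ N := by exact_mod_cast Nat.one_le_iff_ne_zero.2 hN
  set y : K := N * x with hy
  have hint := Algebra.isIntegral_norm ℚ h.2
  obtain ⟨m, hm⟩ := IsIntegrallyClosed.isIntegral_iff.1 hint
  have hm0 : m ≠ 0 := by
    rintro rfl
    rw [map_zero, eq_comm, Algebra.norm_eq_zero_iff] at hm
    exact mul_ne_zero hNK hx hm
  have hprod := Algebra.norm_eq_prod_embeddings ℚ ℂ y
  have h1 : (1 : ℝ) ≤ ∏ σ : K →ₐ[ℚ] ℂ, ‖σ y‖ := by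
    rw [← norm_prod, ← hprod, ← hm]
    simp only [eq_intCast, map_intCast, Complex.norm_intCast]
    exact_mod_cast Int.one_le_abs hm0
  have hσ (σ : K →ₐ[ℚ] ℂ) : ‖σ y‖ ≤ (N : ℝ) ^ 2 := by
    rw [hy, map_mul, norm_mul, map_natCast, Complex.norm_natCast, sq]
    exact mul_le_mul_of_nonneg_left (h.1 (σ : K →+* ℂ)) (Nat.cast_nonneg _)
  have hcard : Fintype.card (K →ₐ[ℚ] ℂ) = Module.finrank ℚ K := AlgHom.card ℚ K ℂ
  set σ₀ : K →ₐ[ℚ] ℂ := ι.toRatAlgHom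
  have hσ₀ : ‖σ₀ y‖ = N * ‖ι x‖ := by
    simp [hy, σ₀]
  rw [← Finset.mul_prod_erase _ _ (Finset.mem_univ σ₀), hσ₀] at h1
  have h2 : ∏ σ ∈ Finset.univ.erase σ₀, ‖σ y‖ ≤ ((N : ℝ) ^ 2) ^ (Module.finrank ℚ K - 1) := by
    rw [← hcard, ← Finset.card_univ, ← Finset.card_erase_of_mem (Finset.mem_univ σ₀)]
    rw [← Finset.prod_const]
    exact Finset.prod_le_prod (fun _ _ => norm_nonneg _) fun σ _ => hσ σ
  have h3 : 1 ≤ Module.finrank ℚ K := Module.finrank_pos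
  calc (1 : ℝ) ≤ _ := h1
    _ ≤ N * ‖ι x‖ * ((N : ℝ) ^ 2) ^ (Module.finrank ℚ K - 1) :=
        mul_le_mul_of_nonneg_left h2 (by positivity)
    _ = ‖ι x‖ * (N : ℝ) ^ (2 * (Module.finrank ℚ K - 1) + 1) := by rw [← pow_mul]; ring
    _ ≤ _ := by
        gcongr
        omega

end SizeLE

/-- The sequences in a number field whose size grows at most like `N ^ q ^ k`. -/
def polySize (K : Type*) [Field K] [NumberField K] {q : ℕ} (hq : q ≠ 0) : Subring (ℕ → K) where
  carrier := {x | ∃ N : ℕ, N ≠ 0 ∧ ∀ k, SizeLE (N ^ q ^ k) (x k)}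
  zero_mem' := ⟨1, one_ne_zero, fun k => .zero _⟩
  one_mem' := ⟨1, one_ne_zero, fun k => by simpa using SizeLE.one⟩
  neg_mem' := fun ⟨N, hN, h⟩ => ⟨N, hN, fun k => (h k).neg⟩
  mul_mem' := fun ⟨N, hN, h⟩ ⟨M, hM, h'⟩ =>
    ⟨N * M, mul_ne_zero hN hM, fun k => by rw [mul_pow]; exact (h k).mul (h' k)⟩
  add_mem' := by
    rintro x y ⟨N, hN, h⟩ ⟨M, hM, h'⟩
    refine ⟨2 * (N * M), by positivity, fun k => ?_⟩
    have h0 : (N * M) ^ q ^ k ≠ 0 := by positivity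
    rw [mul_pow]
    refine (((h k).of_dvd ?_ h0).add ((h' k).of_dvd ?_ h0)).of_dvd ?_ (by positivity)
    · rw [mul_pow]; exact dvd_mul_right _ _
    · rw [mul_pow]; exact dvd_mul_left _ _
    · exact Nat.mul_dvd_mul_right (dvd_pow_self 2 (by positivity)) _

section MahlerCofactor

variable {q : ℕ}

theorem eval_pow_mem_polySize [NumberField K] (hq : q ≠ 0) (α : K) (p : K[X]) :
    (fun k => p.eval (α ^ q ^ k)) ∈ polySize K hq := by
  have hC (c : K) : (fun _ => c) ∈ polySize K hq := by
    obtain ⟨N, hN, h⟩ := SizeLE.exists_of_numberField c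
    exact ⟨N, hN, fun k => h.of_dvd (dvd_pow_self N (by positivity)) (by positivity)⟩
  have hα : (fun k => α ^ q ^ k) ∈ polySize K hq := by
    obtain ⟨N, hN, h⟩ := SizeLE.exists_of_numberField α
    exact ⟨N, hN, fun k => h.pow _⟩
  induction p using Polynomial.induction_on' with
  | add p r hp hr => simp only [eval_add]; exact add_mem hp hr
  | monomial m c =>
    simp only [eval_monomial]
    exact mul_mem (hC c) (pow_mem hα m)

/-- The coefficients of the linear form in the values `f(α ^ q ^ k), …, f(α ^ q ^ (k + n - 1))`
which is obtained from `f(α)` by iterating a Mahler equation of order `n`. -/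
def mahlerCofactor (q n : ℕ) (a : ℕ → K[X]) (α : K) : ℕ → ℕ → K
  | 0, i => if i = 0 then 1 else 0
  | k + 1, i => if i < n then (a 0).eval (α ^ q ^ k) * mahlerCofactor q n a α k (i + 1) -
      (a (i + 1)).eval (α ^ q ^ k) * mahlerCofactor q n a α k 0 else 0

theorem mahlerCofactor_of_le {n : ℕ} (hn : n ≠ 0) (a : ℕ → K[X]) (α : K) (k : ℕ) {i : ℕ}
    (hi : n ≤ i) : mahlerCofactor q n a α k i = 0 := by
  cases k with
  | zero => rw [mahlerCofactor, if_neg (by omega)]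
  | succ k => rw [mahlerCofactor, if_neg (by omega)]

theorem exists_mahlerCofactor_ne_zero {n : ℕ} (hn : n ≠ 0) {a : ℕ → K[X]} {α : K}
    (ha0 : ∀ k, (a 0).eval (α ^ q ^ k) ≠ 0) (han : ∀ k, (a n).eval (α ^ q ^ k) ≠ 0) (k : ℕ) :
    ∃ i < n, mahlerCofactor q n a α k i ≠ 0 := by
  induction k with
  | zero => exact ⟨0, by omega, by simp [mahlerCofactor]⟩
  | succ k ih =>
    by_contra! h
    have h0 : mahlerCofactor q n a α k 0 = 0 := by
      have := h (n - 1) (by omega)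
      rw [mahlerCofactor, if_pos (by omega), Nat.sub_add_cancel (by omega),
        mahlerCofactor_of_le hn a α k le_rfl, mul_zero, zero_sub, neg_eq_zero] at this
      exact (mul_eq_zero.1 this).resolve_left (han k)
    obtain ⟨i, hi, hne⟩ := ih
    obtain ⟨j, rfl⟩ := Nat.exists_eq_succ_of_ne_zero (n := i) (by rintro rfl; exact hne h0)
    have := h j (by omega)
    rw [mahlerCofactor, if_pos (by omega), h0, mul_zero, sub_zero] at this
    exact hne ((mul_eq_zero.1 this).resolve_left (ha0 k))

theorem sum_mahlerCofactor_mul {n : ℕ} (hn : n ≠ 0) {a : ℕ → K[X]} {α : K} {R : Type*} [CommRing R]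
    [IsDomain R] (ι : K →+* R) {v : ℕ → R} (hv0 : v 0 = 0)
    (hv : ∀ k, ∑ i ∈ Finset.range (n + 1), ι ((a i).eval (α ^ q ^ k)) * v (k + i) = 0) (k : ℕ) :
    ∑ i ∈ Finset.range n, ι (mahlerCofactor q n a α k i) * v (k + i) = 0 := by
  induction k with
  | zero =>
    refine Finset.sum_eq_zero fun i _ => ?_
    rcases eq_or_ne i 0 with rfl | hi
    · simp [hv0]
    · simp [mahlerCofactor, hi]
  | succ k ih =>
    have h1 := hv k
    rw [Finset.sum_range_succ'] at h1
    obtain ⟨m, rfl⟩ := Nat.exists_eq_succ_of_ne_zero hn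
    rw [Finset.sum_range_succ'] at ih
    have h2 : ∑ i ∈ Finset.range (m + 1), ι (mahlerCofactor q (m + 1) a α k (i + 1)) *
        v (k + (i + 1)) = ∑ i ∈ Finset.range m, ι (mahlerCofactor q (m + 1) a α k (i + 1)) *
        v (k + (i + 1)) := by
      rw [Finset.sum_range_succ, mahlerCofactor_of_le hn a α k le_rfl, map_zero, zero_mul, add_zero]
    have h3 : ∑ i ∈ Finset.range (m + 1), ι (mahlerCofactor q (m + 1) a α (k + 1) i) *
        v (k + 1 + i) = ι ((a 0).eval (α ^ q ^ k)) * ∑ i ∈ Finset.range (m + 1),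
        ι (mahlerCofactor q (m + 1) a α k (i + 1)) * v (k + (i + 1)) -
        ι (mahlerCofactor q (m + 1) a α k 0) * ∑ i ∈ Finset.range (m + 1),
        ι ((a (i + 1)).eval (α ^ q ^ k)) * v (k + (i + 1)) := by
      rw [Finset.mul_sum, Finset.mul_sum, ← Finset.sum_sub_distrib]
      refine Finset.sum_congr rfl fun i hi => ?_
      rw [mahlerCofactor, if_pos (Finset.mem_range.1 hi), map_sub, map_mul, map_mul,
        add_assoc k 1 i, add_comm 1 i]
      ring
    rw [Nat.succ_eq_add_one, h3, h2]
    linear_combination ι ((a 0).eval (α ^ q ^ k)) * ih - ι (mahlerCofactor q (m + 1) a α k 0) * h1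

theorem exists_sizeLE_mahlerCofactor [NumberField K] (hq : 2 ≤ q) (n : ℕ) (a : ℕ → K[X]) (α : K) :
    ∃ B : ℕ, B ≠ 0 ∧ (∀ k, SizeLE (B ^ q ^ k) (α ^ q ^ k)) ∧
      ∀ k i, SizeLE (B ^ q ^ k) (mahlerCofactor q n a α k i) := by
  have hq0 : q ≠ 0 := by omega
  obtain ⟨N, hN, hα⟩ := SizeLE.exists_of_numberField α
  choose M hM hMa using fun i => eval_pow_mem_polySize hq0 α (a i)
  set P := ∏ i ∈ Finset.range (n + 1), M i with hP
  have hP0 : P ≠ 0 := Finset.prod_ne_zero_iff.2 fun i _ => hM i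
  have hPa (i) (hi : i ≤ n) (k) : SizeLE (P ^ q ^ k) ((a i).eval (α ^ q ^ k)) :=
    (hMa i k).of_dvd (pow_dvd_pow_of_dvd
      (Finset.dvd_prod_of_mem M (Finset.mem_range.2 (by omega))) _) (by positivity)
  refine ⟨2 * P * N, by positivity, fun k => ?_, fun k => ?_⟩
  · exact (hα.pow _).of_dvd (pow_dvd_pow_of_dvd (dvd_mul_left _ _) _) (by positivity)
  induction k with
  | zero =>
    intro i
    rw [mahlerCofactor]
    split_ifs
    · exact SizeLE.one.of_dvd (one_dvd _) (by positivity)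
    · exact .zero _
  | succ k ih =>
    intro i
    rw [mahlerCofactor]
    split_ifs with hi
    · rw [sub_eq_add_neg]
      refine (((hPa 0 (by omega) k).mul (ih (i + 1))).add
        ((hPa (i + 1) hi k).mul (ih 0)).neg).of_dvd ?_ (by positivity)
      have h1 : (2 * P * N) ^ q ^ k * (2 * P * N) ^ q ^ k ∣ (2 * P * N) ^ q ^ (k + 1) := by
        rw [← pow_add]
        refine pow_dvd_pow _ ?_
        rw [pow_succ, ← mul_two]
        exact Nat.mul_le_mul_left _ hq
      refine dvd_trans ?_ h1
      rw [← mul_assoc]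
      refine Nat.mul_dvd_mul_right ?_ _
      rw [mul_pow, mul_pow]
      exact (Nat.mul_dvd_mul_right (dvd_pow_self 2 (by positivity)) _).trans (dvd_mul_right _ _)
    · exact .zero _

end MahlerCofactor

end Size

section UltraGerm

open PowerSeries Polynomial Filter Topology

/-- The field of germs of complex sequences along a nonprincipal ultrafilter. -/
abbrev SeqGerm : Type := Germ (hyperfilter ℕ : Filter ℕ) ℂ

variable {K : Type*} [Field K] {ι : K →+* ℂ}

/-- Evaluation of convergent power series along a sequence tending to `0`. -/
def germEval {β : ℕ → ℂ} (hβ : Tendsto β atTop (𝓝 0)) : convergentSeries ι →+* SeqGerm where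
  toFun g := ((fun k => seriesSum ι (g : K⟦X⟧) (β k) : ℕ → ℂ) : SeqGerm)
  map_one' := Germ.coe_eq.2 <| .of_forall fun k => by
    simpa using seriesSum_coe (ι := ι) (1 : K[X]) (β k)
  map_zero' := Germ.coe_eq.2 <| .of_forall fun k => by
    simpa using seriesSum_coe (ι := ι) (0 : K[X]) (β k)
  map_mul' g h := by
    rw [← Germ.coe_mul, Germ.coe_eq]
    have hβ' := hβ.mono_left Nat.hyperfilter_le_atTop
    filter_upwards [hβ'.eventually (eventually_hasValue_seriesSum g.2),
      hβ'.eventually (eventually_hasValue_seriesSum h.2)] with k hg hh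
    refine HasValue.seriesSum_eq ?_
    rw [MulMemClass.coe_mul, map_mul]
    exact hg.mul hh
  map_add' g h := by
    rw [← Germ.coe_add, Germ.coe_eq]
    have hβ' := hβ.mono_left Nat.hyperfilter_le_atTop
    filter_upwards [hβ'.eventually (eventually_hasValue_seriesSum g.2),
      hβ'.eventually (eventually_hasValue_seriesSum h.2)] with k hg hh
    refine HasValue.seriesSum_eq ?_
    rw [AddMemClass.coe_add, map_add]
    exact hg.add hh

theorem germEval_apply {β : ℕ → ℂ} (hβ : Tendsto β atTop (𝓝 0)) (g : convergentSeries ι) :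
    germEval hβ g = ((fun k => seriesSum ι (g : K⟦X⟧) (β k) : ℕ → ℂ) : SeqGerm) := rfl

/-- The inclusion of polynomials into convergent power series. -/
def polyToConv (ι : K →+* ℂ) : K[X] →+* convergentSeries ι :=
  Polynomial.coeToPowerSeries.ringHom.codRestrict (convergentSeries ι) coe_mem_convergentSeries

theorem coe_polyToConv (p : K[X]) : (polyToConv ι p : K⟦X⟧) = p := rfl

theorem polyToConv_X : polyToConv ι X = convX := Subtype.ext (by simp [coe_polyToConv, convX])

theorem germEval_polyToConv {β : ℕ → ℂ} (hβ : Tendsto β atTop (𝓝 0)) (p : K[X]) :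
    germEval hβ (polyToConv ι p) = ((fun k => p.eval₂ ι (β k) : ℕ → ℂ) : SeqGerm) := by
  simp only [germEval_apply, coe_polyToConv, seriesSum_coe]

/-- `GrowthLE B q e x` : the germ `x` is represented by a sequence which is
`O(B ^ (e * q ^ k))`. -/
def GrowthLE (B q e : ℕ) (x : SeqGerm) : Prop :=
  ∃ C : ℝ, 0 ≤ C ∧ ∃ g : ℕ → ℂ, x = (g : SeqGerm) ∧
    ∀ᶠ k in (hyperfilter ℕ : Filter ℕ), ‖g k‖ ≤ C * (B : ℝ) ^ (e * q ^ k)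

namespace GrowthLE

variable {B q e e' : ℕ} {x y : SeqGerm}

theorem mono (hB : B ≠ 0) (h : GrowthLE B q e x) (hee : e ≤ e') : GrowthLE B q e' x := by
  obtain ⟨C, hC, g, rfl, hg⟩ := h
  refine ⟨C, hC, g, rfl, hg.mono fun k hk => hk.trans ?_⟩
  have : (1 : ℝ) ≤ B := by exact_mod_cast Nat.one_le_iff_ne_zero.2 hB
  gcongr

theorem zero : GrowthLE B q e 0 := ⟨0, le_rfl, 0, rfl, .of_forall fun k => by simp⟩

theorem one : GrowthLE B q 0 1 := ⟨1, zero_le_one, 1, rfl, .of_forall fun k => by simp⟩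

theorem add (hx : GrowthLE B q e x) (hy : GrowthLE B q e y) : GrowthLE B q e (x + y) := by
  obtain ⟨C, hC, g, rfl, hg⟩ := hx
  obtain ⟨C', hC', g', rfl, hg'⟩ := hy
  refine ⟨C + C', by positivity, g + g', rfl, ?_⟩
  filter_upwards [hg, hg'] with k h h'
  rw [add_mul]
  exact (norm_add_le _ _).trans (add_le_add h h')

theorem mul (hx : GrowthLE B q e x) (hy : GrowthLE B q e' y) : GrowthLE B q (e + e') (x * y) := by
  obtain ⟨C, hC, g, rfl, hg⟩ := hx
  obtain ⟨C', hC', g', rfl, hg'⟩ := hy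
  refine ⟨C * C', by positivity, g * g', rfl, ?_⟩
  filter_upwards [hg, hg'] with k h h'
  rw [add_mul, pow_add, mul_mul_mul_comm, Pi.mul_apply, norm_mul]
  exact mul_le_mul h h' (norm_nonneg _) (by positivity)

theorem pow (hx : GrowthLE B q e x) (m : ℕ) : GrowthLE B q (m * e) (x ^ m) := by
  induction m with
  | zero => simpa using one
  | succ m ih => rw [pow_succ, Nat.succ_mul]; exact ih.mul hx

theorem sum {I : Type*} (J : Finset I) {x : I → SeqGerm} (h : ∀ i ∈ J, GrowthLE B q e (x i)) :
    GrowthLE B q e (∑ i ∈ J, x i) :=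
  Finset.sum_induction _ _ (fun _ _ => add) zero h

theorem prod {I : Type*} (J : Finset I) {x : I → SeqGerm} {e : I → ℕ}
    (h : ∀ i ∈ J, GrowthLE B q (e i) (x i)) : GrowthLE B q (∑ i ∈ J, e i) (∏ i ∈ J, x i) := by
  classical
  induction J using Finset.induction_on with
  | empty => simpa using one
  | insert i J hi ih =>
    rw [Finset.sum_insert hi, Finset.prod_insert hi]
    exact (h i (Finset.mem_insert_self i J)).mul (ih fun j hj => h j (Finset.mem_insert_of_mem hj))

theorem germEval {β : ℕ → ℂ} (hβ : Tendsto β atTop (𝓝 0)) (g : convergentSeries ι) :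
    GrowthLE B q 0 (germEval hβ g) := by
  have hc : ContinuousAt (seriesSum ι (g : K⟦X⟧)) 0 :=
    (analyticAt_zero_of_hasValue (eventually_hasValue_seriesSum g.2)).continuousAt
  have h1 := (hc.tendsto.comp (hβ.mono_left Nat.hyperfilter_le_atTop)).norm.eventually_le_const
    (lt_add_one _)
  refine ⟨‖seriesSum ι (g : K⟦X⟧) 0‖ + 1, by positivity, _, rfl, h1.mono fun k hk => ?_⟩
  simpa using hk

theorem eval₂ (hB : B ≠ 0) {β : ℕ → ℂ} (hβ : Tendsto β atTop (𝓝 0)) {s : Type*} [Fintype s]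
    {η : s → SeqGerm} (hη : ∀ j, GrowthLE B q 1 (η j)) {G : MvPolynomial s (convergentSeries ι)}
    {M : ℕ} (hG : ∀ w ∈ G.support, ∀ j, w j ≤ M) :
    GrowthLE B q (Fintype.card s * M) (MvPolynomial.eval₂ (_root_.germEval hβ) η G) := by
  rw [MvPolynomial.eval₂_eq']
  refine sum _ fun w hw => ?_
  refine ((germEval hβ _).mul (prod Finset.univ fun j _ => (hη j).pow (w j))).mono hB ?_
  rw [zero_add, ← Finset.card_univ, ← smul_eq_mul]
  exact Finset.sum_le_card_nsmul _ _ _ fun j _ => by simpa using hG w hw j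

end GrowthLE

/-- `HeightLE ι B q e x` : the germ `x` is represented by a sequence in the number field `K`
whose size is `O(B ^ (e * q ^ k))`. -/
def HeightLE (ι : K →+* ℂ) (B q e : ℕ) (x : SeqGerm) : Prop :=
  ∃ C : ℕ, C ≠ 0 ∧ ∃ g : ℕ → K, x = ((fun k => ι (g k) : ℕ → ℂ) : SeqGerm) ∧
    ∀ k, SizeLE (C * B ^ (e * q ^ k)) (g k)

namespace HeightLE

variable {B q e e' : ℕ} {x y : SeqGerm}

theorem mono (hB : B ≠ 0) (h : HeightLE ι B q e x) (hee : e ≤ e') : HeightLE ι B q e' x := by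
  obtain ⟨C, hC, g, rfl, hg⟩ := h
  refine ⟨C, hC, g, rfl, fun k => (hg k).of_dvd ?_ (by positivity)⟩
  exact Nat.mul_dvd_mul_left _ (pow_dvd_pow _ (Nat.mul_le_mul_right _ hee))

theorem zero : HeightLE ι B q e 0 := ⟨1, one_ne_zero, 0, by simp; rfl, fun k => .zero _⟩

theorem one : HeightLE ι B q 0 1 :=
  ⟨1, one_ne_zero, 1, by simp; rfl, fun k => by simpa using SizeLE.one⟩

theorem add (hB : B ≠ 0) (hx : HeightLE ι B q e x) (hy : HeightLE ι B q e y) :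
    HeightLE ι B q e (x + y) := by
  obtain ⟨C, hC, g, rfl, hg⟩ := hx
  obtain ⟨C', hC', g', rfl, hg'⟩ := hy
  refine ⟨2 * (C * C'), by positivity, g + g', ?_, fun k => ?_⟩
  · rw [← Germ.coe_add]
    congr 1
    ext k
    simp
  · rw [mul_assoc]
    refine ((hg k).of_dvd ?_ (by positivity)).add ((hg' k).of_dvd ?_ (by positivity))
    · exact Nat.mul_dvd_mul_right (dvd_mul_right _ _) _
    · exact Nat.mul_dvd_mul_right (dvd_mul_left _ _) _

theorem mul (hx : HeightLE ι B q e x) (hy : HeightLE ι B q e' y) :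
    HeightLE ι B q (e + e') (x * y) := by
  obtain ⟨C, hC, g, rfl, hg⟩ := hx
  obtain ⟨C', hC', g', rfl, hg'⟩ := hy
  refine ⟨C * C', by positivity, g * g', ?_, fun k => ?_⟩
  · rw [← Germ.coe_mul]
    congr 1
    ext k
    simp
  · rw [add_mul, pow_add, mul_mul_mul_comm]
    exact (hg k).mul (hg' k)

theorem pow (hx : HeightLE ι B q e x) (m : ℕ) : HeightLE ι B q (m * e) (x ^ m) := by
  induction m with
  | zero => simpa using one
  | succ m ih => rw [pow_succ, Nat.succ_mul]; exact ih.mul hx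

theorem sum (hB : B ≠ 0) {I : Type*} (J : Finset I) {x : I → SeqGerm}
    (h : ∀ i ∈ J, HeightLE ι B q e (x i)) : HeightLE ι B q e (∑ i ∈ J, x i) :=
  Finset.sum_induction _ _ (fun _ _ => add hB) zero h

theorem prod {I : Type*} (J : Finset I) {x : I → SeqGerm} {e : I → ℕ}
    (h : ∀ i ∈ J, HeightLE ι B q (e i) (x i)) :
    HeightLE ι B q (∑ i ∈ J, e i) (∏ i ∈ J, x i) := by
  classical
  induction J using Finset.induction_on with
  | empty => simpa using one
  | insert i J hi ih =>
    rw [Finset.sum_insert hi, Finset.prod_insert hi]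
    exact (h i (Finset.mem_insert_self i J)).mul (ih fun j hj => h j (Finset.mem_insert_of_mem hj))

theorem growthLE (h : HeightLE ι B q e x) : GrowthLE B q e x := by
  obtain ⟨C, hC, g, rfl, hg⟩ := h
  exact ⟨C, by positivity, _, rfl, .of_forall fun k => by exact_mod_cast (hg k).1 ι⟩

theorem const [NumberField K] (c : K) :
    HeightLE ι B q 0 ((fun _ => ι c : ℕ → ℂ) : SeqGerm) := by
  obtain ⟨N, hN, h⟩ := SizeLE.exists_of_numberField c
  exact ⟨N, hN, fun _ => c, rfl, fun k => by simpa using h⟩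

theorem germEval_polyToConv [NumberField K] (hB : B ≠ 0) {β : ℕ → ℂ} (hβ : Tendsto β atTop (𝓝 0))
    (hζ : HeightLE ι B q 1 (germEval hβ (polyToConv ι X))) {p : K[X]} {m : ℕ}
    (hp : p.natDegree ≤ m) : HeightLE ι B q m (germEval hβ (polyToConv ι p)) := by
  rw [p.as_sum_range_C_mul_X_pow, map_sum, map_sum]
  refine sum hB _ fun i hi => ?_
  rw [map_mul, map_mul, map_pow, map_pow]
  refine HeightLE.mono hB (e := 0 + i * 1) (.mul ?_ (hζ.pow i)) ?_
  · rw [_root_.germEval_polyToConv]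
    simpa using const (p.coeff i)
  · have := Finset.mem_range.1 hi
    omega

theorem eval₂ [NumberField K] (hB : B ≠ 0) {β : ℕ → ℂ} (hβ : Tendsto β atTop (𝓝 0))
    (hζ : HeightLE ι B q 1 (germEval hβ (polyToConv ι X))) {s : Type*} [Fintype s]
    {η : s → SeqGerm} (hη : ∀ j, HeightLE ι B q 1 (η j)) {P : MvPolynomial s K[X]} {m M : ℕ}
    (hm : ∀ w, (P.coeff w).natDegree ≤ m) (hM : ∀ w ∈ P.support, ∀ j, w j ≤ M) :
    HeightLE ι B q (m + Fintype.card s * M)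
      (MvPolynomial.eval₂ ((germEval hβ).comp (polyToConv ι)) η P) := by
  rw [MvPolynomial.eval₂_eq']
  refine sum hB _ fun w hw => ?_
  refine ((germEval_polyToConv hB hβ hζ (hm w)).mul
    (prod Finset.univ fun j _ => (hη j).pow (w j))).mono hB (Nat.add_le_add_left ?_ m)
  rw [← Finset.card_univ, ← smul_eq_mul]
  exact Finset.sum_le_card_nsmul _ _ _ fun j _ => by simpa using hM w hw j

/-- Liouville's inequality for germs: a nonzero germ of small height cannot be too small. -/
theorem one_le_of_eq_mul [NumberField K] (hq : 2 ≤ q) (hB : B ≠ 0) (hx : HeightLE ι B q e x)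
    (hx0 : x ≠ 0) {α : ℂ} {T : ℕ}
    (hxy : x = ((fun k => α ^ q ^ k : ℕ → ℂ) : SeqGerm) ^ T * y) (hy : GrowthLE B q e' y) :
    1 ≤ ‖α‖ ^ T * (B : ℝ) ^ (e' + 2 * Module.finrank ℚ K * e) := by
  set h := Module.finrank ℚ K
  obtain ⟨C, hC, g, rfl, hg⟩ := hx
  obtain ⟨C', hC', g', rfl, hg'⟩ := hy
  set Γ := ‖α‖ ^ T * (B : ℝ) ^ (e' + 2 * h * e) with hΓ
  have hne : ∀ᶠ k in (hyperfilter ℕ : Filter ℕ), ι (g k) ≠ 0 := by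
    rw [Ultrafilter.eventually_not]
    exact fun h => hx0 (Germ.coe_eq.2 h)
  have heq : ∀ᶠ k in (hyperfilter ℕ : Filter ℕ), ι (g k) = (α ^ q ^ k) ^ T * g' k :=
    Germ.coe_eq.1 hxy
  have hbound : ∀ᶠ k in (hyperfilter ℕ : Filter ℕ), 1 ≤ C' * (C : ℝ) ^ (2 * h) * Γ ^ q ^ k := by
    filter_upwards [hne, heq, hg'] with k h1 h2 h3
    have h4 := (hg k).one_le_norm_mul (fun h => h1 (by rw [h, map_zero])) (by positivity) ι
    refine h4.trans ?_
    rw [h2, norm_mul, norm_pow, norm_pow]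
    calc _ ≤ (‖α‖ ^ q ^ k) ^ T * (C' * (B : ℝ) ^ (e' * q ^ k)) *
          ((C * B ^ (e * q ^ k) : ℕ) : ℝ) ^ (2 * h) := by gcongr
      _ = _ := by
        rw [hΓ]
        push_cast
        ring
  by_contra! hlt
  have hΓ0 : 0 ≤ Γ := by positivity
  have hlim : Tendsto (fun k => C' * (C : ℝ) ^ (2 * h) * Γ ^ q ^ k) atTop (𝓝 0) := by
    have := ((tendsto_pow_atTop_nhds_zero_of_lt_one hΓ0 hlt).comp
      (tendsto_pow_atTop_atTop_of_one_lt (r := q) (by omega))).const_mul (C' * (C : ℝ) ^ (2 * h))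
    simpa using this
  have hev := (hlim.mono_left Nat.hyperfilter_le_atTop).eventually_lt_const one_pos
  obtain ⟨k, hk1, hk2⟩ := (hbound.and hev).exists
  exact absurd hk2 (not_lt.2 hk1)

end HeightLE

end UltraGerm

section Auxiliary

open PowerSeries Polynomial Filter Topology

variable {K : Type*} [Field K] {ι : K →+* ℂ} {s : Type*}

theorem degreeOf_sum_map_mul_pow_lt {D δ : ℕ} (hD : 0 < D * δ)
    {Q : MvPolynomial s (convergentSeries ι)} (hQ : ∀ j, Q.degreeOf j ≤ D)
    {P : ℕ → MvPolynomial s K[X]} (hP : ∀ v j, (P v).degreeOf j < D * δ) (v₀ : ℕ) {r : ℕ}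
    (hr : r ≤ δ) (j : s) :
    (∑ v ∈ Finset.range r, MvPolynomial.map (polyToConv ι) (P (v₀ + v)) * Q ^ v).degreeOf j <
      2 * (D * δ) := by
  refine (MvPolynomial.degreeOf_sum_le _ _ _).trans_lt ?_
  rw [Finset.sup_lt_iff (by simp only [bot_eq_zero']; omega)]
  intro v hv
  have h1 := MvPolynomial.degreeOf_mul_le j (MvPolynomial.map (polyToConv ι) (P (v₀ + v))) (Q ^ v)
  have h2 := MvPolynomial.degreeOf_pow_le j Q v
  have h3 : (MvPolynomial.map (polyToConv ι) (P (v₀ + v))).degreeOf j ≤ (P (v₀ + v)).degreeOf j := by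
    simp only [MvPolynomial.degreeOf_eq_sup]
    exact Finset.sup_mono (MvPolynomial.support_map_subset _ _)
  have h4 : v * Q.degreeOf j ≤ D * δ := by
    rw [mul_comm D]
    exact Nat.mul_le_mul ((Finset.mem_range.1 hv).le.trans hr) (hQ j)
  have h5 := hP (v₀ + v) j
  omega

theorem germEval_convX {β : ℕ → ℂ} (hβ : Tendsto β atTop (𝓝 0)) :
    germEval hβ (convX : convergentSeries ι) = (β : SeqGerm) := by
  rw [← polyToConv_X, germEval_polyToConv]
  simp

theorem exists_not_dvd_of_ne_zero {Q : MvPolynomial s (convergentSeries ι)} (hQ : Q ≠ 0) :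
    ∃ (t : ℕ) (Q' : MvPolynomial s (convergentSeries ι)),
      Q = MvPolynomial.C convX ^ t * Q' ∧ ¬ MvPolynomial.C convX ∣ Q' := by
  obtain ⟨w, hw⟩ := MvPolynomial.ne_zero_iff.1 hQ
  have hfin : FiniteMultiplicity (MvPolynomial.C convX) Q := by
    by_contra h
    rw [FiniteMultiplicity.not_iff_forall] at h
    refine hw (Subtype.ext (PowerSeries.ext fun t => ?_))
    have h1 := h (t + 1)
    rw [← map_pow, MvPolynomial.C_dvd_iff_dvd_coeff] at h1
    exact convX_pow_dvd_iff.1 (h1 w) t (Nat.lt_succ_self t)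
  obtain ⟨Q', h1, h2⟩ := hfin.exists_eq_pow_mul_and_not_dvd
  exact ⟨_, Q', h1, h2⟩

variable [Fintype s]

/-- Construction of an auxiliary function: a linear combination of powers of `Q` with
high order of vanishing at `0`. -/
theorem exists_auxiliary_polynomials {D δ m T : ℕ} (hD : 0 < D * δ)
    {Q : MvPolynomial s (convergentSeries ι)} (hQ : ∀ j, Q.degreeOf j ≤ D)
    (hcard : T * (2 * (D * δ)) ^ Fintype.card s < δ * (m + 1) * (D * δ) ^ Fintype.card s) :
    ∃ P : ℕ → MvPolynomial s K[X], (∃ v < δ, P v ≠ 0) ∧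
      (∀ v w, ((P v).coeff w).natDegree ≤ m) ∧ (∀ v j, (P v).degreeOf j < D * δ) ∧
      MvPolynomial.C (convX ^ T) ∣
        ∑ v ∈ Finset.range δ, MvPolynomial.map (polyToConv ι) (P v) * Q ^ v := by
  classical
  let fs {N : ℕ} (u : s → Fin N) : s →₀ ℕ := Finsupp.equivFunOnFinite.symm fun j => (u j : ℕ)
  have hfs {N : ℕ} {u u' : s → Fin N} (h : fs u = fs u') : u = u' := by
    funext j
    exact Fin.ext (DFunLike.congr_fun h j)
  let J := Fin δ × Fin (m + 1) × (s → Fin (D * δ))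
  let G (i : J) : MvPolynomial s (convergentSeries ι) :=
    MvPolynomial.monomial (fs i.2.2) (convX ^ (i.2.1 : ℕ)) * Q ^ (i.1 : ℕ)
  let L : (J → K) →ₗ[K] (Fin T × (s → Fin (2 * (D * δ))) → K) := LinearMap.pi fun p =>
    (PowerSeries.coeff (R := K) p.1) ∘ₗ (convergentSeries ι).val.toLinearMap ∘ₗ
      (MvPolynomial.lcoeff (convergentSeries ι) (fs p.2)).restrictScalars K ∘ₗ
      Fintype.linearCombination K G
  have hker : LinearMap.ker L ≠ ⊥ := by
    refine LinearMap.ker_ne_bot_of_finrank_lt ?_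
    simp only [Module.finrank_fintype_fun_eq_card, J, Fintype.card_prod, Fintype.card_fin,
      Fintype.card_fun]
    rwa [← mul_assoc δ]
  obtain ⟨x, hx, hx0⟩ := Submodule.exists_mem_ne_zero_of_ne_bot hker
  let P (v : ℕ) : MvPolynomial s K[X] := ∑ i : J, if (i.1 : ℕ) = v then
    MvPolynomial.monomial (fs i.2.2) (Polynomial.monomial (i.2.1 : ℕ) (x i)) else 0
  have hcoeff (v : ℕ) (w : s →₀ ℕ) : (P v).coeff w = ∑ i : J, if (i.1 : ℕ) = v then
      (if fs i.2.2 = w then Polynomial.monomial (i.2.1 : ℕ) (x i) else 0) else 0 := by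
    simp only [P, MvPolynomial.coeff_sum]
    refine Finset.sum_congr rfl fun i _ => ?_
    split_ifs with h1 h2 <;> simp [MvPolynomial.coeff_monomial, *]
  have hdeg (v : ℕ) (j : s) : (P v).degreeOf j < D * δ := by
    rw [MvPolynomial.degreeOf_lt_iff hD]
    intro w hw
    rw [MvPolynomial.mem_support_iff, hcoeff] at hw
    obtain ⟨i, _, hi⟩ := Finset.exists_ne_zero_of_sum_ne_zero hw
    by_cases h1 : (i.1 : ℕ) = v
    · by_cases h2 : fs i.2.2 = w
      · rw [← h2]
        exact (i.2.2 j).2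
      · simp [h2] at hi
    · simp [h1] at hi
  have hsum : ∑ v ∈ Finset.range δ, MvPolynomial.map (polyToConv ι) (P v) * Q ^ v =
      Fintype.linearCombination K G x := by
    simp only [P, map_sum, Finset.sum_mul, Fintype.linearCombination_apply]
    rw [Finset.sum_comm]
    refine Finset.sum_congr rfl fun i _ => ?_
    rw [Finset.sum_eq_single_of_mem (i.1 : ℕ) (Finset.mem_range.2 i.1.2)
      fun v _ hv => by simp [hv.symm]]
    simp only [if_true, MvPolynomial.map_monomial, G]
    rw [← smul_mul_assoc, MvPolynomial.smul_monomial]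
    congr 2
    refine Subtype.ext ?_
    simp [coe_polyToConv, convX, PowerSeries.smul_eq_C_mul,
      ← Polynomial.C_mul_X_pow_eq_monomial]
  refine ⟨P, ?_, fun v w => ?_, hdeg, ?_⟩
  · obtain ⟨i, hi⟩ := Function.ne_iff.1 hx0
    refine ⟨i.1, i.1.2, fun h => hi ?_⟩
    have h1 := congrArg (fun p => (p.coeff (fs i.2.2)).coeff (i.2.1 : ℕ)) h
    simp only [hcoeff, Polynomial.finsetSum_coeff, MvPolynomial.coeff_zero,
      Polynomial.coeff_zero] at h1
    rw [Finset.sum_eq_single_of_mem i (Finset.mem_univ i)] at h1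
    · simpa using h1
    · intro i' _ hne
      split_ifs with h2 h3
      · rw [Polynomial.coeff_monomial, if_neg]
        intro h4
        exact hne (Prod.ext (Fin.ext h2) (Prod.ext (Fin.ext h4) (hfs h3)))
      · rfl
      · rfl
  · rw [hcoeff]
    refine Polynomial.natDegree_sum_le_of_forall_le _ _ fun i _ => ?_
    split_ifs
    · exact (Polynomial.natDegree_monomial_le _).trans (by omega)
    · simp
    · simp
  · rw [MvPolynomial.C_dvd_iff_dvd_coeff]
    intro w
    by_cases hw : ∀ j, w j < 2 * (D * δ)
    · rw [convX_pow_dvd_iff, hsum]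
      intro t ht
      have h1 := congrFun (LinearMap.mem_ker.1 hx) (⟨t, ht⟩, fun j => ⟨w j, hw j⟩)
      have h2 : fs (fun j => (⟨w j, hw j⟩ : Fin (2 * (D * δ)))) = w := Finsupp.ext fun j => rfl
      simpa [L, h2] using h1
    · push Not at hw
      obtain ⟨j, hj⟩ := hw
      have h1 := degreeOf_sum_map_mul_pow_lt hD hQ hdeg 0 le_rfl j
      simp only [zero_add] at h1
      rw [MvPolynomial.degreeOf_lt_iff (by omega)] at h1
      have : (∑ v ∈ Finset.range δ, MvPolynomial.map (polyToConv ι) (P v) * Q ^ v).coeff w = 0 := by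
        by_contra h
        exact absurd (h1 w (MvPolynomial.mem_support_iff.2 h)) (by omega)
      rw [this]
      exact dvd_zero _

/-- Germs of controlled height which are algebraically independent over the polynomials are
algebraically independent over the convergent power series. -/
theorem eval₂Hom_germEval_injective [NumberField K] {q B : ℕ} (hq : 2 ≤ q) (hB : B ≠ 0) {α : K}
    (hα0 : α ≠ 0) (hα1 : ‖ι α‖ < 1) (hβ : Tendsto (fun k => ι α ^ q ^ k) atTop (𝓝 0))
    (hαB : ∀ k, SizeLE (B ^ q ^ k) (α ^ q ^ k)) {η : s → SeqGerm}
    (hη : ∀ j, HeightLE ι B q 1 (η j))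
    (hind : Function.Injective (MvPolynomial.eval₂Hom ((germEval hβ).comp (polyToConv ι)) η)) :
    Function.Injective (MvPolynomial.eval₂Hom (germEval (ι := ι) hβ) η) := by
  rw [injective_iff_map_eq_zero]
  intro Q₀ hQ₀
  by_contra hne
  obtain ⟨t, Q, rfl, hXQ⟩ := exists_not_dvd_of_ne_zero hne
  have hια : ι α ≠ 0 := (map_ne_zero ι).2 hα0
  have hζ0 : ((fun k => ι α ^ q ^ k : ℕ → ℂ) : SeqGerm) ≠ 0 := by
    intro h
    obtain ⟨k, hk⟩ := (Germ.coe_eq.1 h).exists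
    exact pow_ne_zero _ hια hk
  have hQη : MvPolynomial.eval₂Hom (germEval (ι := ι) hβ) η Q = 0 := by
    rw [map_mul, map_pow, MvPolynomial.eval₂Hom_C, germEval_convX] at hQ₀
    exact (mul_eq_zero.1 hQ₀).resolve_left (pow_ne_zero _ hζ0)
  have hζ : HeightLE ι B q 1 (germEval hβ (polyToConv ι X)) := by
    rw [polyToConv_X, germEval_convX]
    exact ⟨1, one_ne_zero, fun k => α ^ q ^ k, by simp only [map_pow], fun k => by
      simpa using hαB k⟩
  set d := Fintype.card s
  set h := Module.finrank ℚ K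
  obtain ⟨D, hD0, hD⟩ : ∃ D : ℕ, 0 < D ∧ ∀ j, Q.degreeOf j ≤ D :=
    ⟨Q.totalDegree + 1, by omega, fun j => (MvPolynomial.degreeOf_le_totalDegree Q j).trans (by omega)⟩
  set c := 2 * d * D * 2 ^ d + 2 * h * (1 + d * D * 2 ^ d) with hc
  obtain ⟨m, hm0, hm⟩ : ∃ m : ℕ, 0 < m ∧ ‖ι α‖ ^ m * (B : ℝ) ^ c < 1 := by
    have h1 := (tendsto_pow_atTop_nhds_zero_of_lt_one (norm_nonneg _) hα1).mul_const ((B : ℝ) ^ c)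
    rw [zero_mul] at h1
    obtain ⟨m, h2, h3⟩ := ((h1.eventually_lt_const one_pos).and (eventually_gt_atTop 0)).exists
    exact ⟨m, h3, h2⟩
  set δ := 2 ^ d * m with hδ
  have hδ0 : 0 < δ := by positivity
  obtain ⟨P, hP0, hPm, hPD, hdvd⟩ := exists_auxiliary_polynomials (m := m) (T := m ^ 2) (δ := δ)
    (Nat.mul_pos hD0 hδ0) hD (by
      rw [mul_pow 2, hδ, ← hδ]
      calc m ^ 2 * (2 ^ d * (D * δ) ^ d) = 2 ^ d * m * m * (D * δ) ^ d := by ring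
        _ < 2 ^ d * m * (m + 1) * (D * δ) ^ d := by
          refine Nat.mul_lt_mul_of_pos_right (Nat.mul_lt_mul_of_pos_left (Nat.lt_succ_self m) hδ0) ?_
          positivity)
  classical
  have hv := Nat.find_spec hP0
  have hvmin (u) (hu : u < Nat.find hP0) : P u = 0 := by
    by_contra hPu
    exact Nat.find_min hP0 hu ⟨hu.trans hv.1, hPu⟩
  obtain ⟨hvδ, hPv⟩ := hv
  set v := Nat.find hP0
  obtain ⟨r, hr⟩ := Nat.exists_eq_add_of_lt hvδ
  set W := ∑ u ∈ Finset.range (r + 1), MvPolynomial.map (polyToConv ι) (P (v + u)) * Q ^ u with hW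
  have hF : ∑ u ∈ Finset.range δ, MvPolynomial.map (polyToConv ι) (P u) * Q ^ u = Q ^ v * W := by
    rw [hr, add_assoc, Finset.sum_range_add, Finset.sum_eq_zero, zero_add, hW, Finset.mul_sum]
    · refine Finset.sum_congr rfl fun u _ => ?_
      ring
    · intro u hu
      rw [hvmin u (Finset.mem_range.1 hu), map_zero, zero_mul]
  rw [hF, map_pow] at hdvd
  have hprime : Prime (MvPolynomial.C convX : MvPolynomial s (convergentSeries ι)) :=
    (MvPolynomial.prime_C_iff s).2 prime_convX
  obtain ⟨G, hG⟩ : MvPolynomial.C convX ^ m ^ 2 ∣ W :=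
    hprime.pow_dvd_of_dvd_mul_left _ (fun h => hXQ (hprime.dvd_of_dvd_pow h)) hdvd
  have hPW : MvPolynomial.eval₂Hom (germEval hβ) η W =
      MvPolynomial.eval₂ ((germEval hβ).comp (polyToConv ι)) η (P v) := by
    rw [hW, Finset.sum_range_succ', map_add, map_sum, Finset.sum_eq_zero, zero_add]
    · simp
    · intro u _
      rw [map_mul, map_pow, hQη, zero_pow (by omega), mul_zero]
  have hGdeg (w) (hw : w ∈ G.support) (j : s) : w j ≤ 2 * (D * δ) := by
    have h1 := degreeOf_sum_map_mul_pow_lt (Nat.mul_pos hD0 hδ0) hD hPD v (r := r + 1) (by omega) j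
    rw [← hW, MvPolynomial.degreeOf_lt_iff (by positivity)] at h1
    refine (h1 w ?_).le
    rw [MvPolynomial.mem_support_iff] at hw ⊢
    rw [hG, ← map_pow, MvPolynomial.coeff_C_mul]
    exact mul_ne_zero (pow_ne_zero _ prime_convX.ne_zero) hw
  have hPsupp (w) (hw : w ∈ (P v).support) (j : s) : w j ≤ D * δ :=
    ((MvPolynomial.degreeOf_lt_iff (Nat.mul_pos hD0 hδ0)).1 (hPD v j) w hw).le
  have hmain := (HeightLE.eval₂ hB hβ hζ hη (hPm v) hPsupp).one_le_of_eq_mul (α := ι α) (T := m ^ 2)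
    (y := MvPolynomial.eval₂ (germEval hβ) η G) hq hB ?_ ?_
    (GrowthLE.eval₂ hB hβ (fun j => (hη j).growthLE) hGdeg)
  · refine absurd hmain (not_le.2 ?_)
    have h1 : d * (2 * (D * δ)) + 2 * h * (m + d * (D * δ)) = c * m := by
      rw [hc, hδ]
      ring
    rw [h1, sq, pow_mul, pow_mul, ← mul_pow]
    exact pow_lt_one₀ (by positivity) hm hm0.ne'
  · rw [← MvPolynomial.coe_eval₂Hom]
    exact fun h => hPv (hind (h.trans (map_zero _).symm))
  · rw [← hPW, hG, map_mul, map_pow, MvPolynomial.eval₂Hom_C, germEval_convX,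
      MvPolynomial.coe_eval₂Hom]

end Auxiliary

section TraceDescent

theorem IsAlgebraic.trace {S M E : Type*} [CommRing S] [IsDomain S] [Field M] [Field E] [Algebra S M]
    [Algebra M E] [Algebra S E] [IsScalarTower S M E] [FiniteDimensional M E] {y : E}
    (hy : IsAlgebraic S y) : IsAlgebraic S (Algebra.trace M E y) := by
  obtain ⟨c, hc, hcy⟩ := hy.exists_integral_multiple
  have h1 : IsIntegral S (Algebra.trace M E (c • y)) := Algebra.isIntegral_trace hcy
  rw [LinearMap.map_smul_of_tower] at h1
  exact IsAlgebraic.of_smul (mem_nonZeroDivisors_of_ne_zero hc) h1.isAlgebraic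

/-- A linear relation over `M` whose coefficients are algebraic over a subring of `M` can be pushed
down to `M`, keeping the coefficients algebraic. -/
theorem exists_relation_of_isAlgebraic {S M Ω : Type*} [CommRing S] [IsDomain S]
    [Field M] [Field Ω] [CharZero Ω] [Algebra S M] [Algebra M Ω] [Algebra S Ω]
    [IsScalarTower S M Ω] [FaithfulSMul S M] {I : Type*} [Fintype I] {η : I → Ω} (hη : η ≠ 0)
    (halg : ∀ i, IsAlgebraic S (η i)) {φ : I → M} (hφ : ∑ i, algebraMap M Ω (φ i) * η i = 0) :
    ∃ x : I → M, x ≠ 0 ∧ (∀ i, IsAlgebraic S (x i)) ∧ ∑ i, φ i * x i = 0 := by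
  have : CharZero M := (algebraMap M Ω).charZero_iff (algebraMap M Ω).injective |>.2 inferInstance
  obtain ⟨i₀, hi₀⟩ := Function.ne_iff.1 hη
  have hi₀' : η i₀ ≠ 0 := hi₀
  have hy (i) : IsAlgebraic S (η i * (η i₀)⁻¹) := (halg i).mul (halg i₀).inv
  let E := IntermediateField.adjoin M (Set.range fun i => η i * (η i₀)⁻¹)
  have hfin : FiniteDimensional M E := by
    refine IntermediateField.finiteDimensional_adjoin ?_
    rintro _ ⟨i, rfl⟩
    exact ((hy i).extendScalars (FaithfulSMul.algebraMap_injective S M)).isIntegral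
  let y (i : I) : E := ⟨η i * (η i₀)⁻¹, IntermediateField.subset_adjoin _ _ ⟨i, rfl⟩⟩
  refine ⟨fun i => Algebra.trace M E (y i), fun h => ?_, fun i => ?_, ?_⟩
  · have h1 : y i₀ = algebraMap M E 1 :=
      Subtype.ext (by simp [y, mul_inv_cancel₀ hi₀'])
    have h2 := congrFun h i₀
    simp only [h1, Algebra.trace_algebraMap, Pi.zero_apply, nsmul_eq_mul, mul_one,
      Nat.cast_eq_zero] at h2
    exact Module.finrank_pos.ne' h2
  · have : IsScalarTower S E Ω := .of_algebraMap_eq fun c => by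
      rw [IsScalarTower.algebraMap_apply S M E, ← IsScalarTower.algebraMap_apply M E Ω,
        ← IsScalarTower.algebraMap_apply S M Ω]
    refine IsAlgebraic.trace ?_
    exact (isAlgebraic_algebraMap_iff (algebraMap E Ω).injective).1 (hy i)
  · have h1 : ∑ i, φ i • y i = 0 := by
      refine (algebraMap E Ω).injective ?_
      rw [map_sum, map_zero, ← zero_mul (η i₀)⁻¹, ← hφ, Finset.sum_mul]
      refine Finset.sum_congr rfl fun i _ => ?_
      rw [Algebra.smul_def, map_mul, ← IsScalarTower.algebraMap_apply M E Ω, mul_assoc]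
      rfl
    have h2 := congrArg (Algebra.trace M E) h1
    simpa only [map_sum, map_smul, smul_eq_mul, map_zero] using h2

theorem map_sum_coeff_mul_pow_mul_pow {A F : Type*} [CommRing A] [Field F] (ψ : A →+* F) (N : A)
    {b : A} (hb : ψ b ≠ 0) (p : Polynomial A) :
    ψ (∑ l ∈ Finset.range (p.natDegree + 1), p.coeff l * N ^ l * b ^ (p.natDegree - l)) =
      ψ b ^ p.natDegree * p.eval₂ ψ (ψ N / ψ b) := by
  rw [Polynomial.eval₂_eq_sum_range, map_sum, Finset.mul_sum]
  refine Finset.sum_congr rfl fun l hl => ?_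
  have h1 : ψ b ^ p.natDegree = ψ b ^ (p.natDegree - l) * ψ b ^ l := by
    rw [← pow_add, Nat.sub_add_cancel (by simpa [Nat.lt_succ_iff] using hl)]
  rw [map_mul, map_mul, map_pow, map_pow, h1, div_pow]
  field_simp

theorem exists_eval_algebraMap_ne_zero {R₀ R : Type*} [CommRing R₀] [Infinite R₀] [CommRing R]
    [IsDomain R] [Algebra R₀ R] [FaithfulSMul R₀ R] {s : Type*} {p : MvPolynomial s R}
    (hp : p ≠ 0) : ∃ c : s → R₀, MvPolynomial.eval (fun j => algebraMap R₀ R (c j)) p ≠ 0 := by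
  by_contra! h
  refine hp (MvPolynomial.funext_set (fun _ => Set.range (algebraMap R₀ R))
    (fun _ => Set.infinite_range_of_injective (FaithfulSMul.algebraMap_injective R₀ R)) ?_)
  intro x hx
  choose c hc using fun j => hx j (Set.mem_univ j)
  rw [map_zero, ← h c]
  simp only [hc]

attribute [local instance] MvPolynomial.algebraMvPolynomial

/-- Specialization of a linear relation with coefficients in a field of rational functions. -/
theorem exists_relation_of_relation_fractionRing {R₀ R F : Type*} [CommRing R₀] [IsDomain R₀]
    [Infinite R₀] [CommRing R] [IsDomain R] [Field F] [Algebra R₀ R] [FaithfulSMul R₀ R]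
    [Algebra R F] [Algebra R₀ F] [IsScalarTower R₀ R F] [FaithfulSMul R F] {s I : Type*} [Fintype I]
    {x : I → FractionRing (MvPolynomial s R)} (hx0 : x ≠ 0)
    (hx : ∀ i, IsAlgebraic (MvPolynomial s R₀) (x i)) {φ : I → R}
    (hφ : ∑ i, algebraMap (MvPolynomial s R) (FractionRing (MvPolynomial s R))
      (MvPolynomial.C (φ i)) * x i = 0) :
    ∃ g : I → F, g ≠ 0 ∧ (∀ i, IsAlgebraic R₀ (g i)) ∧ ∑ i, g i * algebraMap R F (φ i) = 0 := by
  set A := MvPolynomial s R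
  have hinj : Function.Injective (algebraMap A (FractionRing A)) := IsFractionRing.injective _ _
  obtain ⟨⟨b, hb⟩, hbx⟩ := IsLocalization.exist_integer_multiples_of_finite (nonZeroDivisors A) x
  have hb0 : b ≠ 0 := nonZeroDivisors.ne_zero hb
  choose N hN using hbx
  replace hN (i) : algebraMap A (FractionRing A) (N i) = algebraMap A (FractionRing A) b * x i := by
    rw [hN i, ← Algebra.smul_def]
  obtain ⟨i₁, hi₁⟩ := Function.ne_iff.1 hx0
  have hN0 : N i₁ ≠ 0 := by
    intro h
    have := hN i₁
    rw [h, map_zero, eq_comm, mul_eq_zero] at this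
    exact this.elim (fun h => hb0 (hinj (h.trans (map_zero _).symm))) hi₁
  choose P hP0 hP using hx
  have hmapinj : Function.Injective (MvPolynomial.map (σ := s) (algebraMap R₀ R)) :=
    MvPolynomial.map_injective _ (FaithfulSMul.algebraMap_injective R₀ R)
  obtain ⟨c, hc⟩ := exists_eval_algebraMap_ne_zero (R₀ := R₀)
    (p := b * N i₁ * ∏ i, MvPolynomial.map (algebraMap R₀ R) (P i).leadingCoeff)
    (mul_ne_zero (mul_ne_zero hb0 hN0) (Finset.prod_ne_zero_iff.2 fun i _ h =>
      hP0 i (Polynomial.leadingCoeff_eq_zero.1 (hmapinj (h.trans (map_zero _).symm)))))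
  set ψ : A →+* F := (algebraMap R F).comp (MvPolynomial.eval fun j => algebraMap R₀ R (c j)) with hψ
  have hψmap (p : MvPolynomial s R₀) : ψ (MvPolynomial.map (algebraMap R₀ R) p) =
      algebraMap R₀ F (MvPolynomial.eval c p) := by
    rw [hψ, RingHom.comp_apply, MvPolynomial.eval_map, IsScalarTower.algebraMap_apply R₀ R F]
    congr 1
    exact (MvPolynomial.eval₂_comp _ _ _).symm
  have hRF := FaithfulSMul.algebraMap_injective R F
  have hψc : ψ (b * N i₁ * ∏ i, MvPolynomial.map (algebraMap R₀ R) (P i).leadingCoeff) ≠ 0 :=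
    fun h => hc (hRF (h.trans (map_zero _).symm))
  rw [map_mul, map_mul, map_prod] at hψc
  have hψb : ψ b ≠ 0 := left_ne_zero_of_mul (left_ne_zero_of_mul hψc)
  refine ⟨fun i => ψ (N i) / ψ b, ?_, fun i => ?_, ?_⟩
  · exact Function.ne_iff.2 ⟨i₁, div_ne_zero (right_ne_zero_of_mul (left_ne_zero_of_mul hψc)) hψb⟩
  · refine ⟨(P i).map (MvPolynomial.eval c), fun h => ?_, ?_⟩
    · have h1 := Finset.prod_ne_zero_iff.1 (right_ne_zero_of_mul hψc) i (Finset.mem_univ i)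
      rw [hψmap] at h1
      refine h1 ?_
      have h2 := congrArg (fun p => Polynomial.coeff p (P i).natDegree) h
      simp only [Polynomial.coeff_map, Polynomial.coeff_natDegree, Polynomial.coeff_zero] at h2
      rw [h2, map_zero]
    · set p := (P i).map (MvPolynomial.map (algebraMap R₀ R) : MvPolynomial s R₀ →+* A) with hp
      have hbM : algebraMap A (FractionRing A) b ≠ 0 := fun h => hb0 (hinj (h.trans (map_zero _).symm))
      have h1 := map_sum_coeff_mul_pow_mul_pow (algebraMap A (FractionRing A)) (N i) hbM p
      have h2 : p.eval₂ (algebraMap A (FractionRing A)) (x i) = 0 := by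
        rw [hp, Polynomial.eval₂_map, ← hP i, Polynomial.aeval_def]
        congr 1
      rw [hN i, mul_div_cancel_left₀ _ hbM, h2, mul_zero] at h1
      have h3 := map_sum_coeff_mul_pow_mul_pow ψ (N i) hψb p
      rw [hinj (h1.trans (map_zero _).symm), map_zero, eq_comm, mul_eq_zero] at h3
      have h4 := h3.resolve_left (pow_ne_zero _ hψb)
      rw [Polynomial.aeval_def, Polynomial.eval₂_map, ← h4, hp, Polynomial.eval₂_map]
      congr 1
      exact RingHom.ext fun r => (hψmap r).symm
  · have h1 : ∑ i, N i * MvPolynomial.C (φ i) = 0 := by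
      refine hinj ?_
      rw [map_sum, map_zero, ← mul_zero (algebraMap A (FractionRing A) b), ← hφ, Finset.mul_sum]
      refine Finset.sum_congr rfl fun i _ => ?_
      rw [map_mul, hN i]
      ring
    have h2 := congrArg ψ h1
    rw [map_sum, map_zero] at h2
    rw [← zero_div (ψ b), ← h2, Finset.sum_div]
    refine Finset.sum_congr rfl fun i _ => ?_
    rw [map_mul, div_mul_eq_mul_div]
    congr 2
    exact congrArg _ (MvPolynomial.eval_C (φ i)).symm

end TraceDescent

section Descent

attribute [local instance] MvPolynomial.algebraMvPolynomial

/-- If algebraic independence of subfamilies of `η` over `R₀` propagates to `R`, then a linear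
relation over `R` with coefficients `η` yields one with coefficients algebraic over `R₀`. -/
theorem exists_relation_of_algebraicIndepOn {R₀ R Ω F : Type*} [CommRing R₀] [IsDomain R₀]
    [Infinite R₀] [CommRing R] [IsDomain R] [Field Ω] [CharZero Ω] [Field F]
    [Algebra R₀ R] [FaithfulSMul R₀ R] [Algebra R F] [Algebra R₀ F] [IsScalarTower R₀ R F]
    [FaithfulSMul R F] [Algebra R Ω] [Algebra R₀ Ω] [IsScalarTower R₀ R Ω] [FaithfulSMul R₀ Ω]
    {I : Type*} [Fintype I] {η : I → Ω} (hη : η ≠ 0)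
    (hind : ∀ s : Set I, AlgebraicIndepOn R₀ η s → AlgebraicIndepOn R η s)
    {φ : I → R} (hφ : ∑ i, algebraMap R Ω (φ i) * η i = 0) :
    ∃ g : I → F, g ≠ 0 ∧ (∀ i, IsAlgebraic R₀ (g i)) ∧ ∑ i, g i * algebraMap R F (φ i) = 0 := by
  obtain ⟨s, hs⟩ := Set.Finite.exists_maximal (Set.toFinite {s : Set I | AlgebraicIndepOn R₀ η s})
    ⟨∅, algebraicIndependent_empty_type_iff.2 (FaithfulSMul.algebraMap_injective R₀ Ω)⟩
  have hs₀ : AlgebraicIndepOn R₀ η s := hs.prop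
  have hsR : AlgebraicIndepOn R η s := hind s hs₀
  have halg (i) : IsAlgebraic (Algebra.adjoin R₀ (η '' s)) (η i) := by
    by_contra h
    have h1 : AlgebraicIndepOn R₀ η (insert i s) := hs₀.insert h
    have h2 : i ∈ s := hs.le_of_ge h1 (Set.subset_insert i s) (Set.mem_insert i s)
    exact h (isAlgebraic_algebraMap
      (⟨η i, Algebra.subset_adjoin ⟨i, h2, rfl⟩⟩ : Algebra.adjoin R₀ (η '' s)))
  let _ : Algebra (MvPolynomial s R) Ω :=
    (MvPolynomial.aeval fun j : s => η j : MvPolynomial s R →ₐ[R] Ω).toRingHom.toAlgebra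
  let _ : Algebra (MvPolynomial s R₀) Ω :=
    (MvPolynomial.aeval fun j : s => η j : MvPolynomial s R₀ →ₐ[R₀] Ω).toRingHom.toAlgebra
  have hR (p : MvPolynomial s R) : algebraMap (MvPolynomial s R) Ω p =
    MvPolynomial.aeval (fun j : s => η j) p := rfl
  have hR₀ (p : MvPolynomial s R₀) : algebraMap (MvPolynomial s R₀) Ω p =
    MvPolynomial.aeval (fun j : s => η j) p := rfl
  have : FaithfulSMul (MvPolynomial s R) Ω := (faithfulSMul_iff_algebraMap_injective _ _).2 hsR
  have : FaithfulSMul (MvPolynomial s R₀) (MvPolynomial s R) :=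
    (faithfulSMul_iff_algebraMap_injective _ _).2
      (MvPolynomial.map_injective _ (FaithfulSMul.algebraMap_injective R₀ R))
  have : IsScalarTower (MvPolynomial s R₀) (MvPolynomial s R) Ω := .of_algebraMap_eq fun p => by
    rw [hR, hR₀, MvPolynomial.algebraMap_def, MvPolynomial.aeval_map_algebraMap]
  let _ : Algebra (FractionRing (MvPolynomial s R)) Ω := FractionRing.liftAlgebra _ _
  have : FaithfulSMul (MvPolynomial s R₀) (FractionRing (MvPolynomial s R)) :=
    FaithfulSMul.trans _ (MvPolynomial s R) _
  have : IsScalarTower (MvPolynomial s R₀) (FractionRing (MvPolynomial s R)) Ω :=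
    .of_algebraMap_eq fun p => by
      rw [IsScalarTower.algebraMap_apply _ (MvPolynomial s R) (FractionRing (MvPolynomial s R)),
        ← IsScalarTower.algebraMap_apply (MvPolynomial s R) (FractionRing (MvPolynomial s R)) Ω,
        ← IsScalarTower.algebraMap_apply]
  have halg' (i) : IsAlgebraic (MvPolynomial s R₀) (η i) := by
    have h1 := halg i
    rw [Set.image_eq_range, Algebra.adjoin_range_eq_range_aeval] at h1
    exact h1.of_ringHom_of_comp_eq (AlgHom.rangeRestrict _) (RingHom.id Ω)
      (AlgHom.rangeRestrict_surjective _) Function.injective_id rfl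
  obtain ⟨x, hx0, hx, hxφ⟩ := exists_relation_of_isAlgebraic
    (M := FractionRing (MvPolynomial s R)) hη halg'
    (φ := fun i => algebraMap (MvPolynomial s R) (FractionRing (MvPolynomial s R))
      (MvPolynomial.C (φ i))) (by
      rw [← hφ]
      refine Finset.sum_congr rfl fun i _ => ?_
      rw [← IsScalarTower.algebraMap_apply, hR, MvPolynomial.aeval_C])
  exact exists_relation_of_relation_fractionRing hx0 hx hxφ

end Descent

section Coefficients

open PowerSeries Polynomial

theorem coeff_mem_of_mahler_equation (K : Subfield ℂ) {q : ℕ} (hq : 2 ≤ q) {f : ℂ⟦X⟧} {n : ℕ}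
    {a : ℕ → ℂ[X]} (ha0 : a 0 ≠ 0)
    (heq : ∑ i ∈ Finset.range (n + 1), polyPS (a i) * (psSigma q)^[i] f = 0)
    (haK : ∀ i ≤ n, ∀ k, (a i).coeff k ∈ K)
    (hfK : ∀ k ≤ (a 0).natTrailingDegree, PowerSeries.coeff k f ∈ K) (k : ℕ) :
    PowerSeries.coeff k f ∈ K := by
  induction k using Nat.strong_induction_on with
  | _ N ih =>
  set w := (a 0).natTrailingDegree with hw
  rcases le_or_gt N w with hN | hN
  · exact hfK N hN
  have h1 := congrArg (PowerSeries.coeff (N + w)) heq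
  rw [Finset.sum_range_succ', map_add, map_sum, map_zero, Function.iterate_zero, id_eq,
    PowerSeries.coeff_mul, ← Finset.add_sum_erase _ _
      (show (w, N) ∈ Finset.HasAntidiagonal.antidiagonal (N + w) by simp [add_comm])] at h1
  have h2 : ∑ i ∈ Finset.range n,
      PowerSeries.coeff (N + w) (polyPS (a (i + 1)) * (psSigma q)^[i + 1] f) ∈ K := by
    refine sum_mem fun i hi => ?_
    rw [PowerSeries.coeff_mul]
    refine sum_mem fun p hp => mul_mem ?_ ?_
    · rw [polyPS_apply, Polynomial.coeff_coe]
      exact haK _ (by have := Finset.mem_range.1 hi; omega) _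
    · have hlt : p.2 < N * q ^ (i + 1) := by
        have := Finset.HasAntidiagonal.mem_antidiagonal.1 hp
        have h2 : 2 ≤ q ^ (i + 1) := hq.trans (Nat.le_self_pow (by omega) q)
        nlinarith
      rw [iterate_psSigma (by omega)]
      by_cases hd : q ^ (i + 1) ∣ p.2
      · obtain ⟨e, he⟩ := hd
        rw [he, PowerSeries.coeff_expand_mul]
        refine ih e (lt_of_mul_lt_mul_left ?_ (Nat.zero_le (q ^ (i + 1))))
        rw [← he, mul_comm]
        exact hlt
      · rw [PowerSeries.coeff_expand_of_not_dvd _ _ _ hd]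
        exact zero_mem K
  have h3 : ∑ p ∈ (Finset.HasAntidiagonal.antidiagonal (N + w)).erase (w, N),
      PowerSeries.coeff p.1 (polyPS (a 0)) * PowerSeries.coeff p.2 f ∈ K := by
    refine sum_mem fun p hp => ?_
    obtain ⟨hne, hp⟩ := Finset.mem_erase.1 hp
    have hp' := Finset.HasAntidiagonal.mem_antidiagonal.1 hp
    rw [polyPS_apply, Polynomial.coeff_coe]
    rcases lt_or_ge p.1 w with hlt | hle
    · rw [Polynomial.coeff_eq_zero_of_lt_natTrailingDegree hlt, zero_mul]
      exact zero_mem K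
    · refine mul_mem (haK 0 (Nat.zero_le n) _) (ih _ ?_)
      have : p.1 ≠ w := fun h => hne (Prod.ext h (by simp only; omega))
      omega
  have h4 : (a 0).coeff w * PowerSeries.coeff N f ∈ K := by
    have h5 := neg_mem (add_mem h2 h3)
    rwa [← eq_neg_of_add_eq_zero_left ((add_left_comm _ _ _).symm.trans h1), polyPS_apply,
      Polynomial.coeff_coe] at h5
  have h5 : (a 0).coeff w ≠ 0 := by
    rw [hw]
    exact Polynomial.trailingCoeff_nonzero_iff_nonzero.2 ha0
  have h6 := mul_mem (inv_mem (haK 0 (Nat.zero_le n) w)) h4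
  rwa [inv_mul_cancel_left₀ h5] at h6

/-- Linear relations with polynomial coefficients descend to a subfield containing the coefficients
of the power series. -/
theorem exists_relation_of_relation_map {K L I : Type*} [Field K] [Field L] [Algebra K L] [Fintype I]
    {G : I → K⟦X⟧} {b : I → L[X]} (hb : b ≠ 0)
    (hsum : ∑ i, (b i : L⟦X⟧) * PowerSeries.map (algebraMap K L) (G i) = 0) :
    ∃ b' : I → K[X], b' ≠ 0 ∧ ∑ i, (b' i : K⟦X⟧) * G i = 0 := by
  obtain ⟨i₀, hi₀⟩ := Function.ne_iff.1 hb
  obtain ⟨k₀, hk₀⟩ : ∃ k, (b i₀).coeff k ≠ 0 := by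
    by_contra! h
    exact hi₀ (Polynomial.ext h)
  obtain ⟨l, hl⟩ := Module.Projective.exists_dual_ne_zero K hk₀
  let b' (i : I) : K[X] :=
    ∑ k ∈ Finset.range ((b i).natDegree + 1), Polynomial.monomial k (l ((b i).coeff k))
  have hb' (i : I) (k : ℕ) : (b' i).coeff k = l ((b i).coeff k) := by
    simp only [b', Polynomial.finsetSum_coeff, Polynomial.coeff_monomial, Finset.sum_ite_eq',
      Finset.mem_range]
    split_ifs with h
    · rfl
    · rw [Polynomial.coeff_eq_zero_of_natDegree_lt (by omega), map_zero]
  refine ⟨b', fun h => hl ?_, PowerSeries.ext fun N => ?_⟩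
  · rw [← hb', h]
    simp
  · have h1 := congrArg (fun x => l (PowerSeries.coeff N x)) hsum
    simp only [map_sum, PowerSeries.coeff_mul, map_zero] at h1 ⊢
    rw [← h1]
    refine Finset.sum_congr rfl fun i _ => Finset.sum_congr rfl fun p _ => ?_
    rw [Polynomial.coeff_coe, Polynomial.coeff_coe, hb', PowerSeries.coeff_map,
      mul_comm ((b i).coeff _), ← Algebra.smul_def, map_smul, smul_eq_mul, mul_comm]

end Coefficients

section Main

open PowerSeries LaurentSeries Polynomial Filter Topology

variable {K : Type*} [Field K]

instance : CharZero SeqGerm where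
  cast_injective m n h := by
    obtain ⟨k, hk⟩ := (Germ.coe_eq.1 h).exists
    simpa using hk

/-- The embedding of convergent power series over `K` into Laurent series over `ℂ`. -/
def convToLaurent (ι : K →+* ℂ) : convergentSeries ι →+* ℂ⸨X⸩ :=
  (algebraMap ℂ⟦X⟧ ℂ⸨X⸩).comp ((PowerSeries.map ι).comp (convergentSeries ι).val.toRingHom)

theorem convToLaurent_apply {ι : K →+* ℂ} (g : convergentSeries ι) :
    convToLaurent ι g = algebraMap ℂ⟦X⟧ ℂ⸨X⸩ (PowerSeries.map ι g) := rfl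

theorem convToLaurent_injective (ι : K →+* ℂ) : Function.Injective (convToLaurent ι) := by
  have h : Function.Injective fun g : convergentSeries ι => PowerSeries.map ι (g : K⟦X⟧) :=
    (PowerSeries.map_injective ι ι.injective).comp Subtype.val_injective
  exact (IsFractionRing.injective ℂ⟦X⟧ ℂ⸨X⸩).comp h

theorem convToLaurent_polyToConv {ι : K →+* ℂ} (p : K[X]) :
    convToLaurent ι (polyToConv ι p) = algebraMap ℂ[X] ℂ⸨X⸩ (p.map ι) := by
  rw [convToLaurent_apply, coe_polyToConv, algebraMap_polynomial_laurent]
  congr 1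
  ext k
  simp

theorem germEval_comp_polyToConv_injective {ι : K →+* ℂ} {β : ℕ → ℂ} (hβ : Tendsto β atTop (𝓝 0))
    (hβi : Function.Injective β) :
    Function.Injective ((germEval (ι := ι) hβ).comp (polyToConv ι)) := by
  rw [injective_iff_map_eq_zero]
  intro p hp
  rw [RingHom.comp_apply, germEval_polyToConv] at hp
  by_contra hp0
  have h1 : {k | p.eval₂ ι (β k) = 0}.Finite := by
    have := (Polynomial.rootSet_finite (p.map ι) ℂ).preimage (f := β) hβi.injOn
    refine this.subset fun k hk => ?_
    rw [Set.mem_preimage, Polynomial.mem_rootSet]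
    exact ⟨(Polynomial.map_ne_zero_iff ι.injective).2 hp0, by simpa [Polynomial.eval_map] using hk⟩
  have h2 : ∀ᶠ k in (hyperfilter ℕ : Filter ℕ), p.eval₂ ι (β k) = 0 := Germ.coe_eq.1 hp
  exact h1.notMem_hyperfilter h2

/-- A nonzero linear relation between convergent series evaluated along a sequence, whose
coefficients are of moderate height, lifts to a relation between the series with coefficients
algebraic over the rational functions. -/
theorem exists_algebraic_relation [NumberField K] {ι : K →+* ℂ} {q : ℕ} (hq : 2 ≤ q) {B : ℕ}
    (hB : B ≠ 0) {α : K} (hα0 : α ≠ 0) (hα1 : ‖ι α‖ < 1)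
    (hβ : Tendsto (fun k => ι α ^ q ^ k) atTop (𝓝 0)) (hαB : ∀ k, SizeLE (B ^ q ^ k) (α ^ q ^ k))
    {I : Type*} [Fintype I] {η : I → SeqGerm} (hη : ∀ j, HeightLE ι B q 1 (η j)) (hη0 : η ≠ 0)
    {φ : I → convergentSeries ι} (hφ : ∑ i, germEval hβ (φ i) * η i = 0) :
    ∃ g : I → ℂ⸨X⸩, g ≠ 0 ∧ (∀ i, IsAlgebraic ℂ[X] (g i)) ∧
      ∑ i, g i * convToLaurent ι (φ i) = 0 := by
  let _ : Algebra K[X] (convergentSeries ι) := (polyToConv ι).toAlgebra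
  let _ : Algebra (convergentSeries ι) SeqGerm := (germEval hβ).toAlgebra
  let _ : Algebra K[X] SeqGerm := ((germEval hβ).comp (polyToConv ι)).toAlgebra
  let _ : Algebra (convergentSeries ι) ℂ⸨X⸩ := (convToLaurent ι).toAlgebra
  let _ : Algebra K[X] ℂ⸨X⸩ := ((convToLaurent ι).comp (polyToConv ι)).toAlgebra
  have : IsScalarTower K[X] (convergentSeries ι) SeqGerm := .of_algebraMap_eq fun _ => rfl
  have : IsScalarTower K[X] (convergentSeries ι) ℂ⸨X⸩ := .of_algebraMap_eq fun _ => rfl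
  have hβi : Function.Injective fun k => ι α ^ q ^ k := by
    have h0 : ι α ≠ 0 := (map_ne_zero ι).2 hα0
    intro k l hkl
    have h1 : ‖ι α‖ ^ q ^ k = ‖ι α‖ ^ q ^ l := by simpa using congrArg norm hkl
    exact Nat.pow_right_injective hq
      (pow_right_injective₀ (norm_pos_iff.2 h0) hα1.ne h1)
  have hinj := germEval_comp_polyToConv_injective (ι := ι) hβ hβi
  have : FaithfulSMul K[X] SeqGerm := (faithfulSMul_iff_algebraMap_injective _ _).2 hinj
  have : FaithfulSMul K[X] (convergentSeries ι) :=
    (faithfulSMul_iff_algebraMap_injective _ _).2 (Function.Injective.of_comp (f := germEval hβ) hinj)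
  have : FaithfulSMul (convergentSeries ι) ℂ⸨X⸩ :=
    (faithfulSMul_iff_algebraMap_injective _ _).2 (convToLaurent_injective ι)
  obtain ⟨g, hg0, hg, hsum⟩ := exists_relation_of_algebraicIndepOn (R₀ := K[X])
    (R := convergentSeries ι) (F := ℂ⸨X⸩) hη0 (fun s hs => by
      have := Fintype.ofFinite s
      exact eval₂Hom_germEval_injective hq hB hα0 hα1 hβ hαB (fun j : s => hη j) hs) hφ
  refine ⟨g, hg0, fun i => ?_, hsum⟩
  obtain ⟨P, hP0, hP⟩ := hg i
  refine ⟨P.map (Polynomial.mapRingHom ι), ?_, ?_⟩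
  · rwa [Ne, Polynomial.map_eq_zero_iff (Polynomial.map_injective ι ι.injective)]
  · rw [← hP, Polynomial.aeval_def, Polynomial.eval₂_map, Polynomial.aeval_def]
    congr 1
    exact RingHom.ext fun p => (convToLaurent_polyToConv p).symm

end Main

section Vanishing

open PowerSeries LaurentSeries Polynomial Filter Topology

variable {K : Type*} [Field K] {ι : K →+* ℂ}

theorem expand_mem_convergentSeries {g : K⟦X⟧} (hg : g ∈ convergentSeries ι) {m : ℕ} (hm : m ≠ 0) :
    PowerSeries.expand m hm g ∈ convergentSeries ι := by
  have h : Tendsto (fun z : ℂ => z ^ m) (𝓝 0) (𝓝 0) := by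
    simpa [hm] using (continuous_pow m).tendsto (0 : ℂ)
  filter_upwards [h.eventually hg] with z ⟨s, hs⟩
  exact ⟨s, by rw [PowerSeries.map_expand]; exact hs.expand hm⟩

/-- If a Mahler function vanishes at a regular point of a Mahler equation of order `n`, then it
satisfies a Mahler equation of order less than `n`. -/
theorem exists_relation_of_value_eq_zero [NumberField K] {q : ℕ} (hq : 2 ≤ q) {f : K⟦X⟧} {n : ℕ}
    (hn : n ≠ 0) {a : ℕ → ℂ[X]} {aK : ℕ → K[X]} (ha : ∀ i ≤ n, (aK i).map ι = a i)
    (heq : ∑ i ∈ Finset.range (n + 1), polyPS (a i) * (psSigma q)^[i] (PowerSeries.map ι f) = 0)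
    {α : K} (hα0 : α ≠ 0) (hα1 : ‖ι α‖ < 1) (ha0 : ∀ k, (a 0).eval (ι α ^ q ^ k) ≠ 0)
    (han : ∀ k, (a n).eval (ι α ^ q ^ k) ≠ 0) (hzero : MahlerValue (PowerSeries.map ι f) (ι α) 0) :
    ∃ b : Fin n → ℂ[X], b ≠ 0 ∧
      ∑ i, polyPS (b i) * (psSigma q)^[i] (PowerSeries.map ι f) = 0 := by
  have hq0 : q ≠ 0 := by omega
  have heval (i) (hi : i ≤ n) (k) : ι ((aK i).eval (α ^ q ^ k)) = (a i).eval (ι α ^ q ^ k) := by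
    rw [← ha i hi, Polynomial.eval_map, ← map_pow, Polynomial.eval₂_at_apply]
  have hconv : f ∈ convergentSeries ι := by
    obtain ⟨F, -, hF, -⟩ := hzero
    exact hF.mono fun z hz => ⟨F z, hz⟩
  obtain ⟨v, hv0, hv, hfv⟩ := exists_mahler_values hq heq ((map_ne_zero ι).2 hα0) hα1 ha0 hzero
  obtain ⟨B, hB, hαB, hcof⟩ := exists_sizeLE_mahlerCofactor hq n aK α
  have hβ := tendsto_pow_pow_atTop hα1 hq
  let η (i : Fin n) : SeqGerm := ((fun k => ι (mahlerCofactor q n aK α k i) : ℕ → ℂ) : SeqGerm)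
  have hη (i) : HeightLE ι B q 1 (η i) := ⟨1, one_ne_zero, _, rfl, fun k => by simpa using hcof k i⟩
  have hη0 : η ≠ 0 := by
    intro h
    have h1 : ∀ᶠ k in (hyperfilter ℕ : Filter ℕ), ∀ i : Fin n,
        ι (mahlerCofactor q n aK α k i) = 0 :=
      eventually_all.2 fun i => Germ.coe_eq.1 (congrFun h i)
    obtain ⟨k, hk⟩ := h1.exists
    obtain ⟨i, hi, hne⟩ := exists_mahlerCofactor_ne_zero (q := q) hn (a := aK) (α := α)
      (fun k h => ha0 k (by rw [← heval 0 (Nat.zero_le n), h, map_zero]))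
      (fun k h => han k (by rw [← heval n le_rfl, h, map_zero])) k
    exact hne ((map_eq_zero ι).1 (hk ⟨i, hi⟩))
  let φ (i : Fin n) : convergentSeries ι :=
    ⟨PowerSeries.expand (q ^ (i : ℕ)) (pow_ne_zero _ hq0) f, expand_mem_convergentSeries hconv _⟩
  have hφ : ∑ i, germEval hβ (φ i) * η i = 0 := by
    have h1 (i : Fin n) : germEval hβ (φ i) = ((fun k => v (k + i) : ℕ → ℂ) : SeqGerm) := by
      refine Germ.coe_eq.2 (Nat.hyperfilter_le_atTop ?_)
      filter_upwards [(tendsto_add_atTop_nat (i : ℕ)).eventually hfv] with k hk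
      refine HasValue.seriesSum_eq ?_
      rw [PowerSeries.map_expand]
      refine HasValue.expand _ ?_
      rwa [← pow_mul, ← pow_add]
    have h2 : ∑ i, germEval hβ (φ i) * η i = ((∑ i : Fin n, fun k =>
        v (k + i) * ι (mahlerCofactor q n aK α k i) : ℕ → ℂ) : SeqGerm) := by
      refine .trans ?_ (map_sum (Germ.coeRingHom _) _ _).symm
      refine Finset.sum_congr rfl fun i _ => ?_
      rw [h1 i]
      rfl
    rw [h2]
    refine congrArg _ (funext fun k => ?_)
    rw [Finset.sum_apply, ← sum_mahlerCofactor_mul hn ι (a := aK) (α := α) hv0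
      (fun k => ?_) k, ← Fin.sum_univ_eq_sum_range
        (fun i => ι (mahlerCofactor q n aK α k i) * v (k + i))]
    · exact Finset.sum_congr rfl fun i _ => mul_comm _ _
    · rw [← hv k]
      refine Finset.sum_congr rfl fun i hi => ?_
      rw [heval i (Nat.lt_succ_iff.1 (Finset.mem_range.1 hi))]
  obtain ⟨g, hg0, hg, hsum⟩ := exists_algebraic_relation hq hB hα0 hα1 hβ hαB hη hη0 hφ
  refine exists_polynomial_relation_of_algebraic_relation hq (a := a) (fun h => ha0 0 (by simp [h]))
    (fun h => han 0 (by simp [h])) heq hg hg0 ?_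
  rw [← hsum]
  refine Finset.sum_congr rfl fun i _ => ?_
  rw [mahlerFamily, iterate_psSigma hq0, convToLaurent_apply, PowerSeries.map_expand]

/-- A Mahler function, a Mahler equation and an algebraic point are defined over a number field. -/
theorem exists_field_of_definition {q : ℕ} (hq : 2 ≤ q) {f : ℂ⟦X⟧}
    (hf : ∀ k, IsAlgebraic ℚ (PowerSeries.coeff k f)) {n : ℕ} {a : ℕ → ℂ[X]} (ha0 : a 0 ≠ 0)
    (haalg : ∀ i k, IsAlgebraic ℚ ((a i).coeff k))
    (heq : ∑ i ∈ Finset.range (n + 1), polyPS (a i) * (psSigma q)^[i] f = 0) {α : ℂ}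
    (hα : IsAlgebraic ℚ α) :
    ∃ K : IntermediateField ℚ ℂ, FiniteDimensional ℚ K ∧ α ∈ K ∧
      (∀ i ≤ n, ∀ k, (a i).coeff k ∈ K) ∧ ∀ k, PowerSeries.coeff k f ∈ K := by
  let S : Set ℂ := {α} ∪ (⋃ i ∈ Finset.range (n + 1), ((a i).coeffs : Set ℂ)) ∪
    (fun k => PowerSeries.coeff k f) '' Set.Iic (a 0).natTrailingDegree
  have hSfin : S.Finite := by
    refine ((Set.finite_singleton α).union ?_).union ((Set.finite_Iic _).image _)
    exact (Finset.range (n + 1)).finite_toSet.biUnion fun i _ => Finset.finite_toSet _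
  have hSalg : ∀ x ∈ S, IsIntegral ℚ x := by
    rintro x ((rfl | hx) | ⟨k, -, rfl⟩)
    · exact hα.isIntegral
    · simp only [Set.mem_iUnion] at hx
      obtain ⟨i, -, hx⟩ := hx
      obtain ⟨k, -, rfl⟩ := Polynomial.mem_coeffs_iff.1 (Finset.mem_coe.1 hx)
      exact (haalg i k).isIntegral
    · exact (hf k).isIntegral
  let K := IntermediateField.adjoin ℚ S
  have hfin : FiniteDimensional ℚ K := by
    have := hSfin.to_subtype
    exact IntermediateField.finiteDimensional_adjoin hSalg
  have hSK : S ⊆ K := IntermediateField.subset_adjoin ℚ S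
  have haK (i) (hi : i ≤ n) (k) : (a i).coeff k ∈ K := by
    by_cases hk : (a i).coeff k = 0
    · rw [hk]
      exact zero_mem K
    · refine hSK (.inl (.inr ?_))
      simp only [Set.mem_iUnion]
      exact ⟨i, Finset.mem_range.2 (by omega), Polynomial.coeff_mem_coeffs hk⟩
  exact ⟨K, hfin, hSK (.inl (.inl rfl)), haK, coeff_mem_of_mahler_equation K.toSubfield hq ha0 heq haK
    fun k hk => hSK (.inr ⟨k, hk, rfl⟩)⟩

end Vanishing

/-- If a nonzero M_q-function `f` vanishes at an algebraic point `α`,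
`0 < |α| < 1`, which is not a pole of `f`, then `α` is a singularity of the minimal q-Mahler
equation `a₀(z)f(z) + ⋯ + a_n(z)f(z^{q^n}) = 0` of `f`: for some `ℓ ≥ 0`,
`a₀(α^{q^ℓ}) a_n(α^{q^ℓ}) = 0`. -/
theorem zero_of_Mq_function_is_singularity_of_minimal_equation
    (q : ℕ) (hq : 2 ≤ q)
    (f : PowerSeries ℂ) (hf : IsM q f) (hf0 : f ≠ 0)
    (n : ℕ) (a : ℕ → Polynomial ℂ)
    (haalg : ∀ i k, IsAlgebraic ℚ ((a i).coeff k))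
    (han : a n ≠ 0)
    (heq : ∑ i ∈ Finset.range (n + 1), polyPS (a i) * (psSigma q)^[i] f = 0)
    (hmin : ∀ m : ℕ, m < n → ∀ b : ℕ → Polynomial ℂ,
      (∀ i k, IsAlgebraic ℚ ((b i).coeff k)) → (∃ i, i ≤ m ∧ b i ≠ 0) →
      ∑ i ∈ Finset.range (m + 1), polyPS (b i) * (psSigma q)^[i] f ≠ 0)
    (α : ℂ) (hαalg : IsAlgebraic ℚ α)
    (hα0 : 0 < ‖α‖) (hα1 : ‖α‖ < 1)
    (hzero : MahlerValue f α 0) :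
    ∃ ℓ : ℕ, Polynomial.eval (α ^ q ^ ℓ) (a 0) * Polynomial.eval (α ^ q ^ ℓ) (a n) = 0 := by
  by_contra! hreg
  have hq0 : q ≠ 0 := by omega
  have ha0 (k) := left_ne_zero_of_mul (hreg k)
  have han' (k) := right_ne_zero_of_mul (hreg k)
  have ha00 : a 0 ≠ 0 := fun h => ha0 0 (by simp [h])
  rcases Nat.eq_zero_or_pos n with rfl | hn
  · rw [Finset.sum_range_one, polyPS_apply, mul_eq_zero, Polynomial.coe_eq_zero_iff] at heq
    exact heq.elim han hf0
  obtain ⟨K, hK, hαK, haK, hfK⟩ := exists_field_of_definition hq hf.1 ha00 haalg heq hαalg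
  have : NumberField K := ⟨⟩
  have hlift (i) (hi : i ≤ n) : ∃ p : Polynomial K, p.map (algebraMap K ℂ) = a i := by
    rw [← Polynomial.mem_lifts, Polynomial.lifts_iff_coeff_lifts]
    exact fun k => ⟨⟨_, haK i hi k⟩, rfl⟩
  choose! aK haK' using hlift
  obtain ⟨g, rfl⟩ : ∃ g : PowerSeries K, PowerSeries.map (algebraMap K ℂ) g = f :=
    ⟨PowerSeries.mk fun k => ⟨_, hfK k⟩, by ext k; simp⟩
  obtain ⟨α, rfl⟩ : ∃ β : K, algebraMap K ℂ β = α := ⟨⟨α, hαK⟩, rfl⟩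
  obtain ⟨b, hb0, hb⟩ := exists_relation_of_value_eq_zero hq hn.ne' haK' heq
    (fun h => by simp [h] at hα0) hα1 ha0 han' hzero
  simp only [iterate_psSigma hq0, ← PowerSeries.map_expand, polyPS_apply] at hb
  obtain ⟨c, hc0, hc⟩ := exists_relation_of_relation_map hb0 hb
  obtain ⟨i₀, hi₀⟩ := Function.ne_iff.1 hc0
  refine hmin (n - 1) (by omega)
    (fun i => if h : i < n then (c ⟨i, h⟩).map (algebraMap K ℂ) else 0) (fun i k => ?_)
    ⟨i₀, by omega, ?_⟩ ?_
  · split_ifs with h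
    · rw [Polynomial.coeff_map]
      exact (Algebra.IsAlgebraic.isAlgebraic _).algebraMap
    · rw [Polynomial.coeff_zero]
      exact isAlgebraic_zero
  · simpa [Polynomial.map_eq_zero_iff (algebraMap K ℂ).injective] using hi₀
  · rw [Nat.sub_add_cancel hn, ← Fin.sum_univ_eq_sum_range (fun i => polyPS _ * _)]
    have := congrArg (PowerSeries.map (algebraMap K ℂ)) hc
    rw [map_sum, map_zero] at this
    rw [← this]
    refine Finset.sum_congr rfl fun i _ => ?_
    rw [map_mul, PowerSeries.map_expand, iterate_psSigma hq0, dif_pos i.2, polyPS_apply]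
    congr 1
    ext k
    simp
end
end

section
/- Let f_1, …, f_r be E-functions. For each i, let a_{i,0}(z) + a_{i,1}(z)δ + ⋯ + a_{i,m_i−1}(z)δ^{m_i−1} + δ^{m_i}, with a_{i,j} ∈ ℚ̄(z), be the monic differential operator of minimal order annihilating f_i, and set L_i := a_{i,0}(z)X_{i,0} + ⋯ + a_{i,m_i−1}(z)X_{i,m_i−1} + X_{i,m_i}. Then, as a δ-ideal of ℚ̄(z)[(X_{i,j})_{1≤i≤r, j∈ℕ}], the ideal I^δ(f_1,…,f_r) is generated by the linear forms L_1, …, L_r together with the elements of I^δ_m(f_1,…,f_r) := I^δ(f_1,…,f_r) ∩ ℚ̄(z)[(X_{i,j})_{1≤i≤r, 0≤j<m_i}]. -/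
noncomputable section

/-- `ℚ̄`, the field of algebraic numbers, realized as the relative algebraic closure
of `ℚ` inside `ℂ`. -/
abbrev Qb : IntermediateField ℚ ℂ := algebraicClosure ℚ ℂ

/-- The embedding `ℚ̄[z] → ℂ[[z]]`. -/
def polyQbPS : Polynomial Qb →+* PowerSeries ℂ :=
  (Polynomial.coeToPowerSeries.ringHom).comp (Polynomial.mapRingHom (Qb.val.toRingHom))

/-- The derivative `d/dz` on `ℚ̄(z)`, computed via numerator and denominator. -/
def ratD (f : RatFunc Qb) : RatFunc Qb :=
  (algebraMap (Polynomial Qb) (RatFunc Qb) (Polynomial.derivative f.num)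
      * algebraMap (Polynomial Qb) (RatFunc Qb) f.denom
    - algebraMap (Polynomial Qb) (RatFunc Qb) f.num
      * algebraMap (Polynomial Qb) (RatFunc Qb) (Polynomial.derivative f.denom))
    / algebraMap (Polynomial Qb) (RatFunc Qb) (f.denom ^ 2)

/-- The derivation `δ` on `ℚ̄(z)[(X_{i,j})]` extending `d/dz` on `ℚ̄(z)` and satisfying
`δ(X_{i,j}) = X_{i,j+1}` (written out via the Leibniz rule). -/
def deltaMv {r : ℕ} (Q : MvPolynomial (Fin r × ℕ) (RatFunc Qb)) :
    MvPolynomial (Fin r × ℕ) (RatFunc Qb) :=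
  (∑ s ∈ Q.support, MvPolynomial.monomial s (ratD (MvPolynomial.coeff s Q)))
  + ∑ v ∈ Q.vars, MvPolynomial.X (v.1, v.2 + 1) * MvPolynomial.pderiv v Q

/-- The ideal `I^δ(f₁, …, f_r)` of `δ`-algebraic relations over `ℚ̄(z)` among the complex
power series `g 1, …, g r` and their successive derivatives: a polynomial
`Q ∈ ℚ̄(z)[(X_{i,j})]` belongs to it iff after clearing denominators (multiplication by a
nonzero `c ∈ ℚ̄[z]`) it becomes a polynomial over `ℚ̄[z]` vanishing under the substitution
`X_{i,j} ↦ g_i^{(j)}(z)`. -/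
def Idelta {r : ℕ} (g : Fin r → PowerSeries ℂ) :
    Set (MvPolynomial (Fin r × ℕ) (RatFunc Qb)) :=
  {Q | ∃ c : Polynomial Qb, c ≠ 0 ∧
        ∃ Q' : MvPolynomial (Fin r × ℕ) (Polynomial Qb),
          MvPolynomial.map (algebraMap (Polynomial Qb) (RatFunc Qb)) Q'
            = MvPolynomial.C (algebraMap (Polynomial Qb) (RatFunc Qb) c) * Q ∧
          MvPolynomial.eval₂ polyQbPS (fun v => psD^[v.2] (g v.1)) Q' = 0}

namespace MvPolynomial

variable {σ k l R S : Type*} [CommRing k] [CommRing l] [CommRing R] [CommRing S]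
  [Algebra k R] [Algebra l S]

/-- The derivation of `R[σ]` that extends the derivation `d` of `R` and sends `X v` to
`X (τ v)`. -/
def shiftDerivation (d : Derivation k R R) (τ : σ → σ) :
    Derivation k (MvPolynomial σ R) (MvPolynomial σ R) :=
  have coeff_sum (p : MvPolynomial σ R) (n : σ →₀ ℕ) :
      coeff n (∑ s ∈ p.support, monomial s (d (coeff s p))) = d (coeff n p) := by
    classical
    simp only [MvPolynomial.coeff_sum, coeff_monomial, Finset.sum_ite_eq', mem_support_iff]
    split_ifs with h
    · rfl
    · rw [not_not.mp h, map_zero]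
  Derivation.mk'
    { toFun := fun p => ∑ s ∈ p.support, monomial s (d (coeff s p))
      map_add' := fun p q => by
        ext n
        rw [coeff_add, coeff_sum, coeff_sum, coeff_sum, coeff_add, map_add]
      map_smul' := fun c p => by
        ext n
        rw [coeff_sum, coeff_smul, coeff_smul, coeff_sum, Derivation.map_smul, RingHom.id_apply] }
    (fun p q => by
      classical
      ext n
      simp only [LinearMap.coe_mk, AddHom.coe_mk, smul_eq_mul, coeff_add, coeff_sum]
      rw [mul_comm q, coeff_mul, coeff_mul, coeff_mul, map_sum, ← Finset.sum_add_distrib]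
      refine Finset.sum_congr rfl fun x _ => ?_
      rw [coeff_sum, coeff_sum, Derivation.leibniz, smul_eq_mul, smul_eq_mul,
        mul_comm (coeff x.2 q)])
  + (mkDerivation R fun v => X (τ v)).restrictScalars k

theorem shiftDerivation_apply (d : Derivation k R R) (τ : σ → σ) (p : MvPolynomial σ R) :
    shiftDerivation d τ p = (∑ s ∈ p.support, monomial s (d (coeff s p)))
      + mkDerivation R (fun v => X (τ v)) p := rfl

@[simp]
theorem shiftDerivation_C (d : Derivation k R R) (τ : σ → σ) (x : R) :
    shiftDerivation d τ (C x) = C (d x) := by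
  classical
  rw [shiftDerivation_apply, show mkDerivation R (fun v => X (τ v)) (C x) = (0 : MvPolynomial σ R) from
    derivation_C _ x, add_zero]
  ext n
  simp only [coeff_sum, coeff_monomial, Finset.sum_ite_eq', mem_support_iff, coeff_C]
  by_cases h : 0 = n <;> by_cases hx : x = 0 <;> simp [h, hx]

@[simp]
theorem shiftDerivation_X (d : Derivation k R R) (τ : σ → σ) (v : σ) :
    shiftDerivation d τ (X v) = X (τ v) := by
  rw [shiftDerivation_apply, mkDerivation_X, add_eq_right]
  refine Finset.sum_eq_zero fun s _ => ?_
  classical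
  rw [coeff_X]
  split_ifs <;> simp

theorem sum_vars_mul_pderiv (f : σ → MvPolynomial σ R) (p : MvPolynomial σ R) :
    ∑ v ∈ p.vars, f v * pderiv v p = mkDerivation R f p := by
  classical
  have hsum (q : MvPolynomial σ R) :
      (∑ v ∈ p.vars, f v • pderiv v : Derivation R (MvPolynomial σ R) (MvPolynomial σ R)) q
        = ∑ v ∈ p.vars, f v * pderiv v q := by
    rw [← Derivation.coeFnAddMonoidHom_apply, map_sum, Finset.sum_apply]
    rfl
  rw [← hsum]
  refine derivation_eq_of_forall_mem_vars fun w hw => ?_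
  rw [hsum, mkDerivation_X, Finset.sum_eq_single_of_mem w hw fun v _ hvw => by
    rw [pderiv_X_of_ne hvw.symm, mul_zero], pderiv_X_self, mul_one]

theorem map_shiftDerivation (φ : R →+* S) (d : Derivation k R R) (e : Derivation l S S)
    (h : ∀ x, φ (d x) = e (φ x)) (τ : σ → σ) (p : MvPolynomial σ R) :
    map φ (shiftDerivation d τ p) = shiftDerivation e τ (map φ p) := by
  induction p using MvPolynomial.induction_on with
  | C x => simp [h]
  | add p q hp hq => simp [hp, hq]
  | mul_X p v hp => simp [hp]

theorem eval₂_shiftDerivation (φ : R →+* S) (g : σ → S) (d : Derivation k R R)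
    (e : Derivation l S S) (τ : σ → σ) (h : ∀ x, φ (d x) = e (φ x))
    (hg : ∀ v, g (τ v) = e (g v)) (p : MvPolynomial σ R) :
    eval₂ φ g (shiftDerivation d τ p) = e (eval₂ φ g p) := by
  induction p using MvPolynomial.induction_on with
  | C x => simp [h]
  | add p q hp hq => simp [hp, hq]
  | mul_X p v hp => simp [hp, hg]

theorem shiftDerivation_mem_supported (d : Derivation k R R) (τ : σ → σ) {s t : Set σ}
    (hst : s ⊆ t) (hτ : Set.MapsTo τ s t) {p : MvPolynomial σ R} (hp : p ∈ supported R s) :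
    shiftDerivation d τ p ∈ supported R t := by
  have hle : supported R s ≤ supported R t := supported_mono hst
  rw [supported_eq_adjoin_X] at hp
  induction hp using Algebra.adjoin_induction with
  | mem x hx =>
    obtain ⟨v, hv, rfl⟩ := hx
    rw [shiftDerivation_X]
    exact Algebra.subset_adjoin ⟨_, hτ hv, rfl⟩
  | algebraMap x =>
    rw [algebraMap_eq, shiftDerivation_C]
    exact (supported R t).algebraMap_mem _
  | add x y _ _ hx hy =>
    rw [map_add]
    exact add_mem hx hy
  | mul x y hx' hy' hx hy =>
    rw [Derivation.leibniz]
    exact add_mem (mul_mem (hle hx') hy) (mul_mem (hle hy') hx)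

theorem exists_map_eq_C_mul {A K : Type*} [CommRing A] [IsDomain A] [Field K] [Algebra A K]
    [IsFractionRing A K] (p : MvPolynomial σ K) :
    ∃ c : A, c ≠ 0 ∧ ∃ q : MvPolynomial σ A,
      map (algebraMap A K) q = C (algebraMap A K c) * p := by
  induction p using MvPolynomial.induction_on with
  | C x =>
    obtain ⟨n, c, hc, rfl⟩ := IsFractionRing.div_surjective (A := A) x
    have hc0 : c ≠ 0 := nonZeroDivisors.ne_zero hc
    refine ⟨c, hc0, C n, ?_⟩
    rw [map_C, ← C_mul, mul_div_cancel₀]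
    simpa using hc0
  | add p q hp hq =>
    obtain ⟨c, hc, p', hp⟩ := hp
    obtain ⟨b, hb, q', hq⟩ := hq
    refine ⟨c * b, mul_ne_zero hc hb, C b * p' + C c * q', ?_⟩
    simp only [map_add, map_mul, map_C, hp, hq]
    ring
  | mul_X p v hp =>
    obtain ⟨c, hc, p', hp⟩ := hp
    refine ⟨c, hc, p' * X v, ?_⟩
    rw [map_mul, hp, map_X, mul_assoc]

/-- If `J` is stable under the derivation and contains, for each `i`, an element of the form
`X (i, m i) + (polynomial in the X (i, j) with j < m i)`, then modulo `J` every polynomial is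
congruent to one involving only the variables `X (i, j)` with `j < m i`. -/
theorem exists_supported_sub_mem {ι : Type*} (d : Derivation k R R) (m : ι → ℕ)
    (J : Ideal (MvPolynomial (ι × ℕ) R))
    (hJ : ∀ p ∈ J, shiftDerivation d (fun v => (v.1, v.2 + 1)) p ∈ J)
    (L : ι → MvPolynomial (ι × ℕ) R) (hLJ : ∀ i, L i ∈ J)
    (hL : ∀ i, L i - X (i, m i) ∈ supported R {v : ι × ℕ | v.1 = i ∧ v.2 < m i})
    (p : MvPolynomial (ι × ℕ) R) :
    ∃ q ∈ supported R {v : ι × ℕ | v.2 < m v.1}, p - q ∈ J := by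
  set δ := shiftDerivation d (fun v : ι × ℕ => (v.1, v.2 + 1)) with hδ
  set T : Subalgebra R (MvPolynomial (ι × ℕ) R) :=
    ((supported R {v : ι × ℕ | v.2 < m v.1}).map (Ideal.Quotient.mkₐ R J)).comap
      (Ideal.Quotient.mkₐ R J) with hT
  have mem_T (p : MvPolynomial (ι × ℕ) R) :
      p ∈ T ↔ ∃ q ∈ supported R {v : ι × ℕ | v.2 < m v.1}, p - q ∈ J := by
    simp only [hT, Subalgebra.mem_comap, Subalgebra.mem_map, Ideal.Quotient.mkₐ_eq_mk]
    refine exists_congr fun q => and_congr_right fun _ => ?_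
    rw [eq_comm, Ideal.Quotient.eq]
  have prolong (i : ι) (k : ℕ) : ∃ l ∈ J,
      l - X (i, m i + k) ∈ supported R {v : ι × ℕ | v.1 = i ∧ v.2 < m i + k} := by
    induction k with
    | zero => exact ⟨L i, hLJ i, hL i⟩
    | succ k ih =>
      obtain ⟨l, hl, hs⟩ := ih
      refine ⟨δ l, hJ l hl, ?_⟩
      have := shiftDerivation_mem_supported d (fun v : ι × ℕ => (v.1, v.2 + 1))
        (t := {v : ι × ℕ | v.1 = i ∧ v.2 < m i + (k + 1)})
        (fun v hv => ⟨hv.1, by have := hv.2; omega⟩)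
        (fun v hv => ⟨hv.1, by have := hv.2; simp only; omega⟩) hs
      rwa [map_sub, shiftDerivation_X] at this
  have X_mem (i : ι) (j : ℕ) : X (i, j) ∈ T := by
    induction j using Nat.strong_induction_on with
    | _ j ih =>
      rcases lt_or_ge j (m i) with hj | hj
      · exact (mem_T _).2 ⟨X (i, j), Algebra.subset_adjoin ⟨(i, j), hj, rfl⟩, by simp⟩
      · obtain ⟨k, rfl⟩ := Nat.exists_eq_add_of_le hj
        obtain ⟨l, hl, hs⟩ := prolong i k
        have hle : supported R {v : ι × ℕ | v.1 = i ∧ v.2 < m i + k} ≤ T := by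
          refine Algebra.adjoin_le ?_
          rintro _ ⟨⟨i', j⟩, ⟨rfl, hj⟩, rfl⟩
          exact ih j hj
        have hlT : l ∈ T := (mem_T l).2 ⟨0, zero_mem _, by simpa using hl⟩
        simpa using sub_mem hlT (hle hs)
  refine (mem_T p).1 ?_
  have htop : T = ⊤ := by
    rw [eq_top_iff, ← adjoin_range_X]
    refine Algebra.adjoin_le ?_
    rintro _ ⟨⟨i, j⟩, rfl⟩
    exact X_mem i j
  exact htop ▸ Algebra.mem_top

/-- Let `I` and `J` be ideals that are stable under the derivation and contain monic linear forms
of orders `m i`. If `J` contains the elements of `I` that involve only the variables `X (i, j)`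
with `j < m i`, then `J` contains `I`. -/
theorem le_of_forall_vars_mem {ι : Type*} (d : Derivation k R R) (m : ι → ℕ)
    (co : ι → ℕ → R) (I J : Ideal (MvPolynomial (ι × ℕ) R))
    (hI : ∀ p ∈ I, shiftDerivation d (fun v => (v.1, v.2 + 1)) p ∈ I)
    (hJ : ∀ p ∈ J, shiftDerivation d (fun v => (v.1, v.2 + 1)) p ∈ J)
    (hLI : ∀ i, (∑ j ∈ Finset.range (m i), C (co i j) * X (i, j)) + X (i, m i) ∈ I)
    (hLJ : ∀ i, (∑ j ∈ Finset.range (m i), C (co i j) * X (i, j)) + X (i, m i) ∈ J)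
    (h : ∀ p ∈ I, (∀ v ∈ p.vars, v.2 < m v.1) → p ∈ J) : I ≤ J := by
  intro p hp
  obtain ⟨q, hq, hpq⟩ := exists_supported_sub_mem d m (I ⊓ J)
    (fun p hp => ⟨hI p hp.1, hJ p hp.2⟩) _ (fun i => ⟨hLI i, hLJ i⟩)
    (fun i => by
      rw [add_sub_cancel_right]
      refine sum_mem fun j hj => mul_mem (Subalgebra.algebraMap_mem _ (co i j)) ?_
      exact Algebra.subset_adjoin ⟨(i, j), ⟨rfl, Finset.mem_range.mp hj⟩, rfl⟩) p
  have hqI : q ∈ I := by simpa using sub_mem hp hpq.1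
  have hqJ : q ∈ J := h q hqI fun v hv => mem_supported.mp hq hv
  simpa using add_mem hpq.2 hqJ

end MvPolynomial

open Polynomial in
theorem Polynomial.wronskian_mul_sq_eq {R : Type*} [CommRing R] {n d p q : R[X]}
    (h : n * q = p * d) :
    (derivative n * d - n * derivative d) * q ^ 2
      = (derivative p * q - p * derivative q) * d ^ 2 := by
  have hder : derivative n * q + n * derivative q = derivative p * d + p * derivative d := by
    simpa only [derivative_mul] using congrArg derivative h
  linear_combination d * q * hder - (derivative d * q + d * derivative q) * h

open Polynomial in
theorem ratD_div (p q : Qb[X]) (hq : q ≠ 0) :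
    ratD (algebraMap Qb[X] (RatFunc Qb) p / algebraMap Qb[X] (RatFunc Qb) q)
      = algebraMap Qb[X] (RatFunc Qb) (derivative p * q - p * derivative q)
        / algebraMap Qb[X] (RatFunc Qb) (q ^ 2) := by
  generalize hf : algebraMap Qb[X] (RatFunc Qb) p / algebraMap Qb[X] (RatFunc Qb) q = f
  have hne {x : Qb[X]} (hx : x ≠ 0) : algebraMap Qb[X] (RatFunc Qb) x ≠ 0 :=
    RatFunc.algebraMap_ne_zero hx
  have hd : f.denom ≠ 0 := f.denom_ne_zero
  have hcross : f.num * q = p * f.denom := by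
    apply RatFunc.algebraMap_injective Qb
    rw [map_mul, map_mul]
    exact (div_eq_div_iff (hne hd) (hne hq)).mp (f.num_div_denom.trans hf.symm)
  rw [ratD, ← map_mul, ← map_mul, ← map_sub,
    div_eq_div_iff (hne (pow_ne_zero 2 hd)) (hne (pow_ne_zero 2 hq)), ← map_mul, ← map_mul,
    Polynomial.wronskian_mul_sq_eq hcross]

open Polynomial in
theorem ratD_algebraMap (p : Qb[X]) :
    ratD (algebraMap Qb[X] (RatFunc Qb) p) = algebraMap Qb[X] (RatFunc Qb) (derivative p) := by
  simpa using ratD_div p 1 one_ne_zero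

theorem RatFunc.exists_eq_div (f : RatFunc Qb) : ∃ p q : Polynomial Qb, q ≠ 0 ∧
    f = algebraMap (Polynomial Qb) (RatFunc Qb) p / algebraMap (Polynomial Qb) (RatFunc Qb) q :=
  ⟨f.num, f.denom, f.denom_ne_zero, f.num_div_denom.symm⟩

theorem ratD_add (f g : RatFunc Qb) : ratD (f + g) = ratD f + ratD g := by
  obtain ⟨p, q, hq, rfl⟩ := f.exists_eq_div
  obtain ⟨s, t, ht, rfl⟩ := g.exists_eq_div
  have hq' : algebraMap (Polynomial Qb) (RatFunc Qb) q ≠ 0 := by simpa using hq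
  have ht' : algebraMap (Polynomial Qb) (RatFunc Qb) t ≠ 0 := by simpa using ht
  rw [div_add_div _ _ hq' ht', ← map_mul, ← map_mul, ← map_mul, ← map_add,
    ratD_div _ _ (mul_ne_zero hq ht), ratD_div _ _ hq, ratD_div _ _ ht]
  simp only [Polynomial.derivative_mul, map_add, map_sub, map_mul,
    map_pow]
  field_simp
  ring

theorem ratD_mul (f g : RatFunc Qb) : ratD (f * g) = f * ratD g + g * ratD f := by
  obtain ⟨p, q, hq, rfl⟩ := f.exists_eq_div
  obtain ⟨s, t, ht, rfl⟩ := g.exists_eq_div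
  have hq' : algebraMap (Polynomial Qb) (RatFunc Qb) q ≠ 0 := by simpa using hq
  have ht' : algebraMap (Polynomial Qb) (RatFunc Qb) t ≠ 0 := by simpa using ht
  rw [div_mul_div_comm, ← map_mul, ← map_mul,
    ratD_div _ _ (mul_ne_zero hq ht), ratD_div _ _ hq, ratD_div _ _ ht]
  simp only [Polynomial.derivative_mul, map_add, map_sub, map_mul, map_pow]
  field_simp
  ring

theorem ratD_smul (c : Qb) (f : RatFunc Qb) : ratD (c • f) = c • ratD f := by
  rw [RatFunc.smul_eq_C_mul, RatFunc.smul_eq_C_mul, ratD_mul, ← RatFunc.algebraMap_C,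
    ratD_algebraMap, Polynomial.derivative_C, map_zero, mul_zero, add_zero]

/-- `d/dz` as a derivation of `ℚ̄(z)`. -/
def ratDerivation : Derivation Qb (RatFunc Qb) (RatFunc Qb) :=
  Derivation.mk' { toFun := ratD, map_add' := ratD_add, map_smul' := ratD_smul } ratD_mul

theorem ratDerivation_apply (f : RatFunc Qb) : ratDerivation f = ratD f := rfl

theorem psD_eq_derivative (f : PowerSeries ℂ) : psD f = PowerSeries.derivative ℂ f := by
  ext n
  simp [psD, PowerSeries.coeff_derivative, mul_comm]

theorem polyQbPS_derivative (p : Polynomial Qb) :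
    polyQbPS (Polynomial.derivative p) = psD (polyQbPS p) := by
  rw [psD_eq_derivative]
  simp only [polyQbPS, RingHom.comp_apply, Polynomial.coe_mapRingHom,
    Polynomial.coeToPowerSeries.ringHom_apply, PowerSeries.derivative_coe,
    Polynomial.derivative_map]

/-- The shift `X_{i,j} ↦ X_{i,j+1}` of differential variables. -/
abbrev shiftVar {r : ℕ} (v : Fin r × ℕ) : Fin r × ℕ := (v.1, v.2 + 1)

theorem deltaMv_eq_shiftDerivation {r : ℕ} (Q : MvPolynomial (Fin r × ℕ) (RatFunc Qb)) :
    deltaMv Q = MvPolynomial.shiftDerivation ratDerivation shiftVar Q := by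
  rw [MvPolynomial.shiftDerivation_apply, deltaMv,
    ← MvPolynomial.sum_vars_mul_pderiv (fun v => MvPolynomial.X (shiftVar v)) Q]
  rfl

/-- `I^δ(g₁, …, g_r)` as an ideal. -/
def IdeltaIdeal {r : ℕ} (g : Fin r → PowerSeries ℂ) :
    Ideal (MvPolynomial (Fin r × ℕ) (RatFunc Qb)) where
  carrier := Idelta g
  zero_mem' := ⟨1, one_ne_zero, 0, by simp, by simp⟩
  add_mem' := by
    rintro P Q ⟨c, hc, P', hP, hP0⟩ ⟨b, hb, Q', hQ, hQ0⟩
    refine ⟨c * b, mul_ne_zero hc hb, MvPolynomial.C b * P' + MvPolynomial.C c * Q', ?_, ?_⟩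
    · simp only [map_add, map_mul, MvPolynomial.map_C, hP, hQ]
      ring
    · simp [hP0, hQ0]
  smul_mem' := by
    rintro P Q ⟨b, hb, Q', hQ, hQ0⟩
    obtain ⟨c, hc, P', hP⟩ := MvPolynomial.exists_map_eq_C_mul (A := Polynomial Qb) P
    refine ⟨c * b, mul_ne_zero hc hb, P' * Q', ?_, ?_⟩
    · simp only [map_mul, hP, hQ, smul_eq_mul]
      ring
    · simp [hQ0]

theorem coe_IdeltaIdeal {r : ℕ} (g : Fin r → PowerSeries ℂ) :
    (IdeltaIdeal g : Set (MvPolynomial (Fin r × ℕ) (RatFunc Qb))) = Idelta g := rfl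

theorem mem_IdeltaIdeal {r : ℕ} {g : Fin r → PowerSeries ℂ}
    {Q : MvPolynomial (Fin r × ℕ) (RatFunc Qb)} : Q ∈ IdeltaIdeal g ↔ Q ∈ Idelta g :=
  Iff.rfl

theorem deltaMv_mem_Idelta {r : ℕ} {g : Fin r → PowerSeries ℂ}
    {Q : MvPolynomial (Fin r × ℕ) (RatFunc Qb)} (hQ : Q ∈ Idelta g) :
    deltaMv Q ∈ Idelta g := by
  obtain ⟨c, hc, Q', hQ', hQ0⟩ := hQ
  have hmap := MvPolynomial.map_shiftDerivation (algebraMap (Polynomial Qb) (RatFunc Qb))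
    Polynomial.derivative' ratDerivation (fun p => (ratD_algebraMap p).symm) shiftVar Q'
  rw [hQ', Derivation.leibniz, MvPolynomial.shiftDerivation_C, ratDerivation_apply,
    ratD_algebraMap, ← deltaMv_eq_shiftDerivation, smul_eq_mul, smul_eq_mul] at hmap
  have heval := MvPolynomial.eval₂_shiftDerivation polyQbPS
    (fun v : Fin r × ℕ => psD^[v.2] (g v.1)) Polynomial.derivative'
    (PowerSeries.derivative ℂ) shiftVar
    (fun p => (polyQbPS_derivative p).trans (psD_eq_derivative _))
    (fun v => (Function.iterate_succ_apply' psD v.2 (g v.1)).trans (psD_eq_derivative _)) Q'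
  rw [hQ0, map_zero] at heval
  refine ⟨c * c, mul_ne_zero hc hc,
    MvPolynomial.C c * MvPolynomial.shiftDerivation Polynomial.derivative' shiftVar Q'
      - MvPolynomial.C (Polynomial.derivative c) * Q', ?_, ?_⟩
  · simp only [map_sub, map_mul, MvPolynomial.map_C, hmap, hQ']
    ring
  · rw [MvPolynomial.eval₂_sub, MvPolynomial.eval₂_mul, MvPolynomial.eval₂_mul, heval, hQ0,
      mul_zero, mul_zero, sub_zero]

/-- Let `f₁, …, f_r` be E-functions and, for each `i`, let
`a_{i,0} + a_{i,1}δ + ⋯ + a_{i,m_i-1}δ^{m_i-1} + δ^{m_i}` (coefficients in `ℚ̄(z)`) be the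
monic differential operator of minimal order annihilating `f_i`, with associated linear form
`L_i = a_{i,0}X_{i,0} + ⋯ + a_{i,m_i-1}X_{i,m_i-1} + X_{i,m_i}`. Then, as a `δ`-ideal,
`I^δ(f₁, …, f_r)` is generated by `L₁, …, L_r` together with the elements of
`I^δ_m(f₁, …, f_r) = I^δ(f₁, …, f_r) ∩ ℚ̄(z)[(X_{i,j})_{j < m_i}]`; that is, it coincides
with the smallest ideal containing them that is stable under `δ`. -/
theorem delta_ideal_generators
    (r : ℕ) (a : Fin r → ℕ → ℂ) (hE : ∀ i, IsE (a i))
    (m : Fin r → ℕ) (co : Fin r → ℕ → RatFunc Qb)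
    (hL : ∀ i,
      ((∑ j ∈ Finset.range (m i), MvPolynomial.C (co i j)
          * MvPolynomial.X ((i, j) : Fin r × ℕ))
        + MvPolynomial.X ((i, m i) : Fin r × ℕ)) ∈ Idelta (fun i => ePS (a i)))
    (hmin : ∀ i, ∀ n < m i, ∀ b : ℕ → RatFunc Qb,
      ((∑ j ∈ Finset.range n, MvPolynomial.C (b j)
          * MvPolynomial.X ((i, j) : Fin r × ℕ))
        + MvPolynomial.X ((i, n) : Fin r × ℕ)) ∉ Idelta (fun i => ePS (a i))) :
    Idelta (fun i => ePS (a i))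
      = ↑(sInf {J : Ideal (MvPolynomial (Fin r × ℕ) (RatFunc Qb)) |
          (∀ i, ((∑ j ∈ Finset.range (m i), MvPolynomial.C (co i j)
              * MvPolynomial.X ((i, j) : Fin r × ℕ))
            + MvPolynomial.X ((i, m i) : Fin r × ℕ)) ∈ J) ∧
          (∀ Q ∈ Idelta (fun i => ePS (a i)),
            (∀ v ∈ Q.vars, v.2 < m v.1) → Q ∈ J) ∧
          (∀ x ∈ J, deltaMv x ∈ J)}) := by
  have hLI := fun i => mem_IdeltaIdeal.2 (hL i)
  have hδ : ∀ P ∈ IdeltaIdeal (fun i => ePS (a i)),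
      deltaMv P ∈ IdeltaIdeal (fun i => ePS (a i)) :=
    fun P hP => mem_IdeltaIdeal.2 (deltaMv_mem_Idelta (mem_IdeltaIdeal.1 hP))
  refine (coe_IdeltaIdeal _).symm.trans (congrArg SetLike.coe (le_antisymm (le_sInf ?_) ?_))
  · rintro J ⟨hJL, hJm, hJδ⟩
    refine MvPolynomial.le_of_forall_vars_mem ratDerivation m co _ J (fun P hP => ?_)
      (fun P hP => ?_) hLI hJL (fun P hP => hJm P (mem_IdeltaIdeal.1 hP))
    · rw [← deltaMv_eq_shiftDerivation]
      exact hδ P hP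
    · rw [← deltaMv_eq_shiftDerivation]
      exact hJδ P hP
  · exact sInf_le ⟨hLI, fun Q hQ _ => mem_IdeltaIdeal.2 hQ, hδ⟩
end
end

section
/- Let q ≥ 2 be an integer and f_1, …, f_r be M_q-functions. For each i, let a_{i,0}(z) + a_{i,1}(z)σ_q + ⋯ + a_{i,m_i−1}(z)σ_q^{m_i−1} + σ_q^{m_i}, with a_{i,j} ∈ ℚ̄(z), be the monic σ_q-operator of minimal order annihilating f_i, and set L_i := a_{i,0}(z)X_{i,0} + ⋯ + a_{i,m_i−1}(z)X_{i,m_i−1} + X_{i,m_i}. Then, as a σ_q-ideal of ℚ̄(z)[(X_{i,j})_{1≤i≤r, j∈ℕ}], the ideal I^{σ_q}(f_1,…,f_r) is generated by the linear forms L_1, …, L_r together with the elements of I^{σ_q}_m(f_1,…,f_r) := I^{σ_q}(f_1,…,f_r) ∩ ℚ̄(z)[(X_{i,j})_{1≤i≤r, 0≤j<m_i}]. -/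
noncomputable section

/-- The endomorphism `z ↦ z^q` of `ℚ̄(z)`, computed via numerator and denominator. -/
def ratSig (q : ℕ) (f : RatFunc Qb) : RatFunc Qb :=
  algebraMap (Polynomial Qb) (RatFunc Qb) (f.num.comp (Polynomial.X ^ q))
    / algebraMap (Polynomial Qb) (RatFunc Qb) (f.denom.comp (Polynomial.X ^ q))

/-- The endomorphism `σ_q` of `ℚ̄(z)[(X_{i,j})]` acting as `z ↦ z^q` on `ℚ̄(z)` and
satisfying `σ_q(X_{i,j}) = X_{i,j+1}` (written out monomial by monomial). -/
def sigMv (q : ℕ) {r : ℕ} (Q : MvPolynomial (Fin r × ℕ) (RatFunc Qb)) :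
    MvPolynomial (Fin r × ℕ) (RatFunc Qb) :=
  ∑ s ∈ Q.support,
    MvPolynomial.monomial (Finsupp.mapDomain (fun v : Fin r × ℕ => (v.1, v.2 + 1)) s)
      (ratSig q (MvPolynomial.coeff s Q))

/-- The ideal `I^{σ_q}(f₁, …, f_r)` of `σ_q`-algebraic relations over `ℚ̄(z)` among the
complex power series `g 1, …, g r` and their successive images under `σ_q`: a polynomial
`Q ∈ ℚ̄(z)[(X_{i,j})]` belongs to it iff after clearing denominators (multiplication by a
nonzero `c ∈ ℚ̄[z]`) it becomes a polynomial over `ℚ̄[z]` vanishing under the substitution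
`X_{i,j} ↦ g_i(z^{q^j})`. -/
def Isigma (q : ℕ) {r : ℕ} (g : Fin r → PowerSeries ℂ) :
    Set (MvPolynomial (Fin r × ℕ) (RatFunc Qb)) :=
  {Q | ∃ c : Polynomial Qb, c ≠ 0 ∧
        ∃ Q' : MvPolynomial (Fin r × ℕ) (Polynomial Qb),
          MvPolynomial.map (algebraMap (Polynomial Qb) (RatFunc Qb)) Q'
            = MvPolynomial.C (algebraMap (Polynomial Qb) (RatFunc Qb) c) * Q ∧
          MvPolynomial.eval₂ polyQbPS (fun v => (psSigma q)^[v.2] (g v.1)) Q' = 0}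

/-! ### The ideal of relations -/

/-- Every polynomial over `ℚ̄(z)` becomes a polynomial over `ℚ̄[z]` after multiplication by a
nonzero element of `ℚ̄[z]`. -/
theorem exists_clear_denominators {τ : Type*} (P : MvPolynomial τ (RatFunc Qb)) :
    ∃ c : Polynomial Qb, c ≠ 0 ∧ ∃ P' : MvPolynomial τ (Polynomial Qb),
      MvPolynomial.map (algebraMap (Polynomial Qb) (RatFunc Qb)) P'
        = MvPolynomial.C (algebraMap (Polynomial Qb) (RatFunc Qb) c) * P := by
  let _ := MvPolynomial.algebraMvPolynomial (R := Polynomial Qb) (S := RatFunc Qb) (σ := τ)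
  obtain ⟨⟨P', s⟩, h⟩ := IsLocalization.surj
    (Submonoid.map (MvPolynomial.C (σ := τ)) (nonZeroDivisors (Polynomial Qb))) P
  obtain ⟨c, hc, hs⟩ := s.2
  refine ⟨c, nonZeroDivisors.ne_zero hc, P', ?_⟩
  simp only [← hs, MvPolynomial.algebraMap_def, MvPolynomial.map_C] at h
  rw [← h, mul_comm]

/-- `Isigma q g` as an ideal. -/
def IsigmaIdeal (q : ℕ) {r : ℕ} (g : Fin r → PowerSeries ℂ) :
    Ideal (MvPolynomial (Fin r × ℕ) (RatFunc Qb)) where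
  carrier := Isigma q g
  zero_mem' := ⟨1, one_ne_zero, 0, by simp, by simp⟩
  add_mem' := by
    rintro P Q ⟨c, hc, P', hP, hP0⟩ ⟨d, hd, Q', hQ, hQ0⟩
    refine ⟨c * d, mul_ne_zero hc hd, MvPolynomial.C d * P' + MvPolynomial.C c * Q', ?_, ?_⟩
    · simp only [map_add, map_mul, MvPolynomial.map_C, hP, hQ]
      ring
    · simp [MvPolynomial.eval₂_add, MvPolynomial.eval₂_mul, hP0, hQ0]
  smul_mem' := by
    rintro P Q ⟨d, hd, Q', hQ, hQ0⟩
    obtain ⟨c, hc, P', hP⟩ := exists_clear_denominators P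
    refine ⟨c * d, mul_ne_zero hc hd, P' * Q', ?_, ?_⟩
    · simp only [map_mul, hP, hQ, smul_eq_mul]
      ring
    · simp [MvPolynomial.eval₂_mul, hQ0]

/-! ### The Mahler operators as ring homomorphisms -/

theorem expand_eq_psSigma {q : ℕ} (hq : q ≠ 0) (f : PowerSeries ℂ) :
    PowerSeries.expand q hq f = psSigma q f := by
  ext n
  simp [psSigma, PowerSeries.coeff_expand]

theorem polyQbPS_expand {q : ℕ} (hq : q ≠ 0) (p : Polynomial Qb) :
    polyQbPS (Polynomial.expand Qb q p) = PowerSeries.expand q hq (polyQbPS p) := by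
  ext n
  simp only [polyQbPS, RingHom.comp_apply, Polynomial.coe_mapRingHom,
    Polynomial.coeToPowerSeries.ringHom_apply, Polynomial.coeff_coe, Polynomial.coeff_map,
    PowerSeries.coeff_expand, Polynomial.coeff_expand (Nat.pos_of_ne_zero hq)]
  split_ifs <;> simp

/-- The endomorphism `z ↦ z^q` of `ℚ̄(z)` as a ring homomorphism. -/
def ratSigHom {q : ℕ} (hq : q ≠ 0) : RatFunc Qb →+* RatFunc Qb :=
  RatFunc.mapRingHom (Polynomial.expand Qb q) fun p hp => by
    rw [Submonoid.mem_comap, mem_nonZeroDivisors_iff_ne_zero] at *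
    exact (Polynomial.expand_ne_zero (Nat.pos_of_ne_zero hq)).2 hp

theorem ratSigHom_apply {q : ℕ} (hq : q ≠ 0) (a : RatFunc Qb) : ratSigHom hq a = ratSig q a := by
  simp only [ratSigHom, ratSig, RatFunc.coe_mapRingHom_eq_coe_map, RatFunc.map_apply,
    Polynomial.expand_eq_comp_X_pow]

theorem ratSigHom_algebraMap {q : ℕ} (hq : q ≠ 0) (p : Polynomial Qb) :
    ratSigHom hq (algebraMap (Polynomial Qb) (RatFunc Qb) p)
      = algebraMap (Polynomial Qb) (RatFunc Qb) (Polynomial.expand Qb q p) := by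
  simp [ratSigHom_apply, ratSig, Polynomial.expand_eq_comp_X_pow]

/-- The ring homomorphism acting as `φ` on coefficients and as `X_{i,j} ↦ X_{i,j+1}`
on variables. -/
def shiftHom {R ι : Type*} [CommRing R] (φ : R →+* R) :
    MvPolynomial (ι × ℕ) R →+* MvPolynomial (ι × ℕ) R :=
  MvPolynomial.eval₂Hom (MvPolynomial.C.comp φ) fun v => MvPolynomial.X (v.1, v.2 + 1)

@[simp]
theorem shiftHom_C {R ι : Type*} [CommRing R] (φ : R →+* R) (a : R) :
    shiftHom (ι := ι) φ (MvPolynomial.C a) = MvPolynomial.C (φ a) := by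
  simp [shiftHom]

@[simp]
theorem shiftHom_X {R ι : Type*} [CommRing R] (φ : R →+* R) (v : ι × ℕ) :
    shiftHom φ (MvPolynomial.X v) = MvPolynomial.X (v.1, v.2 + 1) := by
  simp [shiftHom]

theorem shiftHom_iterate_C {R ι : Type*} [CommRing R] (φ : R →+* R) (n : ℕ) (a : R) :
    (shiftHom (ι := ι) φ)^[n] (MvPolynomial.C a) = MvPolynomial.C (φ^[n] a) := by
  induction n with
  | zero => rfl
  | succ n ih => rw [Function.iterate_succ_apply', ih, shiftHom_C, Function.iterate_succ_apply']

theorem shiftHom_iterate_X {R ι : Type*} [CommRing R] (φ : R →+* R) (n : ℕ) (v : ι × ℕ) :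
    (shiftHom φ)^[n] (MvPolynomial.X v) = MvPolynomial.X (v.1, v.2 + n) := by
  induction n with
  | zero => rfl
  | succ n ih => rw [Function.iterate_succ_apply', ih, shiftHom_X, add_assoc]

theorem shiftHom_eq_sigMv {q r : ℕ} (hq : q ≠ 0)
    (Q : MvPolynomial (Fin r × ℕ) (RatFunc Qb)) : shiftHom (ratSigHom hq) Q = sigMv q Q := by
  rw [shiftHom, MvPolynomial.coe_eval₂Hom, MvPolynomial.eval₂_eq, sigMv]
  refine Finset.sum_congr rfl fun s _ => ?_
  rw [MvPolynomial.monomial_eq, RingHom.comp_apply, ratSigHom_apply,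
    Finsupp.prod_mapDomain_index (by simp) (by simp [pow_add])]
  rfl

theorem sigMv_mem_Isigma {q r : ℕ} (hq : q ≠ 0) {g : Fin r → PowerSeries ℂ}
    {Q : MvPolynomial (Fin r × ℕ) (RatFunc Qb)} (hQ : Q ∈ Isigma q g) :
    sigMv q Q ∈ Isigma q g := by
  obtain ⟨c, hc, Q', hQ', h0⟩ := hQ
  let S' := shiftHom (ι := Fin r) (Polynomial.expand Qb q : Polynomial Qb →+* Polynomial Qb)
  refine ⟨Polynomial.expand Qb q c,
    (Polynomial.expand_ne_zero (Nat.pos_of_ne_zero hq)).2 hc, S' Q', ?_, ?_⟩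
  · have hcomm : (MvPolynomial.map (algebraMap (Polynomial Qb) (RatFunc Qb))).comp S'
        = (shiftHom (ratSigHom hq)).comp
          (MvPolynomial.map (algebraMap (Polynomial Qb) (RatFunc Qb))) := by
      apply MvPolynomial.ringHom_ext
      · intro p
        simp [S', ratSigHom_algebraMap]
      · intro v
        simp [S']
    rw [← RingHom.comp_apply, hcomm, RingHom.comp_apply, hQ', map_mul, shiftHom_C,
      ratSigHom_algebraMap, shiftHom_eq_sigMv]
  · let ev := MvPolynomial.eval₂Hom polyQbPS fun v : Fin r × ℕ => (psSigma q)^[v.2] (g v.1)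
    have hcomm : ev.comp S' = (PowerSeries.expand (R := ℂ) q hq).toRingHom.comp ev := by
      apply MvPolynomial.ringHom_ext
      · intro p
        simp [S', ev, polyQbPS_expand hq]
      · intro v
        simp [S', ev, expand_eq_psSigma, Function.iterate_succ_apply', -Function.iterate_succ]
    have := RingHom.congr_fun hcomm Q'
    rw [RingHom.comp_apply, RingHom.comp_apply] at this
    change ev Q' = 0 at h0
    rwa [h0, map_zero] at this

/-! ### Reduction modulo the linear forms -/

/-- Modulo a shift-stable ideal containing monic linear forms `L_i` of order `m i`, every
polynomial is congruent to one involving only the variables `X_{i,j}` with `j < m i`. -/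
theorem exists_reduced_sub_mem {K ι : Type*} [CommRing K] (φ : K →+* K)
    (m : ι → ℕ) (co : ι → ℕ → K) (J : Ideal (MvPolynomial (ι × ℕ) K))
    (hL : ∀ i, (∑ j ∈ Finset.range (m i), MvPolynomial.C (co i j)
        * MvPolynomial.X (i, j)) + MvPolynomial.X (i, m i) ∈ J)
    (hJ : ∀ x ∈ J, shiftHom φ x ∈ J) (Q : MvPolynomial (ι × ℕ) K) :
    ∃ R ∈ MvPolynomial.supported K {v : ι × ℕ | v.2 < m v.1}, Q - R ∈ J := by
  let A := MvPolynomial.supported K {v : ι × ℕ | v.2 < m v.1}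
  let T := (A.map (Ideal.Quotient.mkₐ K J)).comap (Ideal.Quotient.mkₐ K J)
  have hAT : A ≤ T := fun x hx => ⟨x, hx, rfl⟩
  have hJT : ∀ x ∈ J, x ∈ T := fun x hx =>
    ⟨0, A.zero_mem, by simp [Ideal.Quotient.eq_zero_iff_mem.2 hx]⟩
  have hX : ∀ v : ι × ℕ, MvPolynomial.X v ∈ T := by
    rintro ⟨i, j⟩
    induction j using Nat.strong_induction_on with
    | _ j ih =>
      by_cases hj : j < m i
      · exact hAT (Algebra.subset_adjoin ⟨(i, j), hj, rfl⟩)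
      · obtain ⟨n, rfl⟩ := Nat.exists_eq_add_of_le (not_lt.1 hj)
        have hiter : ∀ k, ∀ x ∈ J, (shiftHom φ)^[k] x ∈ J := fun k x hx =>
          Set.MapsTo.iterate (f := shiftHom φ) (s := {x | x ∈ J}) (fun x hx => hJ x hx) k hx
        have h := hJT _ (hiter n _ (hL i))
        rw [iterate_map_add, ← RingHom.coe_pow, map_sum, RingHom.coe_pow,
          shiftHom_iterate_X] at h
        refine (add_mem_cancel_left (sum_mem fun k hk => ?_)).1 h
        rw [iterate_map_mul, shiftHom_iterate_C, shiftHom_iterate_X]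
        exact mul_mem (T.algebraMap_mem _)
          (ih _ (Nat.add_lt_add_right (Finset.mem_range.1 hk) n))
  have hT : T = ⊤ := by
    rw [eq_top_iff, ← MvPolynomial.adjoin_range_X, Algebra.adjoin_le_iff]
    rintro _ ⟨v, rfl⟩
    exact hX v
  obtain ⟨R, hR, hRQ⟩ : Q ∈ T := hT ▸ Algebra.mem_top
  exact ⟨R, hR, Ideal.Quotient.eq.1 hRQ.symm⟩

/-- Let `f₁, …, f_r` be M_q-functions and, for each `i`, let
`a_{i,0} + a_{i,1}σ_q + ⋯ + a_{i,m_i-1}σ_q^{m_i-1} + σ_q^{m_i}` (coefficients in `ℚ̄(z)`) be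
the monic `σ_q`-operator of minimal order annihilating `f_i`, with associated linear form
`L_i = a_{i,0}X_{i,0} + ⋯ + a_{i,m_i-1}X_{i,m_i-1} + X_{i,m_i}`. Then, as a `σ_q`-ideal,
`I^{σ_q}(f₁, …, f_r)` is generated by `L₁, …, L_r` together with the elements of
`I^{σ_q}_m(f₁, …, f_r) = I^{σ_q}(f₁, …, f_r) ∩ ℚ̄(z)[(X_{i,j})_{j < m_i}]`; that is, it
coincides with the smallest ideal containing them that is stable under `σ_q`. -/
theorem sigma_ideal_generators
    (q : ℕ) (hq : 2 ≤ q)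
    (r : ℕ) (f : Fin r → PowerSeries ℂ) (hM : ∀ i, IsM q (f i))
    (m : Fin r → ℕ) (co : Fin r → ℕ → RatFunc Qb)
    (hL : ∀ i,
      ((∑ j ∈ Finset.range (m i), MvPolynomial.C (co i j)
          * MvPolynomial.X ((i, j) : Fin r × ℕ))
        + MvPolynomial.X ((i, m i) : Fin r × ℕ)) ∈ Isigma q f)
    (hmin : ∀ i, ∀ n < m i, ∀ b : ℕ → RatFunc Qb,
      ((∑ j ∈ Finset.range n, MvPolynomial.C (b j)
          * MvPolynomial.X ((i, j) : Fin r × ℕ))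
        + MvPolynomial.X ((i, n) : Fin r × ℕ)) ∉ Isigma q f) :
    Isigma q f
      = ↑(sInf {J : Ideal (MvPolynomial (Fin r × ℕ) (RatFunc Qb)) |
          (∀ i, ((∑ j ∈ Finset.range (m i), MvPolynomial.C (co i j)
              * MvPolynomial.X ((i, j) : Fin r × ℕ))
            + MvPolynomial.X ((i, m i) : Fin r × ℕ)) ∈ J) ∧
          (∀ Q ∈ Isigma q f, (∀ v ∈ Q.vars, v.2 < m v.1) → Q ∈ J) ∧
          (∀ x ∈ J, sigMv q x ∈ J)}) := by
  have hq0 : q ≠ 0 := by lia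
  apply Set.Subset.antisymm
  · intro Q hQ
    rw [SetLike.mem_coe, Submodule.mem_sInf]
    rintro J ⟨hLJ, hredJ, hsigJ⟩
    obtain ⟨R, hR, hQR⟩ := exists_reduced_sub_mem (ratSigHom hq0) m co (J ⊓ IsigmaIdeal q f)
      (fun i => ⟨hLJ i, hL i⟩)
      (fun x hx => by
        rw [shiftHom_eq_sigMv]
        exact ⟨hsigJ x hx.1, sigMv_mem_Isigma hq0 hx.2⟩) Q
    have hRI : R ∈ IsigmaIdeal q f := by
      simpa using sub_mem (show Q ∈ IsigmaIdeal q f from hQ) hQR.2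
    have hRJ : R ∈ J := hredJ R hRI fun v hv => MvPolynomial.mem_supported.1 hR hv
    simpa using add_mem hQR.1 hRJ
  · exact fun Q hQ => (Submodule.mem_sInf.1 hQ) (IsigmaIdeal q f)
      ⟨hL, fun _ h _ => h, fun _ h => sigMv_mem_Isigma hq0 h⟩
end
end
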